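/- Let (M,p) be a germ of a generic real-analytic submanifold of ℂ^N which is minimal at p, let M' ⊆ ℂ^{N'} be a generic real-analytic submanifold, and let H be a holomorphic map on a neighborhood of p with H(p) = p' ∈ M', H(M) ⊆ M' near p, and H finitely nondegenerate of order at most ℓ at p. If 𝔥𝔬𝔩(H) = {0}, then H is isolated among finitely nondegenerate maps of M into M': there exist a compact neighborhood K ⊆ dom(H) of p and δ > 0 such that every holomorphic map Ĥ defined on an open neighborhood of K with Ĥ(M ∩ K) ⊆ M', Ĥ finitely nondegenerate of order at most ℓ at p with Ĥ(p) ∈ M', and sup_{z ∈ K} |Ĥ(z) − H(z)| < δ, coincides with H on a neighborhood of p. -/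

import Mathlib

open Complex Topology

noncomputable section

/-- `ℂ^n`. -/
abbrev Cn (n : ℕ) : Type := EuclideanSpace ℂ (Fin n)

/-- `ℝ^m`. -/
abbrev Rm (m : ℕ) : Type := EuclideanSpace ℝ (Fin m)

/-- The vector of `ℂ^n` with entry `c` in the `j`-th coordinate and `0` elsewhere. -/
def cbasis {n : ℕ} (j : Fin n) (c : ℂ) : Cn n := EuclideanSpace.single j c

/-- The `j`-th component of the Wirtinger gradient `∂f(q)` of a real-valued function `f`. -/
def wirtD {n : ℕ} (f : Cn n → ℝ) (q : Cn n) : Fin n → ℂ := fun j =>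
  (1 / 2 : ℂ) * ((fderiv ℝ f q (cbasis j 1) : ℂ)
    - Complex.I * (fderiv ℝ f q (cbasis j Complex.I) : ℂ))

/-- The `j`-th component of `∂̄g(q)` for a complex-valued function `g`. -/
def wirtDBar {n : ℕ} (g : Cn n → ℂ) (q : Cn n) : Fin n → ℂ := fun j =>
  (1 / 2 : ℂ) * (fderiv ℝ g q (cbasis j 1) + Complex.I * fderiv ℝ g q (cbasis j Complex.I))

/-- The `j`-th component of `∂̄f(q)` for a real-valued function `f`. -/
def wirtDBarR {n : ℕ} (f : Cn n → ℝ) (q : Cn n) : Fin n → ℂ := fun j =>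
  (1 / 2 : ℂ) * ((fderiv ℝ f q (cbasis j 1) : ℂ)
    + Complex.I * (fderiv ℝ f q (cbasis j Complex.I) : ℂ))

/-- `M` is a generic real-analytic submanifold of codimension `d` near `p`. -/
def IsGenericAt {n : ℕ} (M : Set (Cn n)) (d : ℕ) (p : Cn n) : Prop :=
  p ∈ M ∧ ∃ (U : Set (Cn n)) (ρ : Cn n → Fin d → ℝ),
    IsOpen U ∧ p ∈ U ∧ (∀ k, AnalyticOnNhd ℝ (fun z => ρ z k) U) ∧
    (M ∩ U = {z | z ∈ U ∧ ∀ k, ρ z k = 0}) ∧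
    ∀ q ∈ M ∩ U, LinearIndependent ℂ (fun k : Fin d => wirtD (fun z => ρ z k) q)

/-- `S` is, near its point `q`, a real-analytic submanifold of (real) dimension `mdim`. -/
def IsRASubmanifoldAt {E : Type*} [NormedAddCommGroup E] [NormedSpace ℝ E]
    (S : Set E) (q : E) (mdim : ℕ) : Prop :=
  ∃ (c : ℕ) (U : Set E) (ρ : E → Fin c → ℝ),
    IsOpen U ∧ q ∈ U ∧ mdim + c = Module.finrank ℝ E ∧
    (∀ k, AnalyticOnNhd ℝ (fun z => ρ z k) U) ∧
    (S ∩ U = {z | z ∈ U ∧ ∀ k, ρ z k = 0}) ∧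
    ∀ x ∈ S ∩ U, LinearIndependent ℝ (fun k : Fin c => fderiv ℝ (fun z => ρ z k) x)

/-- The tangent space of a set at a point: the span of the tangent cone. -/
def tangentSpaceAt {E : Type*} [NormedAddCommGroup E] [NormedSpace ℝ E] (S : Set E) (q : E) :
    Submodule ℝ E := Submodule.span ℝ (tangentConeAt ℝ S q)

/-- Multiplication by `i` on `ℂ^n` as an `ℝ`-linear map. -/
def mulI {n : ℕ} : Cn n →ₗ[ℝ] Cn n :=
  (LinearMap.lsmul ℂ (Cn n) Complex.I).restrictScalars ℝ

/-- `M` (a generic submanifold of codimension `d`, hence of real dimension `2n - d`) is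
minimal at `p`: there is no real-analytic submanifold `S ⊆ M` through `p` of strictly
smaller dimension whose tangent spaces contain the complex tangent spaces of `M`. -/
def IsMinimalAt {n : ℕ} (M : Set (Cn n)) (d : ℕ) (p : Cn n) : Prop :=
  ¬ ∃ (S : Set (Cn n)) (mdim : ℕ), S ⊆ M ∧ p ∈ S ∧ mdim < 2 * n - d ∧
      (∀ q ∈ S, IsRASubmanifoldAt S q mdim) ∧
      ∀ q ∈ S, tangentSpaceAt M q ⊓ (tangentSpaceAt M q).map mulI ≤ tangentSpaceAt S q

/-- A real-analytic CR vector field of `M` near `p`. -/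
structure CRVectorField {N : ℕ} (M : Set (Cn N)) (p : Cn N) where
  coeff : Cn N → Fin N → ℂ
  dom : Set (Cn N)
  isOpen : IsOpen dom
  mem : p ∈ dom
  analytic : ∀ j, AnalyticOnNhd ℝ (fun z => coeff z j) dom
  tangent : ∀ (f : Cn N → ℝ) (U : Set (Cn N)), IsOpen U → p ∈ U → AnalyticOnNhd ℝ f U →
    (∀ z ∈ M ∩ U, f z = 0) →
    ∃ V, IsOpen V ∧ p ∈ V ∧ ∀ z ∈ M ∩ V, (∑ j, coeff z j * wirtDBarR f z j) = 0

/-- Application of a CR vector field to a complex-valued function. -/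
def CRVectorField.apply {N : ℕ} {M : Set (Cn N)} {p : Cn N} (L : CRVectorField M p)
    (g : Cn N → ℂ) : Cn N → ℂ := fun z => ∑ j, L.coeff z j * wirtDBar g z j

/-- Iterated application `L̄₁ ⋯ L̄ₖ g` of a list of CR vector fields. -/
def CRApplyList {N : ℕ} {M : Set (Cn N)} {p : Cn N} (Ls : List (CRVectorField M p))
    (g : Cn N → ℂ) : Cn N → ℂ := Ls.foldr CRVectorField.apply g

/-- `H` is finitely nondegenerate of order at most `ℓ` at `p` (as a map of `M` into `M'`). -/
def FinNondeg {N N' : ℕ} (M : Set (Cn N)) (p : Cn N) (M' : Set (Cn N')) (ℓ : ℕ)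
    (H : Cn N → Cn N') : Prop :=
  Submodule.span ℂ
    { v : Fin N' → ℂ | ∃ (Ls : List (CRVectorField M p)) (ρ' : Cn N' → ℝ) (U' : Set (Cn N')),
        Ls.length ≤ ℓ ∧ IsOpen U' ∧ H p ∈ U' ∧ AnalyticOnNhd ℝ ρ' U' ∧
        (∀ w ∈ M' ∩ U', ρ' w = 0) ∧
        v = fun j => CRApplyList Ls (fun z => wirtD ρ' (H z) j) p } = ⊤

/-- The mapping locus `E_ℓ ⊆ M'`. -/
def MappingLocus {N N' : ℕ} (M : Set (Cn N)) (p : Cn N) (M' : Set (Cn N')) (ℓ : ℕ) :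
    Set (Cn N') :=
  { p' | p' ∈ M' ∧ ∃ (Ω : Set (Cn N)) (H : Cn N → Cn N'),
      IsOpen Ω ∧ p ∈ Ω ∧ DifferentiableOn ℂ H Ω ∧ H p = p' ∧
      (∀ z ∈ M ∩ Ω, H z ∈ M') ∧ FinNondeg M p M' ℓ H }

/-- A semi-analytic subset of a real vector space. -/
def SemiAnalyticSet {E : Type*} [NormedAddCommGroup E] [NormedSpace ℝ E] (A : Set E) : Prop :=
  ∀ x : E, ∃ U : Set E, IsOpen U ∧ x ∈ U ∧
    ∃ (n k : ℕ) (f : Fin n → Fin k → E → ℝ) (iseq : Fin n → Fin k → Bool),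
      (∀ i j, AnalyticOnNhd ℝ (f i j) U) ∧
      A ∩ U = ⋃ i, ⋂ j, {x | x ∈ U ∧ if iseq i j then f i j x = 0 else 0 < f i j x}

/-- `A` is locally semi-analytic along `M'`. -/
def LocallySemiAnalyticOn {E : Type*} [NormedAddCommGroup E] [NormedSpace ℝ E]
    (M' A : Set E) : Prop :=
  ∀ q ∈ M', ∃ U : Set E, IsOpen U ∧ q ∈ U ∧ SemiAnalyticSet (A ∩ U)


/-- `Y` (defined and holomorphic on `ΩY ∋ p`) is an infinitesimal deformation of `H`, i.e.
`Re (∂ρ'(H(z)) ⬝ Y(z)) = 0` for `z ∈ M` near `p` and every `ρ' ∈ I_{p'}(M')`. -/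
def InHol {N N' : ℕ} (M : Set (Cn N)) (p : Cn N) (M' : Set (Cn N')) (p' : Cn N')
    (H : Cn N → Cn N') (Y : Cn N → Cn N') (ΩY : Set (Cn N)) : Prop :=
  IsOpen ΩY ∧ p ∈ ΩY ∧ DifferentiableOn ℂ Y ΩY ∧
  ∀ (ρ' : Cn N' → ℝ) (U' : Set (Cn N')), IsOpen U' → p' ∈ U' → AnalyticOnNhd ℝ ρ' U' →
    (∀ w ∈ M' ∩ U', ρ' w = 0) →
    ∃ V, IsOpen V ∧ p ∈ V ∧ ∀ z ∈ M ∩ V, (∑ j, wirtD ρ' (H z) j * Y z j).re = 0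

open Complex Topology
noncomputable section

/-! ### General facts on holomorphic maps between normed spaces -/

open Filter Metric Set in
/-- Cauchy estimate of first order. -/
lemma hol_fderiv_bound {E F : Type*} [NormedAddCommGroup E] [NormedSpace ℂ E]
    [NormedAddCommGroup F] [NormedSpace ℂ F] {f : E → F} {z : E} {r C : ℝ} (hr : 0 < r)
    (hd : DifferentiableOn ℂ f (ball z r)) (hC : ∀ x ∈ ball z r, ‖f x‖ ≤ C) :
    ‖fderiv ℂ f z‖ ≤ 2 * C / r := by
  apply Complex.norm_fderiv_le_div_of_mapsTo_ball hd _ hr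
  intro x hx
  rw [mem_closedBall, dist_eq_norm]
  calc ‖f x - f z‖ ≤ ‖f x‖ + ‖f z‖ := norm_sub_le _ _
    _ ≤ 2 * C := by linarith [hC x hx, hC z (mem_ball_self hr)]

open Filter Metric Set in
lemma hol_dist_bound {E F : Type*} [NormedAddCommGroup E] [NormedSpace ℂ E]
    [NormedAddCommGroup F] [NormedSpace ℂ F] {f : E → F} {z : E} {r C : ℝ} (hr : 0 < r)
    (hd : DifferentiableOn ℂ f (ball z r)) (hC : ∀ x ∈ ball z r, ‖f x‖ ≤ C) (x : E)
    (hx : x ∈ ball z r) :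
    ‖f x - f z‖ ≤ 2 * C / r * ‖x - z‖ := by
  rw [← dist_eq_norm, ← dist_eq_norm]
  apply Complex.dist_le_div_mul_dist_of_mapsTo_ball hd _ hx
  intro x hx
  rw [mem_closedBall, dist_eq_norm]
  calc ‖f x - f z‖ ≤ ‖f x‖ + ‖f z‖ := norm_sub_le _ _
    _ ≤ 2 * C := by linarith [hC x hx, hC z (mem_ball_self hr)]

open Filter Metric Set in
/-- Cauchy estimate of second order. -/
lemma hol_second_order {E F : Type*} [NormedAddCommGroup E] [NormedSpace ℂ E]
    [NormedAddCommGroup F] [NormedSpace ℂ F] {f : E → F} {z : E} {r C : ℝ} (hr : 0 < r)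
    (hd : DifferentiableOn ℂ f (ball z r)) (hC : ∀ x ∈ ball z r, ‖f x‖ ≤ C) (x : E)
    (hx : x ∈ ball z r) :
    ‖f x - f z - fderiv ℂ f z (x - z)‖ ≤ 4 * C * (‖x - z‖ / r) ^ 2 := by
  have hb := hol_fderiv_bound hr hd hC
  have hdz : DifferentiableAt ℂ f z := hd.differentiableAt (ball_mem_nhds z hr)
  have key := Complex.dist_le_mul_div_pow_of_mapsTo_ball_of_isLittleO (n := 1)
    (f := fun y => f y - fderiv ℂ f z (y - z)) (c := z) (z := x) (R₁ := r) (R₂ := 4 * C)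
    (hd.sub (by fun_prop)) ?_ ?_ hx
  · simp only [dist_eq_norm, sub_self, map_zero, sub_zero] at key
    have e : f x - f z - fderiv ℂ f z (x - z) = f x - fderiv ℂ f z (x - z) - f z := by abel
    rw [e]
    exact key
  · intro y hy
    rw [mem_closedBall, dist_eq_norm]
    simp only [sub_self, map_zero, sub_zero]
    have h1 : ‖fderiv ℂ f z (y - z)‖ ≤ 2 * C := by
      refine (ContinuousLinearMap.le_opNorm _ _).trans ?_
      rw [mem_ball, dist_eq_norm] at hy
      calc ‖fderiv ℂ f z‖ * ‖y - z‖ ≤ (2 * C / r) * r := by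
            apply mul_le_mul hb hy.le (norm_nonneg _)
            exact (norm_nonneg _).trans hb
        _ = 2 * C := by field_simp
    calc ‖f y - fderiv ℂ f z (y - z) - f z‖ ≤ ‖f y - fderiv ℂ f z (y - z)‖ + ‖f z‖ := norm_sub_le _ _
      _ ≤ ‖f y‖ + ‖fderiv ℂ f z (y - z)‖ + ‖f z‖ := by gcongr; exact norm_sub_le _ _
      _ ≤ 4 * C := by linarith [hC y hy, hC z (mem_ball_self hr)]
  · have := hdz.hasFDerivAt.isLittleO
    simp only [sub_self, map_zero, sub_zero, pow_one]
    refine (this.norm_right).congr_left ?_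
    intro y
    abel

open Filter Metric Set in
/-- Ultrafilter limits of bounded holomorphic maps are holomorphic. -/
lemma hol_ulim {ι : Type*} (l : Ultrafilter ι) {E F : Type*} [NormedAddCommGroup E]
    [NormedSpace ℂ E] [FiniteDimensional ℂ E]
    [NormedAddCommGroup F] [NormedSpace ℂ F] [FiniteDimensional ℂ F] {f : ι → E → F} {g : E → F}
    {z : E} {r C : ℝ} (hr : 0 < r)
    (hd : ∀ᶠ i in (l : Filter ι), DifferentiableOn ℂ (f i) (ball z r))
    (hC : ∀ᶠ i in (l : Filter ι), ∀ x ∈ ball z r, ‖f i x‖ ≤ C)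
    (hg : ∀ x ∈ ball z r, Tendsto (fun i => f i x) l (𝓝 (g x))) :
    DifferentiableAt ℂ g z := by
  haveI : ProperSpace (E →L[ℂ] F) := FiniteDimensional.proper ℂ _
  obtain ⟨A, -, hA⟩ : ∃ A ∈ closedBall (0 : E →L[ℂ] F) (2 * C / r),
      Tendsto (fun i => fderiv ℂ (f i) z) l (𝓝 A) := by
    have := (isCompact_closedBall (0 : E →L[ℂ] F) (2 * C / r)).ultrafilter_le_nhds
      (l.map (fun i => fderiv ℂ (f i) z)) ?_
    · exact this
    · rw [le_principal_iff]
      change ∀ᶠ i in (l : Filter ι), _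
      filter_upwards [hd, hC] with i h1 h2
      simpa using hol_fderiv_bound hr h1 h2
  have hC0 : 0 ≤ C := by
    obtain ⟨i, hi⟩ := hC.exists
    exact (norm_nonneg _).trans (hi z (mem_ball_self hr))
  have key : ∀ x ∈ ball z r, ‖g x - g z - A (x - z)‖ ≤ 4 * C * (‖x - z‖ / r) ^ 2 := by
    intro x hx
    have ht : Tendsto (fun i => ‖f i x - f i z - fderiv ℂ (f i) z (x - z)‖) l
        (𝓝 ‖g x - g z - A (x - z)‖) := by
      refine (((hg x hx).sub (hg z (mem_ball_self hr))).sub ?_).norm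
      exact ((ContinuousLinearMap.apply ℂ F (x - z)).continuous.tendsto A).comp hA
    refine le_of_tendsto ht ?_
    filter_upwards [hd, hC] with i h1 h2
    exact hol_second_order hr h1 h2 x hx
  refine HasFDerivAt.differentiableAt (f' := A) ?_
  rw [hasFDerivAt_iff_isLittleO]
  have hO : (fun x => g x - g z - A (x - z)) =O[𝓝 z] fun x => ‖x - z‖ ^ 2 := by
    refine Asymptotics.IsBigO.of_bound (4 * C / r ^ 2) ?_
    filter_upwards [ball_mem_nhds z hr] with x hx
    refine (key x hx).trans (le_of_eq ?_)
    rw [norm_pow, norm_norm]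
    field_simp
  refine hO.trans_isLittleO ?_
  have := (Asymptotics.isLittleO_norm_pow_id (E' := E) (n := 2) (by norm_num))
  have h2 := this.comp_tendsto (k := fun x => x - z) (l' := 𝓝 z)
    (by
      have : Continuous (fun x : E => x - z) := by fun_prop
      simpa using this.tendsto z)
  exact h2

open Filter Metric Set in
/-- Directional derivatives of holomorphic maps are holomorphic. -/
lemma hol_fderiv_apply {E F : Type*} [NormedAddCommGroup E]
    [NormedSpace ℂ E] [FiniteDimensional ℂ E]
    [NormedAddCommGroup F] [NormedSpace ℂ F] [FiniteDimensional ℂ F] {f : E → F}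
    {U : Set E} (hU : IsOpen U) (hf : DifferentiableOn ℂ f U) (v : E) :
    DifferentiableOn ℂ (fun z => fderiv ℂ f z v) U := by
  intro z hz
  apply DifferentiableAt.differentiableWithinAt
  -- a ball on which f is bounded
  have hcont : ContinuousAt f z := (hf.differentiableAt (hU.mem_nhds hz)).continuousAt
  obtain ⟨R, hR, hRU⟩ : ∃ R > 0, ball z R ⊆ U ∩ {x | ‖f x‖ < ‖f z‖ + 1} := by
    apply Metric.mem_nhds_iff.1
    refine inter_mem (hU.mem_nhds hz) ?_
    exact hcont.norm.eventually (gt_mem_nhds (by linarith))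
  set C := ‖f z‖ + 1
  let l : Ultrafilter ℂ := Ultrafilter.of (𝓝[≠] (0:ℂ))
  have hl : (l : Filter ℂ) ≤ 𝓝[≠] (0:ℂ) := Ultrafilter.of_le _
  set r := R / 3 with hr
  have hr0 : 0 < r := by positivity
  have hsmall : ∀ᶠ t : ℂ in (l : Filter ℂ), ‖t • v‖ < r ∧ t ≠ 0 := by
    refine hl ?_
    refine inter_mem ?_ self_mem_nhdsWithin
    refine mem_nhdsWithin_of_mem_nhds ?_
    have : Tendsto (fun t : ℂ => ‖t • v‖) (𝓝 0) (𝓝 0) := by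
      have : Continuous (fun t : ℂ => ‖t • v‖) := by fun_prop
      simpa using this.tendsto 0
    exact this.eventually (gt_mem_nhds hr0)
  refine hol_ulim l (f := fun t x => t⁻¹ • (f (x + t • v) - f x)) (z := z) (r := r)
    (C := 2 * C / r * ‖v‖) hr0 ?_ ?_ ?_
  · filter_upwards [hsmall] with t ht
    refine DifferentiableOn.const_smul (DifferentiableOn.sub ?_ ?_) _
    · refine hf.comp (by fun_prop) ?_
      intro x hx
      refine (hRU ?_).1
      rw [mem_ball, dist_eq_norm] at hx ⊢
      calc ‖x + t • v - z‖ = ‖(x - z) + t • v‖ := by congr 1; abel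
        _ ≤ ‖x - z‖ + ‖t • v‖ := norm_add_le _ _
        _ < R := by linarith [ht.1]
    · refine hf.mono fun x hx => (hRU ?_).1
      exact ball_subset_ball (by linarith) hx
  · filter_upwards [hsmall] with t ht x hx
    have h1 : ball x r ⊆ ball z R := by
      apply ball_subset_ball'
      rw [mem_ball] at hx
      linarith
    have := hol_dist_bound (f := f) (z := x) (C := C) hr0
      (hf.mono fun y hy => (hRU (h1 hy)).1) (fun y hy => (hRU (h1 hy)).2.le) (x + t • v)
      (by simpa [mem_ball, dist_eq_norm] using ht.1)
    rw [norm_smul, norm_inv]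
    rw [add_sub_cancel_left, norm_smul] at this
    have ht0 : 0 < ‖t‖ := norm_pos_iff.2 ht.2
    rw [inv_mul_le_iff₀ ht0]
    linarith
  · intro x hx
    have hxU : x ∈ U := (hRU (ball_subset_ball (by linarith) hx)).1
    have h := (hf.differentiableAt (hU.mem_nhds hxU)).hasFDerivAt.hasLineDerivAt v
    exact (h.tendsto_slope_zero).mono_left hl

/-- Holomorphic maps in several variables are smooth. -/
lemma hol_contDiffOn {E F : Type*} [NormedAddCommGroup E]
    [NormedSpace ℂ E] [FiniteDimensional ℂ E]
    [NormedAddCommGroup F] [NormedSpace ℂ F] [FiniteDimensional ℂ F] {U : Set E} (hU : IsOpen U)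
    (n : ℕ) : ∀ {f : E → F}, DifferentiableOn ℂ f U → ContDiffOn ℂ n f U := by
  induction n with
  | zero => intro f hf; simpa using hf.continuousOn
  | succ n ih =>
    intro f hf
    push_cast
    rw [contDiffOn_succ_iff_fderiv_of_isOpen hU]
    refine ⟨hf, by simp, ?_⟩
    rw [contDiffOn_clm_apply]
    intro v
    exact ih (hol_fderiv_apply hU hf v)

lemma hol_contDiffAt {E F : Type*} [NormedAddCommGroup E]
    [NormedSpace ℂ E] [FiniteDimensional ℂ E]
    [NormedAddCommGroup F] [NormedSpace ℂ F] [FiniteDimensional ℂ F] {U : Set E} (hU : IsOpen U)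
    {f : E → F} (hf : DifferentiableOn ℂ f U) {x : E} (hx : x ∈ U) :
    ContDiffAt ℂ (⊤ : ℕ∞) f x := by
  rw [contDiffAt_infty]
  intro n
  exact (hol_contDiffOn hU n hf).contDiffAt (hU.mem_nhds hx)

open Filter Metric Set in
/-- Identity theorem on lines. -/
lemma hol_line_zero {F : Type*} [NormedAddCommGroup F] [NormedSpace ℂ F] [CompleteSpace F]
    {f : ℂ → F} {r : ℝ} (hd : DifferentiableOn ℂ f (ball 0 r))
    (h0 : ∃ᶠ t in 𝓝[≠] (0:ℂ), f t = 0) (z : ℂ) (hz : z ∈ ball (0:ℂ) r) :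
    f z = 0 := by
  have hr : 0 < r := nonempty_ball.mp ⟨z, hz⟩
  have := (hd.analyticOnNhd isOpen_ball).eqOn_zero_of_preconnected_of_frequently_eq_zero
    (convex_ball (0:ℂ) r).isPreconnected (mem_ball_self hr) h0
  exact this hz

open Filter Metric Set in
/-- Identity theorem on balls. -/
lemma hol_ball_zero {E F : Type*} [NormedAddCommGroup E] [NormedSpace ℂ E]
    [NormedAddCommGroup F] [NormedSpace ℂ F] [CompleteSpace F]
    {f : E → F} {x : E} {R : ℝ} (hd : DifferentiableOn ℂ f (ball x R)) {y : E}
    (hy : y ∈ ball x R) (h0 : ∀ᶠ y' in 𝓝 y, f y' = 0) : ∀ z ∈ ball x R, f z = 0 := by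
  intro z hz
  let L : ℂ → E := fun t => y + t • (z - y)
  have hL : Continuous L := by fun_prop
  have hLd : Differentiable ℂ L := by fun_prop
  have hconv : Convex ℝ (L ⁻¹' ball x R) := by
    intro a ha b hb s t hs ht hst
    have h1 : L (s • a + t • b) = s • L a + t • L b := by
      simp only [L]
      have hst' : (s : ℂ) + t = 1 := by exact_mod_cast hst
      rw [← Complex.coe_smul, ← Complex.coe_smul, ← Complex.coe_smul, ← Complex.coe_smul]
      have ht' : (t : ℂ) = 1 - s := by linear_combination hst'
      rw [ht']
      simp only [smul_eq_mul]
      module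
    rw [mem_preimage, h1]
    exact convex_ball x R ha hb hs ht hst
  have hopen : IsOpen (L ⁻¹' ball x R) := isOpen_ball.preimage hL
  have hdf : DifferentiableOn ℂ (fun t => f (L t)) (L ⁻¹' ball x R) :=
    hd.comp hLd.differentiableOn (fun t ht => ht)
  have h0' : ∀ᶠ t in 𝓝 (0:ℂ), f (L t) = 0 := by
    have : Tendsto L (𝓝 0) (𝓝 y) := by simpa [L] using hL.tendsto 0
    exact this.eventually h0
  have := (hdf.analyticOnNhd hopen).eqOn_zero_of_preconnected_of_eventuallyEq_zero
    hconv.isPreconnected (z₀ := 0) (by simpa [L] using hy) h0'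
  have h1 := this (x := 1) (by simpa [L] using hz)
  simpa [L] using h1

end

open Complex Topology
noncomputable section

/-! ### Conjugations -/

/-- coordinatewise conjugation -/
def cj {n : ℕ} : Cn n ≃ₛₗᵢ[starRingEnd ℂ] Cn n where
  toFun x := WithLp.toLp 2 (fun i => (starRingEnd ℂ) (x i))
  invFun x := WithLp.toLp 2 (fun i => (starRingEnd ℂ) (x i))
  map_add' x y := by ext i; simp
  map_smul' c x := by ext i; simp
  left_inv x := by ext i; simp
  right_inv x := by ext i; simp
  norm_map' x := by simp [EuclideanSpace.norm_eq]

@[simp] lemma cj_apply {n : ℕ} (x : Cn n) (i : Fin n) : cj x i = (starRingEnd ℂ) (x i) := rfl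

@[simp] lemma cj_cj {n : ℕ} (x : Cn n) : cj (cj x) = x := by ext i; simp

/-- product of two conjugations -/
def pj {E F : Type*} [NormedAddCommGroup E] [NormedSpace ℂ E]
    [NormedAddCommGroup F] [NormedSpace ℂ F] (a : E ≃ₛₗᵢ[starRingEnd ℂ] E)
    (b : F ≃ₛₗᵢ[starRingEnd ℂ] F) : (E × F) ≃ₛₗᵢ[starRingEnd ℂ] (E × F) where
  toFun x := (a x.1, b x.2)
  invFun x := (a.symm x.1, b.symm x.2)
  map_add' x y := by simp
  map_smul' c x := by simp [map_smulₛₗ]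
  left_inv x := by simp
  right_inv x := by simp
  norm_map' x := by simp [Prod.norm_def]

@[simp] lemma pj_apply {E F : Type*} [NormedAddCommGroup E] [NormedSpace ℂ E]
    [NormedAddCommGroup F] [NormedSpace ℂ F] (a : E ≃ₛₗᵢ[starRingEnd ℂ] E)
    (b : F ≃ₛₗᵢ[starRingEnd ℂ] F) (x : E × F) : pj a b x = (a x.1, b x.2) := rfl

/-- the doubled space -/
abbrev CC (N : ℕ) : Type := Cn N × Cn N

/-- the real structure of the doubled space -/
def sg {N : ℕ} : CC N ≃ₛₗᵢ[starRingEnd ℂ] CC N where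
  toFun x := (cj x.2, cj x.1)
  invFun x := (cj x.2, cj x.1)
  map_add' x y := by simp
  map_smul' c x := by simp [map_smulₛₗ]
  left_inv x := by simp
  right_inv x := by simp
  norm_map' x := by
    simp only [LinearEquiv.coe_mk, LinearMap.coe_mk, AddHom.coe_mk, Prod.norm_def,
      LinearIsometryEquiv.norm_map]
    exact max_comm _ _

@[simp] lemma sg_apply {N : ℕ} (x : CC N) : sg x = (cj x.2, cj x.1) := rfl

lemma sg_sg {N : ℕ} (x : CC N) : sg (sg x) = x := by simp

section conj

variable {E F : Type*} [NormedAddCommGroup E] [NormedSpace ℂ E]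
    [NormedAddCommGroup F] [NormedSpace ℂ F] (a : E ≃ₛₗᵢ[starRingEnd ℂ] E)
    (b : F ≃ₛₗᵢ[starRingEnd ℂ] F)

/-- conjugate of a linear map -/
def conjCLM (f : E →L[ℂ] F) : E →L[ℂ] F :=
  LinearMap.mkContinuous
    { toFun := fun x => b (f (a x))
      map_add' := fun x y => by simp
      map_smul' := fun c x => by simp [map_smulₛₗ] } ‖f‖ (fun x => by
        simp only [LinearMap.coe_mk, AddHom.coe_mk, LinearIsometryEquiv.norm_map]
        simpa using f.le_opNorm (a x))

@[simp] lemma conjCLM_apply (f : E →L[ℂ] F) (x : E) : conjCLM a b f x = b (f (a x)) := rfl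

open Asymptotics in
lemma HasFDerivAt.conj' {f : E → F} {f' : E →L[ℂ] F} {x : E} (hf : HasFDerivAt f f' (a x)) :
    HasFDerivAt (fun y => b (f (a y))) (conjCLM a b f') x := by
  rw [hasFDerivAt_iff_isLittleO] at hf ⊢
  have h := hf.comp_tendsto (a.continuous.tendsto x)
  refine (isLittleO_norm_norm.1 ?_)
  refine (isLittleO_norm_norm.2 h).congr ?_ ?_
  · intro y
    simp only [Function.comp, conjCLM_apply]
    rw [← map_sub b, ← map_sub b, LinearIsometryEquiv.norm_map, map_sub a]
  · intro y
    simp only [Function.comp]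
    rw [← map_sub, LinearIsometryEquiv.norm_map]

lemma DifferentiableAt.conj' {f : E → F} {x : E} (hf : DifferentiableAt ℂ f (a x)) :
    DifferentiableAt ℂ (fun y => b (f (a y))) x :=
  (hf.hasFDerivAt.conj' a b).differentiableAt

/-- conjugate of a multilinear map -/
def conjCMM {n : ℕ} (f : E [×n]→L[ℂ] F) : E [×n]→L[ℂ] F :=
  MultilinearMap.mkContinuous
    { toFun := fun x => b (f (fun i => a (x i)))
      map_update_add' := fun {_} m i x y => by
        have (z : E) : (fun j => a (Function.update m i z j)) =
            Function.update (fun j => a (m j)) i (a z) := by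
          ext j; by_cases h : j = i
          · subst h; simp
          · simp [h]
        simp [this]
      map_update_smul' := fun {_} m i c x => by
        have (z : E) : (fun j => a (Function.update m i z j)) =
            Function.update (fun j => a (m j)) i (a z) := by
          ext j; by_cases h : j = i
          · subst h; simp
          · simp [h]
        simp [map_smulₛₗ, this] } ‖f‖ (fun x => by
        simp only [MultilinearMap.coe_mk, LinearIsometryEquiv.norm_map]
        simpa using f.le_opNorm (fun i => a (x i)))

lemma conjCMM_apply {n : ℕ} (f : E [×n]→L[ℂ] F) (x : Fin n → E) :
    conjCMM a b f x = b (f (fun i => a (x i))) := rfl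

lemma conjCMM_norm {n : ℕ} (f : E [×n]→L[ℂ] F) : ‖conjCMM a b f‖ ≤ ‖f‖ :=
  MultilinearMap.mkContinuous_norm_le _ (norm_nonneg _) _

lemma AnalyticAt.conj' {f : E → F} {x : E} (hf : AnalyticAt ℂ f (a x)) :
    AnalyticAt ℂ (fun y => b (f (a y))) x := by
  obtain ⟨q, r, h⟩ := hf
  refine ⟨fun n => conjCMM a b (q n), r, ?_, h.r_pos, ?_⟩
  · exact h.r_le.trans (FormalMultilinearSeries.radius_le_of_le (fun n => conjCMM_norm a b (q n)))
  · intro y hy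
    have h1 : a y ∈ Metric.eball (0 : E) r := by
      simpa [Metric.mem_eball, edist_zero_right, enorm_eq_nnnorm] using hy
    have := (h.hasSum h1).map (b : F →+ F) b.continuous
    simp only [map_add] 
    exact this

end conj
end

open Complex Topology
noncomputable section

/-! ### Inverse functions, straightening, constant rank -/

section inv
open Filter

variable {X Y Z : Type*} [NormedAddCommGroup X] [NormedSpace ℂ X] [FiniteDimensional ℂ X]
  [NormedAddCommGroup Y] [NormedSpace ℂ Y] [FiniteDimensional ℂ Y]
  [NormedAddCommGroup Z] [NormedSpace ℂ Z] [FiniteDimensional ℂ Z]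

lemma inv_analytic {f : X → Y} {a : X} (hf : AnalyticAt ℂ f a)
    (hb : Function.Bijective (fderiv ℂ f a)) :
    ∃ g : Y → X, AnalyticAt ℂ g (f a) ∧ g (f a) = a ∧ (∀ᶠ x in 𝓝 a, g (f x) = x) ∧
      ∀ᶠ y in 𝓝 (f a), f (g y) = y := by
  have : CompleteSpace X := FiniteDimensional.complete ℂ X
  have : CompleteSpace Y := FiniteDimensional.complete ℂ Y
  let e : X ≃L[ℂ] Y := (LinearEquiv.ofBijective (fderiv ℂ f a : X →ₗ[ℂ] Y) hb).toContinuousLinearEquiv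
  have he : (e : X →L[ℂ] Y) = fderiv ℂ f a := by ext v; rfl
  have hs : HasStrictFDerivAt f (e : X →L[ℂ] Y) a := by rw [he]; exact hf.hasStrictFDerivAt
  refine ⟨hs.localInverse f e a, ?_, hs.localInverse_apply_image, hs.eventually_left_inverse,
    hs.eventually_right_inverse⟩
  have h1 : ContDiffAt ℂ ⊤ f a := hf.contDiffAt
  have h2 := h1.to_localInverse (f' := e) hs.hasFDerivAt (by simp)
  exact (h2.analyticAt)

/-- A linear left inverse of the inclusion of a kernel. -/
lemma exists_proj (K : Submodule ℂ X) : ∃ l : X →L[ℂ] K, ∀ v : K, l v = v := by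
  obtain ⟨l, hl⟩ := (Submodule.ClosedComplemented.of_finiteDimensional K : _)
  exact ⟨l, hl⟩

lemma bij_straight (A : X →L[ℂ] Y) (hA : Function.Surjective A)
    (l : X →L[ℂ] A.ker) (hl : ∀ v : A.ker, l v = v) :
    Function.Bijective (A.prod l) := by
  constructor
  · rw [injective_iff_map_eq_zero]
    intro v hv
    simp only [ContinuousLinearMap.prod_apply, Prod.mk_eq_zero] at hv
    have h1 : v ∈ A.ker := hv.1
    have := (hl ⟨v, h1⟩).symm.trans hv.2
    exact congrArg Subtype.val this
  · rintro ⟨y, s⟩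
    obtain ⟨x, rfl⟩ := hA y
    refine ⟨x + (s - l x : A.ker), ?_⟩
    simp only [ContinuousLinearMap.prod_apply, map_add, hl]
    have : A ((s - l x : A.ker) : X) = 0 := (s - l x).2
    rw [this]; simp

lemma straighten {g : X → Y} {a : X} (hg : AnalyticAt ℂ g a)
    (hA : Function.Surjective (fderiv ℂ g a))
    (l : X →L[ℂ] (fderiv ℂ g a).ker) (hl : ∀ v : (fderiv ℂ g a).ker, l v = v) :
    ∃ Γ : Y × (fderiv ℂ g a).ker → X, AnalyticAt ℂ Γ (g a, l a) ∧ Γ (g a, l a) = a ∧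
      (∀ᶠ x in 𝓝 a, Γ (g x, l x) = x) ∧
      ∀ᶠ y in 𝓝 (g a, l a), g (Γ y) = y.1 ∧ l (Γ y) = y.2 := by
  have hd : fderiv ℂ (fun x => (g x, l x)) a = (fderiv ℂ g a).prod l := by
    rw [DifferentiableAt.fderiv_prodMk hg.differentiableAt l.differentiableAt]
    simp
  obtain ⟨Γ, h1, h2, h3, h4⟩ := inv_analytic (f := fun x => (g x, l x)) (a := a)
    (hg.prod (l.analyticAt a)) (by rw [hd]; exact bij_straight _ hA l hl)
  exact ⟨Γ, h1, h2, h3, h4.mono fun y hy => ⟨congrArg Prod.fst hy, congrArg Prod.snd hy⟩⟩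

lemma straighten' {g : X → Y} {a : X} (hg : AnalyticAt ℂ g a)
    (hA : Function.Surjective (fderiv ℂ g a)) :
    ∃ K : Submodule ℂ X, K = (fderiv ℂ g a).ker ∧ ∃ (l : X →L[ℂ] K) (Γ : Y × K → X),
      AnalyticAt ℂ Γ (g a, l a) ∧ Γ (g a, l a) = a ∧
      (∀ᶠ x in 𝓝 a, Γ (g x, l x) = x) ∧
      ∀ᶠ y in 𝓝 (g a, l a), g (Γ y) = y.1 ∧ l (Γ y) = y.2 := by
  obtain ⟨l, hl⟩ := exists_proj (fderiv ℂ g a).ker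
  exact ⟨_, rfl, l, straighten hg hA l hl⟩

/-- Constant rank theorem. -/
lemma const_rank {E : X → Y} {x0 : X} (hE : AnalyticAt ℂ E x0) {m : ℕ}
    (hle : ∀ᶠ x in 𝓝 x0, Module.finrank ℂ (fderiv ℂ E x).range ≤ m)
    (hge : m ≤ Module.finrank ℂ (fderiv ℂ E x0).range) :
    ∃ h : Y → Y, AnalyticAt ℂ h (E x0) ∧ (∀ᶠ x in 𝓝 x0, h (E x) = 0) ∧
      Module.finrank ℂ (fderiv ℂ h (E x0)).ker ≤ m := by
  set R := (fderiv ℂ E x0).range with hR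
  obtain ⟨q, hq⟩ := exists_proj R
  have hRm : Module.finrank ℂ R = m := le_antisymm hle.self_of_nhds hge
  let g : X → R := fun x => q (E x)
  have hg : AnalyticAt ℂ g x0 := (q.analyticAt _).comp hE
  have hgd : ∀ x, DifferentiableAt ℂ E x → fderiv ℂ g x = q.comp (fderiv ℂ E x) := fun x hx =>
    (q.hasFDerivAt.comp x hx.hasFDerivAt).fderiv
  have hsurj : Function.Surjective (fderiv ℂ g x0) := by
    rintro ⟨y, v, rfl⟩
    refine ⟨v, ?_⟩
    rw [hgd x0 hE.differentiableAt]
    exact hq ⟨fderiv ℂ E x0 v, v, rfl⟩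
  obtain ⟨K, hK, l, Γ, hΓ, hΓ0, hΓl, hΓr⟩ := straighten' hg hsurj
  set y0 : R × K := (g x0, l x0) with hy0
  have hΓt : Tendsto Γ (𝓝 y0) (𝓝 x0) := by
    have := hΓ.continuousAt.tendsto; rwa [hΓ0] at this
  have hEd : ∀ᶠ x in 𝓝 x0, DifferentiableAt ℂ E x :=
    hE.eventually_analyticAt.mono fun x hx => hx.differentiableAt
  have hev : ∀ᶠ y in 𝓝 y0, DifferentiableAt ℂ Γ y ∧ DifferentiableAt ℂ E (Γ y) ∧
      Module.finrank ℂ (fderiv ℂ E (Γ y)).range ≤ m ∧ ∀ᶠ y' in 𝓝 y, g (Γ y') = y'.1 := by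
    filter_upwards [hΓ.eventually_analyticAt, hΓt.eventually hEd, hΓt.eventually hle,
      hΓr.eventually_nhds] with y h1 h2 h3 h4
    exact ⟨h1.differentiableAt, h2, h3, h4.mono fun _ h => h.1⟩
  have hzero : ∀ᶠ y in 𝓝 y0, DifferentiableAt ℂ (fun y => E (Γ y)) y ∧
      ∀ s : K, fderiv ℂ (fun y => E (Γ y)) y (0, s) = 0 := by
    filter_upwards [hev] with y ⟨h1, h2, h3, h4⟩
    refine ⟨h2.comp y h1, ?_⟩
    have hc : fderiv ℂ (fun y => E (Γ y)) y = (fderiv ℂ E (Γ y)).comp (fderiv ℂ Γ y) :=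
      fderiv_comp (g := E) y h2 h1
    have hc2 : (q.comp (fderiv ℂ E (Γ y))).comp (fderiv ℂ Γ y) = ContinuousLinearMap.fst ℂ R K := by
      rw [← hgd _ h2]
      have e1 : HasFDerivAt (fun y => g (Γ y)) ((fderiv ℂ g (Γ y)).comp (fderiv ℂ Γ y)) y :=
        HasFDerivAt.comp (g := g) y (q.differentiableAt.comp _ h2).hasFDerivAt h1.hasFDerivAt
      have e2 : HasFDerivAt (fun y : R × K => y.1) (ContinuousLinearMap.fst ℂ R K) y :=
        hasFDerivAt_fst
      exact e1.unique (e2.congr_of_eventuallyEq h4)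
    -- q is injective on the range of the derivative
    have hinj : Function.Injective
        ((q : Y →ₗ[ℂ] R).comp (fderiv ℂ E (Γ y)).range.subtype) := by
      have hs : Function.Surjective
          ((q : Y →ₗ[ℂ] R).comp (fderiv ℂ E (Γ y)).range.subtype) := by
        intro r
        refine ⟨⟨fderiv ℂ E (Γ y) (fderiv ℂ Γ y (r, 0)), _, rfl⟩, ?_⟩
        have := DFunLike.congr_fun hc2 (r, 0)
        exact this
      have hfr := LinearMap.finrank_range_add_finrank_ker
        ((q : Y →ₗ[ℂ] R).comp (fderiv ℂ E (Γ y)).range.subtype)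
      rw [LinearMap.range_eq_top.2 hs, finrank_top, hRm] at hfr
      rw [← LinearMap.ker_eq_bot, ← Submodule.finrank_eq_zero (R := ℂ)]
      omega
    intro s
    rw [hc]
    have h0 : q (fderiv ℂ E (Γ y) (fderiv ℂ Γ y (0, s))) = 0 := DFunLike.congr_fun hc2 (0, s)
    have := (injective_iff_map_eq_zero _).1 hinj
      ⟨fderiv ℂ E (Γ y) (fderiv ℂ Γ y (0, s)), _, rfl⟩ h0
    exact congrArg Subtype.val this
  obtain ⟨ε, hε, hball⟩ := Metric.eventually_nhds_iff_ball.1 hzero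
  have hconst : ∀ y ∈ Metric.ball y0 ε, E (Γ y) = E (Γ (y.1, l x0)) := by
    intro y hy
    have hy1 : y.1 ∈ Metric.ball (g x0) ε := by
      have : dist y y0 < ε := hy
      rw [Prod.dist_eq, max_lt_iff] at this
      exact this.1
    have hy2 : y.2 ∈ Metric.ball (l x0) ε := by
      have : dist y y0 < ε := hy
      rw [Prod.dist_eq, max_lt_iff] at this
      exact this.2
    have hder : ∀ s ∈ Metric.ball (l x0) ε, HasFDerivAt (fun s => E (Γ (y.1, s)))
        (0 : K →L[ℂ] Y) s := by
      intro s hs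
      have hm : (y.1, s) ∈ Metric.ball y0 ε := by
        rw [Metric.mem_ball, Prod.dist_eq, max_lt_iff]; exact ⟨hy1, hs⟩
      have h := hball _ hm
      have h2 : HasFDerivAt (fun s : K => (y.1, s)) (ContinuousLinearMap.inr ℂ R K) s :=
        hasFDerivAt_prodMk_right _ _
      have h3 := HasFDerivAt.comp (g := fun y => E (Γ y)) s h.1.hasFDerivAt h2
      have h4 : (fderiv ℂ (fun y => E (Γ y)) (y.1, s)).comp (ContinuousLinearMap.inr ℂ R K) = 0 := by
        ext t
        simpa using h.2 t
      rw [h4] at h3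
      exact h3
    have := IsOpen.is_const_of_fderiv_eq_zero (𝕜 := ℂ) (f := fun s => E (Γ (y.1, s)))
      Metric.isOpen_ball (convex_ball (l x0) ε).isPreconnected
      (fun s hs => (hder s hs).differentiableAt.differentiableWithinAt)
      (fun s hs => (hder s hs).fderiv) hy2 (Metric.mem_ball_self hε)
    exact this
  let e : R → Y := fun r => E (Γ (r, l x0))
  have he : AnalyticAt ℂ e (g x0) := by
    have h1 : AnalyticAt ℂ (fun r : R => (r, l x0)) (g x0) := analyticAt_id.prod analyticAt_const
    have h2 : AnalyticAt ℂ (fun r : R => Γ (r, l x0)) (g x0) := hΓ.comp_of_eq h1 rfl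
    exact hE.comp_of_eq h2 hΓ0
  refine ⟨fun c => c - e (q c), ?_, ?_, ?_⟩
  · exact analyticAt_id.sub (he.comp_of_eq (q.analyticAt _) rfl)
  · have hcont : ContinuousAt (fun x => (g x, l x)) x0 :=
      hg.continuousAt.prodMk l.continuous.continuousAt
    filter_upwards [hΓl, hcont.preimage_mem_nhds (Metric.ball_mem_nhds y0 hε)] with x h1 h2
    have := hconst _ h2
    rw [h1] at this
    simp only [e]
    rw [sub_eq_zero]
    exact this
  · have hd : HasFDerivAt (fun c => c - e (q c))
        (ContinuousLinearMap.id ℂ Y - (fderiv ℂ e (g x0)).comp q) (E x0) :=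
      (hasFDerivAt_id _).sub
        (HasFDerivAt.comp (g := e) (E x0) he.differentiableAt.hasFDerivAt q.hasFDerivAt)
    rw [hd.fderiv]
    have hsub : (ContinuousLinearMap.id ℂ Y - (fderiv ℂ e (g x0)).comp q).ker ≤
        (fderiv ℂ e (g x0)).range := by
      intro v hv
      have hv' : v - fderiv ℂ e (g x0) (q v) = 0 := hv
      exact ⟨q v, (sub_eq_zero.1 hv').symm⟩
    calc _ ≤ Module.finrank ℂ (fderiv ℂ e (g x0)).range := Submodule.finrank_mono hsub
      _ ≤ Module.finrank ℂ R := LinearMap.finrank_range_le _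
      _ = m := hRm

/-- A function killed along a family of generically full rank in `{g = 0}` vanishes on `{g = 0}`. -/
lemma vanish_of_family {V : Type*} [NormedAddCommGroup V] [NormedSpace ℂ V] [FiniteDimensional ℂ V]
    {g : X → Y} {a : X} (hg : AnalyticAt ℂ g a) (hga : g a = 0)
    (hA : Function.Surjective (fderiv ℂ g a))
    {w : V → X} (hw : AnalyticAt ℂ w 0) (hw0 : w 0 = a) (hgw : ∀ᶠ t in 𝓝 0, g (w t) = 0)
    (hrank : ∃ᶠ t in 𝓝 0, Module.finrank ℂ (fderiv ℂ g a).ker ≤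
      Module.finrank ℂ (fderiv ℂ w t).range)
    {k : X → Z} (hk : AnalyticAt ℂ k a) (hkw : ∀ᶠ t in 𝓝 0, k (w t) = 0) :
    ∀ᶠ x in 𝓝 a, g x = 0 → k x = 0 := by
  have : CompleteSpace V := FiniteDimensional.complete ℂ V
  have : CompleteSpace Z := FiniteDimensional.complete ℂ Z
  obtain ⟨K, hK, l, Γ, hΓ, hΓ0, hΓl, hΓr⟩ := straighten' hg hA
  rw [← hK] at hrank
  have : CompleteSpace K := FiniteDimensional.complete ℂ K
  let κ : K → Z := fun s => k (Γ (0, s))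
  have hκ : AnalyticAt ℂ κ (l a) := by
    have h1 : AnalyticAt ℂ (fun s : K => ((0 : Y), s)) (l a) := analyticAt_const.prod analyticAt_id
    have h2 : AnalyticAt ℂ (fun s : K => Γ (0, s)) (l a) := hΓ.comp_of_eq h1 (by rw [hga])
    exact hk.comp_of_eq h2 (by rw [← hga]; exact hΓ0)
  obtain ⟨ε, hε, hball⟩ := Metric.eventually_nhds_iff_ball.1 hκ.eventually_analyticAt
  have hwt : Tendsto w (𝓝 0) (𝓝 a) := by
    have := hw.continuousAt.tendsto; rwa [hw0] at this
  have hlw : Tendsto (fun t => l (w t)) (𝓝 0) (𝓝 (l a)) := (l.continuous.tendsto a).comp hwt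
  have hgood : ∀ᶠ t in 𝓝 0, (∀ᶠ t' in 𝓝 t, g (w t') = 0) ∧ (∀ᶠ t' in 𝓝 t, k (w t') = 0) ∧
      (∀ᶠ t' in 𝓝 t, Γ (g (w t'), l (w t')) = w t') ∧ AnalyticAt ℂ w t ∧ 
      l (w t) ∈ Metric.ball (l a) ε ∧ DifferentiableAt ℂ Γ (0, l (w t)) := by
    have hΓd : ∀ᶠ t in 𝓝 0, DifferentiableAt ℂ Γ (0, l (w t)) := by
      have ht : Tendsto (fun t => ((0 : Y), l (w t))) (𝓝 0) (𝓝 (g a, l a)) := by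
        rw [hga]; exact tendsto_const_nhds.prodMk_nhds hlw
      exact ht.eventually (hΓ.eventually_analyticAt.mono fun x hx => hx.differentiableAt)
    filter_upwards [hgw.eventually_nhds, hkw.eventually_nhds, (hwt.eventually hΓl).eventually_nhds,
      hw.eventually_analyticAt, hlw.eventually (Metric.ball_mem_nhds _ hε), hΓd]
      with t h1 h2 h3 h4 h5 h6
    exact ⟨h1, h2, h3, h4, h5, h6⟩
  obtain ⟨t, hrk, h1, h2, h3, h4, h5, h6⟩ := (hrank.and_eventually hgood).exists
  have hcomp : ∀ᶠ t' in 𝓝 t, w t' = Γ (0, l (w t')) := by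
    filter_upwards [h1, h3] with t' a1 a3
    rw [a1] at a3; exact a3.symm
  have hD : HasFDerivAt (fun t' => l (w t')) (l.comp (fderiv ℂ w t)) t :=
    l.hasFDerivAt.comp t h4.differentiableAt.hasFDerivAt
  have hDs : HasStrictFDerivAt (fun t' => l (w t')) (l.comp (fderiv ℂ w t)) t :=
    l.hasStrictFDerivAt.comp t h4.hasStrictFDerivAt
  have hw' : fderiv ℂ w t = ((fderiv ℂ Γ (0, l (w t))).comp (ContinuousLinearMap.inr ℂ Y K)).comp
      (l.comp (fderiv ℂ w t)) := by
    have e2 : HasFDerivAt (fun s : K => Γ ((0 : Y), s))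
        ((fderiv ℂ Γ (0, l (w t))).comp (ContinuousLinearMap.inr ℂ Y K)) (l (w t)) :=
      HasFDerivAt.comp (g := Γ) (l (w t)) h6.hasFDerivAt (hasFDerivAt_prodMk_right _ _)
    have e3 := HasFDerivAt.comp (g := fun s : K => Γ ((0 : Y), s)) t e2 hD
    exact (e3.congr_of_eventuallyEq hcomp).fderiv
  have hsurj : (l.comp (fderiv ℂ w t)).range = ⊤ := by
    apply Submodule.eq_top_of_finrank_eq
    apply le_antisymm (Submodule.finrank_le _)
    refine hrk.trans ?_
    have hsub : (fderiv ℂ w t).range = Submodule.map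
        (((fderiv ℂ Γ (0, l (w t))).comp (ContinuousLinearMap.inr ℂ Y K) : K →L[ℂ] X) : K →ₗ[ℂ] X)
        (l.comp (fderiv ℂ w t)).range := by
      conv_lhs => rw [hw']
      exact LinearMap.range_comp _ _
    rw [hsub]
    exact Submodule.finrank_map_le _ _
  have hmap := hDs.map_nhds_eq_of_surj hsurj
  have hz : ∀ᶠ s in 𝓝 (l (w t)), κ s = 0 := by
    rw [← hmap, eventually_map]
    filter_upwards [h2, hcomp] with t' a2 a3
    simp only [κ]
    rw [← a3]; exact a2
  have hall := hol_ball_zero (f := κ) (x := l a) (R := ε)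
    (fun s hs => (hball s hs).differentiableAt.differentiableWithinAt) h5 hz
  filter_upwards [hΓl, (l.continuous.tendsto a).eventually (Metric.ball_mem_nhds _ hε)]
    with x a1 a2 a3
  have := hall _ a2
  simp only [κ] at this
  rw [a3] at a1
  rwa [a1] at this

end inv
end

open Complex Topology
noncomputable section

/-! ### Complexification of real-analytic functions -/

section cplx
open Filter

/-- real coordinate functions, extended to the doubled space -/
def Xc {N : ℕ} (i : Fin N × Fin 2) : CC N →L[ℂ] ℂ :=
  if i.2 = 0 then
    (1 / 2 : ℂ) • ((EuclideanSpace.proj i.1).comp (ContinuousLinearMap.fst ℂ (Cn N) (Cn N)) +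
      (EuclideanSpace.proj i.1).comp (ContinuousLinearMap.snd ℂ (Cn N) (Cn N)))
  else
    (1 / (2 * Complex.I) : ℂ) •
      ((EuclideanSpace.proj i.1).comp (ContinuousLinearMap.fst ℂ (Cn N) (Cn N)) -
      (EuclideanSpace.proj i.1).comp (ContinuousLinearMap.snd ℂ (Cn N) (Cn N)))

/-- real basis vectors -/
def bvec {N : ℕ} (i : Fin N × Fin 2) : Cn N := cbasis i.1 (if i.2 = 0 then 1 else Complex.I)

/-- real coordinates -/
def xr {N : ℕ} (z : Cn N) (i : Fin N × Fin 2) : ℝ := if i.2 = 0 then (z i.1).re else (z i.1).im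

lemma bvec_norm {N : ℕ} (i : Fin N × Fin 2) : ‖bvec i‖ = 1 := by
  unfold bvec cbasis
  split_ifs <;> simp

lemma Xc_diag {N : ℕ} (z : Cn N) (i : Fin N × Fin 2) : Xc i (z, cj z) = xr z i := by
  unfold Xc xr
  split_ifs
  · have := Complex.add_conj (z i.1)
    push_cast at this
    simp
    linear_combination (1 / 2 : ℂ) * this
  · have := Complex.sub_conj (z i.1)
    push_cast at this
    simp [this]
    linear_combination (-(z i.1).im : ℂ) * Complex.I_mul_I

lemma sum_bvec {N : ℕ} (z : Cn N) : z = ∑ i, xr z i • bvec i := by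
  rw [Fintype.sum_prod_type]
  ext k
  simp only [Fin.sum_univ_two, bvec, xr, cbasis]
  simp only [WithLp.ofLp_sum, WithLp.ofLp_add, Finset.sum_apply, Pi.add_apply]
  simp [Finset.sum_add_distrib]

/-- complexified terms of a power series -/
def cterm {N : ℕ} {n : ℕ} (q : Cn N [×n]→L[ℝ] ℂ) : CC N [×n]→L[ℂ] ℂ :=
  ∑ i : Fin n → Fin N × Fin 2, q (fun k => bvec (i k)) •
    (ContinuousMultilinearMap.mkPiAlgebra ℂ (Fin n) ℂ).compContinuousLinearMap
      (fun k => Xc (i k))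

lemma cterm_diag {N : ℕ} {n : ℕ} (q : Cn N [×n]→L[ℝ] ℂ) (v : Cn N) :
    cterm q (fun _ => (v, cj v)) = q (fun _ => v) := by
  unfold cterm
  simp only [sum_apply, smul_apply,
    ContinuousMultilinearMap.compContinuousLinearMap_apply,
    ContinuousMultilinearMap.mkPiAlgebra_apply, Xc_diag]
  conv_rhs => rw [sum_bvec v]
  have := q.toMultilinearMap.map_sum (fun (_ : Fin n) (i : Fin N × Fin 2) => xr v i • bvec i)
  refine Eq.trans ?_ this.symm
  refine Finset.sum_congr rfl fun i _ => ?_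
  have h2 := q.toMultilinearMap.map_smul_univ (fun k => xr v (i k)) (fun k => bvec (i k))
  refine Eq.trans ?_ h2.symm
  simp [mul_comm]

lemma cterm_norm (N : ℕ) : ∃ K : ℝ, 0 < K ∧ ∀ (n : ℕ) (q : Cn N [×n]→L[ℝ] ℂ),
    ‖cterm q‖ ≤ ‖q‖ * K ^ n := by
  let B : ℝ := ∑ i : Fin N × Fin 2, ‖(Xc i : CC N →L[ℂ] ℂ)‖
  have hB : ∀ i : Fin N × Fin 2, ‖(Xc i : CC N →L[ℂ] ℂ)‖ ≤ B := fun i =>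
    Finset.single_le_sum (f := fun i : Fin N × Fin 2 => ‖(Xc i : CC N →L[ℂ] ℂ)‖)
      (fun _ _ => norm_nonneg _) (Finset.mem_univ i)
  have hB0 : 0 ≤ B := Finset.sum_nonneg fun _ _ => norm_nonneg _
  refine ⟨Fintype.card (Fin N × Fin 2) * B + 1, by positivity, ?_⟩
  intro n q
  have h1 : ‖cterm q‖ ≤ ∑ i : Fin n → Fin N × Fin 2, ‖q‖ * B ^ n := by
    refine (norm_sum_le _ _).trans (Finset.sum_le_sum fun i _ => ?_)
    rw [norm_smul]
    gcongr
    · refine (q.le_opNorm _).trans ?_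
      simp [bvec_norm]
    · refine (ContinuousMultilinearMap.norm_compContinuousLinearMap_le _ _).trans ?_
      rw [ContinuousMultilinearMap.norm_mkPiAlgebra, one_mul]
      calc ∏ k : Fin n, ‖(Xc (i k) : CC N →L[ℂ] ℂ)‖ ≤ ∏ k : Fin n, B :=
            Finset.prod_le_prod (fun _ _ => norm_nonneg _) (fun k _ => hB _)
        _ = B ^ n := by simp
  refine h1.trans ?_
  rw [Finset.sum_const, nsmul_eq_mul, Finset.card_univ, Fintype.card_fun, Fintype.card_fin]
  push_cast
  calc _ = ‖q‖ * ((Fintype.card (Fin N × Fin 2) : ℝ) * B) ^ n := by rw [mul_pow]; ring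
    _ ≤ _ := by gcongr; linarith

lemma complexify {N : ℕ} {f : Cn N → ℂ} {p : Cn N} (hf : AnalyticAt ℝ f p) :
    ∃ F : CC N → ℂ, AnalyticAt ℂ F (p, cj p) ∧ ∀ᶠ z in 𝓝 p, F (z, cj z) = f z := by
  obtain ⟨q, R, hq⟩ := hf
  obtain ⟨K, hK, hKb⟩ := cterm_norm N
  let P : FormalMultilinearSeries ℂ (CC N) ℂ := fun n => cterm (q n)
  have hrad : 0 < P.radius := by
    obtain ⟨r, hr0, hr⟩ := ENNReal.lt_iff_exists_nnreal_btwn.1 (hq.r_pos.trans_le hq.r_le)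
    obtain ⟨C, hC, hb⟩ := q.norm_mul_pow_le_of_lt_radius hr
    have hr0' : (0 : ℝ) < r := by exact_mod_cast hr0
    let r' : NNReal := r / K.toNNReal
    have hr' : (r' : ℝ) = r / K := by simp [r', hK.le]
    have h1 : (r' : ENNReal) ≤ P.radius := by
      refine P.le_radius_of_bound C fun n => ?_
      calc ‖P n‖ * (r' : ℝ) ^ n ≤ ‖q n‖ * K ^ n * (r' : ℝ) ^ n := by gcongr; exact hKb n (q n)
        _ = ‖q n‖ * (r : ℝ) ^ n := by rw [hr', div_pow]; field_simp
        _ ≤ C := hb n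
    refine lt_of_lt_of_le ?_ h1
    have : (0 : ℝ) < r' := by rw [hr']; positivity
    exact_mod_cast this
  have hP := P.hasFPowerSeriesOnBall hrad
  refine ⟨fun c => P.sum (c - (p, cj p)), ?_, ?_⟩
  · refine AnalyticAt.comp_of_eq hP.analyticAt (f := fun c => c - (p, cj p)) ?_ (by simp)
    exact analyticAt_id.sub analyticAt_const
  · have hmem : ∀ᶠ z in 𝓝 p, z - p ∈ Metric.eball (0 : Cn N) R := by
      have : Tendsto (fun z => z - p) (𝓝 p) (𝓝 0) := by
        have : Continuous (fun z : Cn N => z - p) := by fun_prop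
        simpa using this.tendsto p
      exact this.eventually (Metric.eball_mem_nhds _ hq.r_pos)
    filter_upwards [hmem] with z hz
    have h1 := hq.hasSum hz
    rw [add_sub_cancel] at h1
    have h2 : ((z, cj z) : CC N) - (p, cj p) = (z - p, cj (z - p)) := by simp
    rw [h2, ← h1.tsum_eq]
    unfold FormalMultilinearSeries.sum
    congr 1
    ext n
    exact cterm_diag (q n) (z - p)

/-- diagonal embedding -/
def dg {N : ℕ} : Cn N →L[ℝ] CC N :=
  (ContinuousLinearMap.id ℝ (Cn N)).prod
    { toFun := fun z => cj z
      map_add' := fun x y => by simp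
      map_smul' := fun c x => by ext i; simp
      cont := cj.continuous }

@[simp] lemma dg_apply {N : ℕ} (z : Cn N) : dg z = (z, cj z) := rfl

lemma sg_fixed {N : ℕ} {c : CC N} (h : sg c = c) : c = (c.1, cj c.1) := by
  have := congrArg Prod.snd h
  simp at this
  exact Prod.ext rfl this.symm

/-- chain rule for the diagonal embedding -/
lemma diag_hasFDerivAt {N : ℕ} {F : Type*} [NormedAddCommGroup F] [NormedSpace ℂ F]
    {G : CC N → F} {g : Cn N → F} {z : Cn N} (hG : DifferentiableAt ℂ G (z, cj z))
    (hg : ∀ᶠ z' in 𝓝 z, g z' = G (z', cj z')) :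
    HasFDerivAt g (((fderiv ℂ G (z, cj z)).restrictScalars ℝ).comp dg) z := by
  have h1 : HasFDerivAt (fun z => G (dg z)) (((fderiv ℂ G (z, cj z)).restrictScalars ℝ).comp dg) z :=
    HasFDerivAt.comp (g := G) z (hG.hasFDerivAt.restrictScalars ℝ) (dg.hasFDerivAt)
  exact h1.congr_of_eventuallyEq hg

/-- symmetric complexification of a tuple of real functions -/
lemma complexify_real {N d : ℕ} {f : Cn N → Fin d → ℝ} {p : Cn N}
    (hf : ∀ k, AnalyticAt ℝ (fun z => f z k) p) :
    ∃ F : CC N → Cn d, AnalyticAt ℂ F (p, cj p) ∧ (∀ c, F (sg c) = cj (F c)) ∧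
      ∀ᶠ z in 𝓝 p, F (z, cj z) = WithLp.toLp 2 (fun k => (f z k : ℂ)) := by
  have h0 : ∀ k, ∃ F : CC N → ℂ, AnalyticAt ℂ F (p, cj p) ∧
      ∀ᶠ z in 𝓝 p, F (z, cj z) = (f z k : ℂ) := fun k =>
    complexify ((Complex.ofRealCLM.analyticAt _).comp (hf k))
  choose F0 hF0 hF1 using h0
  let F1 : CC N → Cn d := fun c => WithLp.toLp 2 (fun k => F0 k c)
  have hF1a : AnalyticAt ℂ F1 (p, cj p) :=
    ((EuclideanSpace.equiv (Fin d) ℂ).symm.toContinuousLinearMap.analyticAt _).comp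
      (AnalyticAt.pi hF0)
  have hF1d : ∀ᶠ z in 𝓝 p, F1 (z, cj z) = WithLp.toLp 2 (fun k => (f z k : ℂ)) := by
    filter_upwards [eventually_all.2 hF1] with z hz
    simp only [F1, hz]
  refine ⟨fun c => (1 / 2 : ℂ) • (F1 c + cj (F1 (sg c))), ?_, ?_, ?_⟩
  · have : AnalyticAt ℂ (fun c => cj (F1 (sg c))) (p, cj p) :=
      AnalyticAt.conj' sg cj (by simpa using hF1a)
    exact (hF1a.add this).const_smul (c := (1 / 2 : ℂ))
  · intro c
    beta_reduce
    rw [sg_sg]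
    simp only [map_smulₛₗ, map_add, cj_cj]
    have h2 : (starRingEnd ℂ) 2 = 2 := Complex.conj_ofNat 2
    simp [add_comm, h2]
  · filter_upwards [hF1d] with z hz
    simp only [sg_apply, cj_cj, hz]
    ext k
    simp
    ring

end cplx
end

open Complex Topology
noncomputable section

/-! ### Wirtinger derivatives and complexification -/

section wirt
open Filter

lemma sum_cbasis {n : ℕ} (v : Cn n) : v = ∑ j, v j • cbasis j 1 := by
  ext k
  simp [cbasis, WithLp.ofLp_sum, Finset.sum_apply, Pi.single_apply]

lemma cj_cbasis {n : ℕ} (j : Fin n) (c : ℂ) : cj (cbasis j c) = cbasis j ((starRingEnd ℂ) c) := by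
  ext k
  simp only [cj_apply, cbasis, PiLp.single_apply]
  split_ifs <;> simp

lemma cbasis_I {n : ℕ} (j : Fin n) : cbasis j Complex.I = Complex.I • cbasis j 1 := by
  ext k
  simp only [cbasis, PiLp.single_apply, PiLp.smul_apply]
  split_ifs <;> simp

lemma wirt_aux {n : ℕ} (D : CC n →L[ℂ] ℂ) (j : Fin n) :
    (1 / 2 : ℂ) * (D (cbasis j 1, cj (cbasis j 1)) -
      Complex.I * D (cbasis j Complex.I, cj (cbasis j Complex.I))) = D (cbasis j 1, 0) ∧
    (1 / 2 : ℂ) * (D (cbasis j 1, cj (cbasis j 1)) +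
      Complex.I * D (cbasis j Complex.I, cj (cbasis j Complex.I))) = D (0, cbasis j 1) := by
  have e1 : ((cbasis j 1, cj (cbasis j 1)) : CC n) = (cbasis j 1, 0) + (0, cbasis j 1) := by
    rw [cj_cbasis]; simp
  have e2 : ((cbasis j Complex.I, cj (cbasis j Complex.I)) : CC n) =
      Complex.I • (cbasis j 1, 0) - Complex.I • (0, cbasis j 1) := by
    rw [cbasis_I, map_smulₛₗ, cj_cbasis]; simp
  rw [e1, e2]
  simp only [map_add, map_sub, map_smul, smul_eq_mul]
  have := Complex.I_mul_I
  constructor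
  · linear_combination (-(1/2) * D (cbasis j 1, 0) + 1/2 * D (0, cbasis j 1)) * this
  · linear_combination ((1/2) * D (cbasis j 1, 0) - 1/2 * D (0, cbasis j 1)) * this

lemma real_fderiv {n : ℕ} {f : Cn n → ℝ} {G : CC n → ℂ} {z : Cn n}
    (hG : DifferentiableAt ℂ G (z, cj z)) (hf : ∀ᶠ z' in 𝓝 z, (f z' : ℂ) = G (z', cj z'))
    (v : Cn n) : HasFDerivAt f (fderiv ℝ f z) z ∧
      ((fderiv ℝ f z v : ℝ) : ℂ) = fderiv ℂ G (z, cj z) (v, cj v) := by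
  have h1 := diag_hasFDerivAt (g := fun z => (f z : ℂ)) hG hf
  have h2 : HasFDerivAt f (Complex.reCLM.comp _) z := Complex.reCLM.hasFDerivAt.comp z h1
  have h3 := h2.differentiableAt.hasFDerivAt
  have h4 : HasFDerivAt (fun z => (f z : ℂ)) (Complex.ofRealCLM.comp (fderiv ℝ f z)) z :=
    Complex.ofRealCLM.hasFDerivAt.comp z h3
  exact ⟨h3, DFunLike.congr_fun (h4.unique h1) v⟩

lemma wirtD_eq {n : ℕ} {f : Cn n → ℝ} {G : CC n → ℂ} {z : Cn n}
    (hG : DifferentiableAt ℂ G (z, cj z)) (hf : ∀ᶠ z' in 𝓝 z, (f z' : ℂ) = G (z', cj z'))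
    (j : Fin n) : wirtD f z j = fderiv ℂ G (z, cj z) (cbasis j 1, 0) := by
  unfold wirtD
  rw [(real_fderiv hG hf _).2, (real_fderiv hG hf _).2]
  exact (wirt_aux _ j).1

lemma wirtDBarR_eq {n : ℕ} {f : Cn n → ℝ} {G : CC n → ℂ} {z : Cn n}
    (hG : DifferentiableAt ℂ G (z, cj z)) (hf : ∀ᶠ z' in 𝓝 z, (f z' : ℂ) = G (z', cj z'))
    (j : Fin n) : wirtDBarR f z j = fderiv ℂ G (z, cj z) (0, cbasis j 1) := by
  unfold wirtDBarR
  rw [(real_fderiv hG hf _).2, (real_fderiv hG hf _).2]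
  exact (wirt_aux _ j).2

lemma wirtDBar_eq {n : ℕ} {f : Cn n → ℂ} {G : CC n → ℂ} {z : Cn n}
    (hG : DifferentiableAt ℂ G (z, cj z)) (hf : ∀ᶠ z' in 𝓝 z, f z' = G (z', cj z'))
    (j : Fin n) : wirtDBar f z j = fderiv ℂ G (z, cj z) (0, cbasis j 1) := by
  unfold wirtDBar
  rw [(diag_hasFDerivAt hG hf).fderiv]
  exact (wirt_aux _ j).2

lemma sum_left {n : ℕ} {F : Type*} [NormedAddCommGroup F] [NormedSpace ℂ F]
    (D : CC n →L[ℂ] F) (v : Cn n) :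
    ∑ j, v j • D (cbasis j 1, 0) = D (v, 0) := by
  have : ((v, 0) : CC n) = ∑ j, v j • ((cbasis j 1, 0) : CC n) := by
    ext1
    · rw [Prod.fst_sum]; simpa using sum_cbasis v
    · rw [Prod.snd_sum]; simp
  rw [this, map_sum]
  simp only [map_smul]

lemma sum_right {n : ℕ} {F : Type*} [NormedAddCommGroup F] [NormedSpace ℂ F]
    (D : CC n →L[ℂ] F) (v : Cn n) :
    ∑ j, v j • D (0, cbasis j 1) = D (0, v) := by
  have : ((0, v) : CC n) = ∑ j, v j • ((0, cbasis j 1) : CC n) := by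
    ext1
    · rw [Prod.fst_sum]; simp
    · rw [Prod.snd_sum]; simpa using sum_cbasis v
  rw [this, map_sum]
  simp only [map_smul]

end wirt

/-- complexified defining function of a generic submanifold -/
structure CData {N : ℕ} (M : Set (Cn N)) (p : Cn N) (d : ℕ) where
  ρ : CC N → Cn d
  an : AnalyticAt ℂ ρ (p, cj p)
  symm : ∀ c, ρ (sg c) = cj (ρ c)
  mem : ∀ᶠ z in 𝓝 p, (z ∈ M ↔ ρ (z, cj z) = 0)
  surj : Function.Surjective (fun v : Cn N => fderiv ℂ ρ (p, cj p) (v, 0))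
  pM : p ∈ M

open Filter in
lemma exists_cdata {N d : ℕ} {M : Set (Cn N)} {p : Cn N} (hM : IsGenericAt M d p) :
    Nonempty (CData M p d) := by
  obtain ⟨hp, U, r, hU, hpU, han, hMU, hli⟩ := hM
  obtain ⟨ρ, h1, h2, h3⟩ := complexify_real (f := r) (p := p) (fun k => han k p hpU)
  refine ⟨⟨ρ, h1, h2, ?_, ?_, hp⟩⟩
  · filter_upwards [h3, hU.mem_nhds hpU] with z hz hzU
    have : z ∈ M ↔ ∀ k, r z k = 0 := by
      constructor
      · intro h
        have : z ∈ M ∩ U := ⟨h, hzU⟩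
        rw [hMU] at this
        exact this.2
      · intro h
        have : z ∈ M ∩ U := by rw [hMU]; exact ⟨hzU, h⟩
        exact this.1
    rw [this, hz]
    constructor
    · intro h; ext k; simp [h]
    · intro h k
      have := congrArg (fun x : Cn d => x k) h
      simpa using this
  · have hli := hli p ⟨hp, hpU⟩
    let A : Matrix (Fin d) (Fin N) ℂ := fun k => wirtD (fun z => r z k) p
    have hr : A.rank = Fintype.card (Fin d) := LinearIndependent.rank_matrix (M := A) hli
    have hs : Function.Surjective A.mulVec := by
      have : LinearMap.range A.mulVecLin = ⊤ := by
        apply Submodule.eq_top_of_finrank_eq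
        rw [← Matrix.rank, hr]; simp
      exact LinearMap.range_eq_top.1 this
    intro y
    obtain ⟨v, hv⟩ := hs (fun k => y k)
    refine ⟨WithLp.toLp 2 v, ?_⟩
    ext k
    have hk := congrFun hv k
    rw [← hk]
    let G : CC N → ℂ := fun c => ρ c k
    have hG : HasFDerivAt G ((EuclideanSpace.proj k).comp (fderiv ℂ ρ (p, cj p))) (p, cj p) :=
      (EuclideanSpace.proj k : Cn d →L[ℂ] ℂ).hasFDerivAt.comp (p, cj p)
        h1.differentiableAt.hasFDerivAt
    have hGe : ∀ᶠ z' in 𝓝 p, (r z' k : ℂ) = G (z', cj z') := by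
      filter_upwards [h3] with z hz
      simp only [G, hz]
    have hw := fun j => wirtD_eq (f := fun z => r z k) hG.differentiableAt hGe j
    simp only [Matrix.mulVec, dotProduct, A, hw]
    have := sum_left (fderiv ℂ G (p, cj p)) (WithLp.toLp 2 v)
    simp only [smul_eq_mul] at this
    simp only [mul_comm] at this ⊢
    rw [this, hG.fderiv]
    rfl

end

open Complex Topology
noncomputable section

namespace CData
open Filter
variable {N d : ℕ} {M : Set (Cn N)} {p : Cn N} (D : CData M p d)

lemma rho0 : D.ρ (p, cj p) = 0 := D.mem.self_of_nhds.1 D.pM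

lemma sg_base (_D : CData M p d) : sg (p, cj p) = (p, cj p) := by simp

lemma fderiv_sg {c : CC N} (h : DifferentiableAt ℂ D.ρ (sg c)) (v : CC N) :
    fderiv ℂ D.ρ c v = cj (fderiv ℂ D.ρ (sg c) (sg v)) := by
  have h1 := h.hasFDerivAt.conj' sg cj
  have h2 : (fun y => cj (D.ρ (sg y))) = D.ρ := by
    funext y
    rw [D.symm, cj_cj]
  rw [h2] at h1
  rw [h1.fderiv]
  rfl

lemma fderiv_base (v : CC N) :
    fderiv ℂ D.ρ (p, cj p) v = cj (fderiv ℂ D.ρ (p, cj p) (sg v)) := by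
  have := D.fderiv_sg (c := (p, cj p)) (by rw [D.sg_base]; exact D.an.differentiableAt) v
  rwa [D.sg_base] at this

lemma surj2 : Function.Surjective (fun v : Cn N => fderiv ℂ D.ρ (p, cj p) (0, v)) := by
  intro y
  obtain ⟨v, hv⟩ := D.surj (cj y)
  refine ⟨cj v, ?_⟩
  have h := D.fderiv_base (0, cj v)
  simp only [sg_apply, cj_cj, map_zero] at h
  simp only at hv
  rw [hv, cj_cj] at h
  exact h

lemma surj' : Function.Surjective (fderiv ℂ D.ρ (p, cj p)) := by
  intro y
  obtain ⟨v, hv⟩ := D.surj y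
  exact ⟨(v, 0), hv⟩

/-- Uniform identity theorem along the complexification. -/
lemma ident {W : Set (CC N)} (hW : W ∈ 𝓝 ((p, cj p) : CC N)) :
    ∃ W' ∈ 𝓝 ((p, cj p) : CC N), ∀ (Z : Type) [NormedAddCommGroup Z] [NormedSpace ℂ Z]
      [CompleteSpace Z] (F : CC N → Z), DifferentiableOn ℂ F W →
      (∀ z ∈ M, (z, cj z) ∈ W → F (z, cj z) = 0) → ∀ c ∈ W', D.ρ c = 0 → F c = 0 := by
  set base : CC N := (p, cj p) with hbase
  have hsb : sg base = base := D.sg_base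
  have hKs : ∀ v ∈ (fderiv ℂ D.ρ base).ker, sg v ∈ (fderiv ℂ D.ρ base).ker := by
    intro v hv
    have hv' : fderiv ℂ D.ρ base v = 0 := hv
    have h := D.fderiv_base (sg v)
    rw [sg_sg, hv', map_zero] at h
    exact h
  obtain ⟨l0, hl0⟩ := exists_proj (fderiv ℂ D.ρ base).ker
  let L1 : CC N →L[ℂ] CC N := (Submodule.subtypeL _).comp l0
  let L : CC N →L[ℂ] CC N := (1 / 2 : ℂ) • (L1 + conjCLM sg sg L1)
  have hLs : ∀ v, L (sg v) = sg (L v) := by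
    intro v
    have h2 : (starRingEnd ℂ) 2 = 2 := Complex.conj_ofNat 2
    simp only [L, smul_apply, add_apply, conjCLM_apply,
      sg_sg, map_smulₛₗ, map_add]
    simp only [map_div₀, map_one, h2]
    rw [add_comm]
  have hLK : ∀ v, L v ∈ (fderiv ℂ D.ρ base).ker := by
    intro v
    refine Submodule.smul_mem _ _ (Submodule.add_mem _ (l0 v).2 ?_)
    exact hKs _ (l0 (sg v)).2
  have hLid : ∀ v ∈ (fderiv ℂ D.ρ base).ker, L v = v := by
    intro v hv
    have e1 : L1 v = v := congrArg Subtype.val (hl0 ⟨v, hv⟩)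
    have e2 : L1 (sg v) = sg v := congrArg Subtype.val (hl0 ⟨sg v, hKs v hv⟩)
    simp only [L, smul_apply, add_apply, conjCLM_apply,
      e1, e2, sg_sg]
    module
  let l : CC N →L[ℂ] (fderiv ℂ D.ρ base).ker := L.codRestrict _ hLK
  have hlc : ∀ v, ((l v : (fderiv ℂ D.ρ base).ker) : CC N) = L v := fun v => rfl
  obtain ⟨Γ, hΓ, hΓ0, hΓl, hΓr⟩ := straighten D.an D.surj' l
    (fun v => Subtype.ext (hLid v v.2))
  rw [D.rho0] at hΓ hΓ0 hΓr
  -- the good ball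
  have hι : AnalyticAt ℂ (fun y : (fderiv ℂ D.ρ base).ker => Γ (0, y)) (l base) :=
    hΓ.comp_of_eq (analyticAt_const.prod analyticAt_id) rfl
  have hιt : Tendsto (fun y : (fderiv ℂ D.ρ base).ker => Γ (0, y)) (𝓝 (l base)) (𝓝 base) := by
    have := hι.continuousAt.tendsto
    rwa [hΓ0] at this
  have hsgt : Tendsto (sg : CC N → CC N) (𝓝 base) (𝓝 base) := by
    have := sg.continuous.tendsto base
    rwa [hsb] at this
  have hfst : Tendsto (Prod.fst : CC N → Cn N) (𝓝 base) (𝓝 p) := continuous_fst.tendsto base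
  have hpair : Tendsto (fun y : (fderiv ℂ D.ρ base).ker => ((0 : Cn d), y)) (𝓝 (l base))
      (𝓝 (0, l base)) := tendsto_const_nhds.prodMk_nhds tendsto_id
  have hgood : ∀ᶠ y in 𝓝 (l base), W ∈ 𝓝 (Γ (0, y)) ∧
      DifferentiableAt ℂ (fun y : (fderiv ℂ D.ρ base).ker => Γ (0, y)) y ∧
      D.ρ (Γ (0, y)) = 0 ∧ l (Γ (0, y)) = y ∧
      Γ (D.ρ (sg (Γ (0, y))), l (sg (Γ (0, y)))) = sg (Γ (0, y)) ∧
      ((Γ (0, y)).1 ∈ M ↔ D.ρ ((Γ (0, y)).1, cj (Γ (0, y)).1) = 0) := by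
    filter_upwards [hιt.eventually (eventually_mem_nhds_iff.2 hW), hι.eventually_analyticAt,
      hpair.eventually hΓr, (hsgt.comp hιt).eventually hΓl, (hfst.comp hιt).eventually D.mem]
      with y h1 h2 h3 h4 h5
    exact ⟨h1, h2.differentiableAt, h3.1, h3.2, h4, h5⟩
  obtain ⟨ε, hε, hball⟩ := Metric.eventually_nhds_iff_ball.1 hgood
  have hlbase : sg (l base : CC N) = l base := by rw [hlc, ← hLs, hsb]
  have hW' : ∀ᶠ c in 𝓝 base, Γ (D.ρ c, l c) = c ∧ ‖(l c : CC N) - l base‖ < ε / 4 := by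
    refine hΓl.and ?_
    have : Tendsto (fun c => ‖(l c : CC N) - l base‖) (𝓝 base) (𝓝 0) := by
      have : Continuous (fun c => ‖(l c : CC N) - l base‖) := by fun_prop
      simpa using this.tendsto base
    exact this.eventually (gt_mem_nhds (by positivity))
  refine ⟨_, hW', ?_⟩
  intro Z _ _ _ F hF hFM c hc hρc
  obtain ⟨hc1, hc2⟩ := hc
  rw [hρc] at hc1
  -- vanishing at fixed points
  have hfix : ∀ y ∈ Metric.ball (l base) ε, sg (y : CC N) = y → F (Γ (0, y)) = 0 := by
    intro y hy hsy
    obtain ⟨h1, h2, h3, h4, h5, h6⟩ := hball y hy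
    have hx : sg (Γ (0, y)) = Γ (0, y) := by
      rw [D.symm, h3, map_zero] at h5
      have : l (sg (Γ (0, y))) = y := by
        apply Subtype.ext
        rw [hlc, hLs, ← hlc, h4, hsy]
      rw [this] at h5
      exact h5.symm
    have hx2 := sg_fixed hx
    rw [hx2]
    refine hFM _ ?_ ?_
    · rw [h6, ← hx2]; exact h3
    · rw [← hx2]; exact mem_of_mem_nhds h1
  set y : (fderiv ℂ D.ρ base).ker := l c with hy
  let sy : (fderiv ℂ D.ρ base).ker := ⟨sg (y : CC N), hKs _ y.2⟩
  let u : (fderiv ℂ D.ρ base).ker := (1 / 2 : ℂ) • (y + sy)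
  let v : (fderiv ℂ D.ρ base).ker := (-Complex.I / 2 : ℂ) • (y - sy)
  have h2c : (starRingEnd ℂ) 2 = 2 := Complex.conj_ofNat 2
  have hsu : sg (u : CC N) = u := by
    simp only [u, sy, Submodule.coe_smul, Submodule.coe_add, map_smulₛₗ, map_add, sg_sg,
      map_div₀, map_one, h2c]
    rw [add_comm]
  have hsv : sg (v : CC N) = v := by
    simp only [v, sy, Submodule.coe_smul, Submodule.coe_sub, map_smulₛₗ, map_sub, sg_sg,
      map_div₀, map_neg, Complex.conj_I, h2c]
    module
  have hyuv : y = u + Complex.I • v := by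
    simp only [u, v, smul_smul]
    have : Complex.I * (-Complex.I / 2) = 1 / 2 := by
      have := Complex.I_mul_I; linear_combination (-1/2) * this
    rw [this]
    module
  have hny : ‖(y : CC N) - l base‖ < ε / 4 := hc2
  have hnsy : ‖(sy : CC N) - l base‖ < ε / 4 := by
    have : (sy : CC N) - (l base : CC N) = sg ((y : CC N) - (l base : CC N)) := by
      rw [map_sub, hlbase]
    rw [this, LinearIsometryEquiv.norm_map]; exact hny
  have hball2 : ∀ t ∈ Metric.ball (0 : ℂ) 2, u + t • v ∈ Metric.ball (l base) ε := by
    intro t ht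
    rw [Metric.mem_ball, dist_eq_norm, ← Submodule.norm_coe]
    rw [mem_ball_zero_iff] at ht
    have e : Subtype.val (u + t • v - l base) =
        (1 / 2 : ℂ) • (((y : CC N) - (l base : CC N)) + ((sy : CC N) - (l base : CC N))) +
        (t * (-Complex.I / 2)) • (((y : CC N) - (l base : CC N)) -
          ((sy : CC N) - (l base : CC N))) := by
      simp only [u, v, Submodule.coe_add, Submodule.coe_sub, Submodule.coe_smul, mul_smul]
      module
    rw [e]
    calc _ ≤ ‖(1 / 2 : ℂ)‖ * (‖(y : CC N) - l base‖ + ‖(sy : CC N) - l base‖) +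
        ‖t * (-Complex.I / 2)‖ * (‖(y : CC N) - l base‖ + ‖(sy : CC N) - l base‖) := by
          refine (norm_add_le _ _).trans ?_
          rw [norm_smul, norm_smul]
          gcongr
          · exact norm_add_le _ _
          · exact norm_sub_le _ _
      _ ≤ (1 / 2) * (‖(y : CC N) - l base‖ + ‖(sy : CC N) - l base‖) +
        1 * (‖(y : CC N) - l base‖ + ‖(sy : CC N) - l base‖) := by
          gcongr
          · simp
          · simp; linarith
      _ < ε := by linarith
  have hline := hol_line_zero (f := fun t : ℂ => F (Γ (0, u + t • v))) (r := 2) ?_ ?_ Complex.I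
    (by simp)
  · have hline' : F (Γ (0, u + Complex.I • v)) = 0 := hline
    rw [← hyuv, hc1] at hline'
    exact hline'
  · intro t ht
    obtain ⟨h1, h2, -⟩ := hball _ (hball2 t ht)
    have h3 : DifferentiableAt ℂ F (Γ (0, u + t • v)) := hF.differentiableAt h1
    have h4 : DifferentiableAt ℂ (fun t : ℂ => u + t • v) t := by fun_prop
    have h5 : DifferentiableAt ℂ (fun t : ℂ => Γ (0, u + t • v)) t :=
      DifferentiableAt.comp t (g := fun y : (fderiv ℂ D.ρ base).ker => Γ (0, y)) h2 h4
    exact (DifferentiableAt.comp t (g := F) h3 h5).differentiableWithinAt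
  · have ht : Tendsto (fun n : ℕ => ((1 / ((n : ℝ) + 1) : ℝ) : ℂ)) atTop (𝓝[≠] 0) := by
      rw [tendsto_nhdsWithin_iff]
      constructor
      · have := (Complex.continuous_ofReal.tendsto 0).comp
          (tendsto_one_div_add_atTop_nhds_zero_nat (𝕜 := ℝ))
        simpa [Function.comp_def] using this
      · refine Eventually.of_forall fun n => ?_
        have : (0 : ℝ) < 1 / ((n : ℝ) + 1) := by positivity
        simpa using (by exact_mod_cast this.ne' : ((1 / ((n : ℝ) + 1) : ℝ) : ℂ) ≠ 0)
    refine ht.frequently (Eventually.frequently (Eventually.of_forall fun n => ?_))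
    apply hfix
    · apply hball2
      rw [mem_ball_zero_iff, Complex.norm_real, Real.norm_of_nonneg (by positivity)]
      have : (1 : ℝ) / ((n : ℝ) + 1) ≤ 1 := by
        rw [div_le_one (by positivity)]; linarith [n.cast_nonneg (α := ℝ)]
      linarith
    · have e : ∀ t : ℂ, ((u + t • v : (fderiv ℂ D.ρ base).ker) : CC N)
          = (u : CC N) + t • (v : CC N) := fun t => rfl
      have e2 : ∀ t : ℝ, sg ((u : CC N) + (t : ℂ) • (v : CC N)) = (u : CC N) + (t : ℂ) • (v : CC N) := by
        intro t
        rw [map_add, hsu]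
        congr 1
        refine (LinearIsometryEquiv.map_smulₛₗ sg (t : ℂ) (v : CC N)).trans ?_
        rw [hsv, Complex.conj_ofReal]
      rw [e, e2]

end CData
end

open Complex Topology
noncomputable section

namespace CData
open Filter
variable {N d : ℕ} {M : Set (Cn N)} {p : Cn N} (D : CData M p d)

lemma exists_psi : ∃ ψ : Cn N × CC N → CC N, AnalyticAt ℂ ψ (0, (p, cj p)) ∧
    (∀ᶠ c in 𝓝 ((p, cj p) : CC N), ψ (0, c) = c) ∧
    (∀ᶠ x in 𝓝 ((0, (p, cj p)) : Cn N × CC N), (ψ x).1 = x.2.1 ∧ D.ρ (ψ x) = D.ρ x.2) ∧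
    (∀ᶠ c in 𝓝 ((p, cj p) : CC N), ∀ v, fderiv ℂ D.ρ c (0, v) = 0 →
      fderiv ℂ ψ (0, c) (v, 0) = (0, v)) := by
  set base : CC N := (p, cj p) with hbase
  let g : CC N → Cn N × Cn d := fun c => (c.1, D.ρ c)
  have hg : AnalyticAt ℂ g base := analyticAt_fst.prod D.an
  have hgd : ∀ c, AnalyticAt ℂ D.ρ c → ∀ v, fderiv ℂ g c v = (v.1, fderiv ℂ D.ρ c v) := by
    intro c hc v
    have : HasFDerivAt g ((ContinuousLinearMap.fst ℂ (Cn N) (Cn N)).prod (fderiv ℂ D.ρ c)) c :=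
      hasFDerivAt_fst.prodMk hc.differentiableAt.hasFDerivAt
    rw [this.fderiv]; rfl
  have hA : Function.Surjective (fderiv ℂ g base) := by
    rintro ⟨a, b⟩
    obtain ⟨v, hv⟩ := D.surj2 (b - fderiv ℂ D.ρ base (a, 0))
    refine ⟨(a, v), ?_⟩
    rw [hgd _ D.an]
    have e : ((a, v) : CC N) = (a, 0) + (0, v) := by simp
    have hv' : fderiv ℂ D.ρ base (0, v) = b - fderiv ℂ D.ρ base (a, 0) := hv
    rw [e, map_add, hv', add_sub_cancel]
    simp
  obtain ⟨K, -, l, Γ, hΓ, hΓ0, hΓl, hΓr⟩ := straighten' hg hA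
  let θ : Cn N × CC N → (Cn N × Cn d) × K := fun x => (g x.2, l (x.2 + (0, x.1)))
  have hθ0 : ∀ c, θ (0, c) = (g c, l c) := by
    intro c
    have : c + ((0 : Cn N), (0 : Cn N)) = c := by simp
    simp only [θ, this]
  have hθa : ∀ c, AnalyticAt ℂ g c → ∀ s, AnalyticAt ℂ θ (s, c) := by
    intro c hc s
    refine (hc.comp_of_eq analyticAt_snd rfl).prod ?_
    refine (l.analyticAt _).comp_of_eq
      (analyticAt_snd.add (analyticAt_const.prod analyticAt_fst)) rfl
  have hθt : Tendsto θ (𝓝 (0, base)) (𝓝 (g base, l base)) := by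
    have := (hθa base hg 0).continuousAt.tendsto
    rwa [hθ0] at this
  have hgl : AnalyticAt ℂ (fun c => (g c, l c)) base := hg.prod (l.analyticAt _)
  refine ⟨fun x => Γ (θ x), hΓ.comp_of_eq (hθa base hg 0) (hθ0 base), ?_, ?_, ?_⟩
  · filter_upwards [hΓl] with c hc
    rw [hθ0, hc]
  · filter_upwards [hθt.eventually hΓr] with x hx
    have := hx.1
    exact ⟨congrArg (fun y : Cn N × Cn d => y.1) this,
      congrArg (fun y : Cn N × Cn d => y.2) this⟩
  · filter_upwards [hΓl.eventually_nhds, hg.eventually_analyticAt, D.an.eventually_analyticAt,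
      hgl.continuousAt.tendsto.eventually hΓ.eventually_analyticAt] with c h1 h2 h3 h4 v hv
    have d1 : HasFDerivAt θ (((fderiv ℂ g c).comp (ContinuousLinearMap.snd ℂ (Cn N) (CC N))).prod
        (l.comp ((ContinuousLinearMap.snd ℂ (Cn N) (CC N)) +
          (ContinuousLinearMap.prod 0 (ContinuousLinearMap.fst ℂ (Cn N) (CC N)))))) (0, c) := by
      refine HasFDerivAt.prodMk ?_ ?_
      · exact HasFDerivAt.comp (g := g) (0, c) h2.differentiableAt.hasFDerivAt hasFDerivAt_snd
      · exact (l.comp ((ContinuousLinearMap.snd ℂ (Cn N) (CC N)) +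
          (ContinuousLinearMap.prod 0 (ContinuousLinearMap.fst ℂ (Cn N) (CC N))))).hasFDerivAt
    have d2 : HasFDerivAt Γ (fderiv ℂ Γ (g c, l c)) (θ (0, c)) := by
      rw [hθ0]; exact h4.differentiableAt.hasFDerivAt
    have d3 := d2.comp _ d1
    have d4 : HasFDerivAt (fun x => Γ (g x, l x)) ((fderiv ℂ Γ (g c, l c)).comp
        ((fderiv ℂ g c).prod l)) c :=
      HasFDerivAt.comp (g := Γ) c (by exact h4.differentiableAt.hasFDerivAt)
        (h2.differentiableAt.hasFDerivAt.prodMk l.hasFDerivAt)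
    have d5 : HasFDerivAt (fun x => Γ (g x, l x)) (ContinuousLinearMap.id ℂ (CC N)) c :=
      (hasFDerivAt_id c).congr_of_eventuallyEq h1
    have e1 := DFunLike.congr_fun (d4.unique d5) (0, v)
    have e0 : (fun x => Γ (θ x)) = Γ ∘ θ := rfl
    rw [e0, d3.fderiv]
    have hz : fderiv ℂ g c (0, v) = 0 := by rw [hgd c h3, hv]; rfl
    have e2 : fderiv ℂ Γ (g c, l c) (fderiv ℂ g c (0, v), l (0, v)) = (0, v) := e1
    rw [hz] at e2
    have e3 : fderiv ℂ Γ (g c, l c) (fderiv ℂ g c 0, l ((0 : CC N) + (0, v))) = (0, v) := by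
      rw [map_zero, zero_add]; exact e2
    exact e3

end CData
end

open Complex Topology
noncomputable section

namespace CData
open Filter
variable {N d : ℕ} {M : Set (Cn N)} {p : Cn N} (D : CData M p d)

/-- elementary step along a Segre leaf -/
def Step (W : Set (CC N)) (c c' : CC N) : Prop :=
  c ∈ W ∧ c' ∈ W ∧ D.ρ c = 0 ∧ D.ρ c' = 0 ∧ (c.1 = c'.1 ∨ c.2 = c'.2)

/-- reachability along Segre leaves -/
def Reach (W : Set (CC N)) : CC N → CC N → Prop := Relation.ReflTransGen (D.Step W)

variable {D} in
lemma Step.symm {W : Set (CC N)} {c c' : CC N} (h : D.Step W c c') : D.Step W c' c :=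
  ⟨h.2.1, h.1, h.2.2.2.1, h.2.2.1, h.2.2.2.2.imp Eq.symm Eq.symm⟩

variable {D} in
lemma Reach.symm {W : Set (CC N)} {c c' : CC N} (h : D.Reach W c c') : D.Reach W c' c := by
  induction h with
  | refl => exact Relation.ReflTransGen.refl
  | tail _ h2 ih => exact Relation.ReflTransGen.head h2.symm ih

variable {D} in
lemma Reach.sg {W W' : Set (CC N)} (hW : ∀ c ∈ W', sg c ∈ W) {c c' : CC N} (h : D.Reach W' c c') :
    D.Reach W (sg c) (sg c') := by
  have key : ∀ a b, D.Step W' a b → D.Step W (_root_.sg a) (_root_.sg b) := ?_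
  · induction h with
    | refl => exact Relation.ReflTransGen.refl
    | tail _ h2 ih => exact Relation.ReflTransGen.tail ih (key _ _ h2)
  rintro a b ⟨h1, h2, h3, h4, h5⟩
  refine ⟨hW _ h1, hW _ h2, by rw [D.symm, h3, map_zero], by rw [D.symm, h4, map_zero], ?_⟩
  rcases h5 with h5 | h5
  · right; simp [h5]
  · left; simp [h5]

lemma sg_tendsto (D : CData M p d) : Tendsto (sg : CC N → CC N) (𝓝 (p, cj p)) (𝓝 (p, cj p)) := by
  have := sg.continuous.tendsto ((p, cj p) : CC N)
  rwa [D.sg_base] at this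

/-- analytic families of maps moving points along Segre chains -/
structure Fam where
  V : Type
  [i1 : NormedAddCommGroup V]
  [i2 : NormedSpace ℂ V]
  [i3 : FiniteDimensional ℂ V]
  a : V ≃ₛₗᵢ[starRingEnd ℂ] V
  f : V × CC N → CC N
  an : AnalyticAt ℂ f (0, (p, cj p))
  zero : ∀ᶠ c in 𝓝 ((p, cj p) : CC N), f (0, c) = c
  rho : ∀ᶠ x in 𝓝 ((0, (p, cj p)) : V × CC N), D.ρ (f x) = D.ρ x.2
  reach : ∀ W ∈ 𝓝 ((p, cj p) : CC N), ∀ᶠ x in 𝓝 ((0, (p, cj p)) : V × CC N),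
    D.ρ x.2 = 0 → D.Reach W x.2 (f x)

attribute [instance] Fam.i1 Fam.i2 Fam.i3

namespace Fam
variable {D}

lemma f0 (f : Fam D) : f.f (0, (p, cj p)) = (p, cj p) := f.zero.self_of_nhds

lemma tend (f : Fam D) : Tendsto f.f (𝓝 (0, (p, cj p))) (𝓝 (p, cj p)) := by
  have := f.an.continuousAt.tendsto
  rwa [f.f0] at this

/-- conjugate family -/
def conj (f : Fam D) : Fam D where
  V := f.V
  a := f.a
  f := fun x => sg (f.f (f.a x.1, sg x.2))
  an := by
    have := AnalyticAt.conj' (pj f.a sg) sg (f := f.f) (x := (0, (p, cj p))) (by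
      have e : pj f.a sg (0, (p, cj p)) = (0, (p, cj p)) := by
        rw [pj_apply, D.sg_base]; simp
      rw [e]; exact f.an)
    exact this
  zero := by
    filter_upwards [D.sg_tendsto.eventually f.zero] with c hc
    rw [map_zero, hc, sg_sg]
  rho := by
    have ht : Tendsto (fun x : f.V × CC N => (f.a x.1, sg x.2)) (𝓝 (0, (p, cj p)))
        (𝓝 (0, (p, cj p))) := by
      have : Continuous (fun x : f.V × CC N => (f.a x.1, sg x.2)) :=
        (f.a.continuous.comp continuous_fst).prodMk (sg.continuous.comp continuous_snd)
      have := this.tendsto (0, (p, cj p))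
      simp only [D.sg_base, map_zero] at this
      exact this
    filter_upwards [ht.eventually f.rho] with x hx
    rw [D.symm, hx, D.symm, cj_cj]
  reach := by
    have ht : Tendsto (fun x : f.V × CC N => (f.a x.1, sg x.2)) (𝓝 (0, (p, cj p)))
        (𝓝 (0, (p, cj p))) := by
      have : Continuous (fun x : f.V × CC N => (f.a x.1, sg x.2)) :=
        (f.a.continuous.comp continuous_fst).prodMk (sg.continuous.comp continuous_snd)
      have := this.tendsto (0, (p, cj p))
      simp only [D.sg_base, map_zero] at this
      exact this
    intro W hW
    filter_upwards [ht.eventually (f.reach _ (D.sg_tendsto hW))] with x hx h0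
    have := (hx (by rw [D.symm, h0, map_zero])).sg (W := W) (fun c hc => hc)
    simpa only [sg_sg] using this

/-- composition of families: first `f`, then `g` -/
def comp (f g : Fam D) : Fam D where
  V := f.V × g.V
  a := pj f.a g.a
  f := fun x => g.f (x.1.2, f.f (x.1.1, x.2))
  an := by
    refine g.an.comp_of_eq ((analyticAt_snd.comp analyticAt_fst).prod
      (f.an.comp_of_eq ((analyticAt_fst.comp analyticAt_fst).prod analyticAt_snd) rfl)) ?_
    exact Prod.ext rfl f.f0
  zero := by
    filter_upwards [f.zero, g.zero] with c h1 h2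
    have e1 : ((0 : f.V × g.V)).1 = 0 := rfl
    have e2 : ((0 : f.V × g.V)).2 = 0 := rfl
    rw [e1, e2, h1, h2]
  rho := by
    have ht1 : Tendsto (fun x : (f.V × g.V) × CC N => (x.1.1, x.2)) (𝓝 (0, (p, cj p)))
        (𝓝 (0, (p, cj p))) := (by fun_prop : Continuous _).tendsto' _ _ rfl
    have ht2 : Tendsto (fun x : (f.V × g.V) × CC N => (x.1.2, f.f (x.1.1, x.2)))
        (𝓝 (0, (p, cj p))) (𝓝 (0, (p, cj p))) := by
      have h1 : Tendsto (fun x : (f.V × g.V) × CC N => x.1.2) (𝓝 (0, (p, cj p))) (𝓝 0) :=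
        (by fun_prop : Continuous _).tendsto' _ _ rfl
      exact h1.prodMk_nhds (f.tend.comp ht1)
    filter_upwards [ht1.eventually f.rho, ht2.eventually g.rho] with x h1 h2
    rw [h2, h1]
  reach := by
    have ht1 : Tendsto (fun x : (f.V × g.V) × CC N => (x.1.1, x.2)) (𝓝 (0, (p, cj p)))
        (𝓝 (0, (p, cj p))) := (by fun_prop : Continuous _).tendsto' _ _ rfl
    have ht2 : Tendsto (fun x : (f.V × g.V) × CC N => (x.1.2, f.f (x.1.1, x.2)))
        (𝓝 (0, (p, cj p))) (𝓝 (0, (p, cj p))) := by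
      have h1 : Tendsto (fun x : (f.V × g.V) × CC N => x.1.2) (𝓝 (0, (p, cj p))) (𝓝 0) :=
        (by fun_prop : Continuous _).tendsto' _ _ rfl
      exact h1.prodMk_nhds (f.tend.comp ht1)
    intro W hW
    filter_upwards [ht1.eventually f.rho, ht1.eventually (f.reach W hW),
      ht2.eventually (g.reach W hW)] with x h1 h2 h3 h0
    exact (h2 h0).trans (h3 (by rw [h1, h0]))

lemma exists_inv (f : Fam D) : ∃ g : f.V × CC N → CC N,
    AnalyticAt ℂ g (0, (p, cj p)) ∧
    (∀ᶠ x in 𝓝 ((0, (p, cj p)) : f.V × CC N), g (x.1, f.f x) = x.2) ∧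
    (∀ᶠ x in 𝓝 ((0, (p, cj p)) : f.V × CC N), f.f (x.1, g x) = x.2) := by
  set b : f.V × CC N := (0, (p, cj p)) with hb
  let F : f.V × CC N → f.V × CC N := fun x => (x.1, f.f x)
  have hF : AnalyticAt ℂ F b := analyticAt_fst.prod f.an
  have hFb : F b = b := Prod.ext rfl f.f0
  have hd : HasFDerivAt F ((ContinuousLinearMap.fst ℂ f.V (CC N)).prod (fderiv ℂ f.f b)) b :=
    hasFDerivAt_fst.prodMk f.an.differentiableAt.hasFDerivAt
  have hd2 : ∀ v : CC N, fderiv ℂ f.f b (0, v) = v := by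
    intro v
    have h1 : HasFDerivAt (fun c : CC N => f.f (0, c)) ((fderiv ℂ f.f b).comp
        (ContinuousLinearMap.inr ℂ f.V (CC N))) (p, cj p) :=
      HasFDerivAt.comp (g := f.f) ((p, cj p) : CC N) f.an.differentiableAt.hasFDerivAt
        ((hasFDerivAt_const _ _).prodMk (hasFDerivAt_id _))
    have h2 : HasFDerivAt (fun c : CC N => f.f (0, c)) (ContinuousLinearMap.id ℂ _) (p, cj p) :=
      (hasFDerivAt_id _).congr_of_eventuallyEq f.zero
    exact DFunLike.congr_fun (h1.unique h2) v
  have hbij : Function.Bijective (fderiv ℂ F b) := by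
    rw [hd.fderiv]
    have hinj : Function.Injective ((ContinuousLinearMap.fst ℂ f.V (CC N)).prod
        (fderiv ℂ f.f b)) := by
      rw [injective_iff_map_eq_zero]
      rintro ⟨t, v⟩ h
      have h1 : t = 0 := congrArg Prod.fst h
      have h2 : fderiv ℂ f.f b (t, v) = 0 := congrArg Prod.snd h
      subst h1
      rw [hd2] at h2
      rw [h2]; rfl
    exact ⟨hinj, (LinearMap.injective_iff_surjective
      (f := (((ContinuousLinearMap.fst ℂ f.V (CC N)).prod
        (fderiv ℂ f.f b) : _ →L[ℂ] _) : f.V × CC N →ₗ[ℂ] f.V × CC N))).1 hinj⟩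
  obtain ⟨G, hG, hG0, hGl, hGr⟩ := inv_analytic hF hbij
  rw [hFb] at hG hG0 hGr
  refine ⟨fun x => (G x).2, analyticAt_snd.comp hG, ?_, ?_⟩
  · filter_upwards [hGl] with x hx
    exact congrArg Prod.snd hx
  · filter_upwards [hGr] with x hx
    have h1' : (F (G x)).1 = x.1 := by rw [hx]
    have h1 : (G x).1 = x.1 := h1'
    have h2 : f.f (G x) = x.2 := congrArg (fun y : f.V × CC N => y.2) hx
    rw [← h1]; exact h2

/-- inverse family -/
def inv (f : Fam D) : Fam D where
  V := f.V
  a := f.a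
  f := f.exists_inv.choose
  an := f.exists_inv.choose_spec.1
  zero := by
    obtain ⟨h1, h2, h3⟩ := f.exists_inv.choose_spec
    have ht : Tendsto (fun c : CC N => ((0 : f.V), c)) (𝓝 (p, cj p)) (𝓝 (0, (p, cj p))) :=
      (by fun_prop : Continuous _).tendsto' _ _ rfl
    filter_upwards [f.zero, ht.eventually h2] with c hc h
    simp only [hc] at h
    exact h
  rho := by
    obtain ⟨h1, h2, h3⟩ := f.exists_inv.choose_spec
    have h0 : f.exists_inv.choose (0, (p, cj p)) = (p, cj p) := by
      have := h2.self_of_nhds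
      simp only [f.f0] at this
      exact this
    have ht : Tendsto (fun x : f.V × CC N => (x.1, f.exists_inv.choose x))
        (𝓝 (0, (p, cj p))) (𝓝 (0, (p, cj p))) := by
      have := h1.continuousAt.tendsto
      rw [h0] at this
      exact (continuous_fst.tendsto' _ _ rfl).prodMk_nhds this
    filter_upwards [h3, ht.eventually f.rho] with x hx h
    rw [hx] at h
    exact h.symm
  reach := by
    obtain ⟨h1, h2, h3⟩ := f.exists_inv.choose_spec
    have h0 : f.exists_inv.choose (0, (p, cj p)) = (p, cj p) := by
      have := h2.self_of_nhds
      simp only [f.f0] at this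
      exact this
    have ht : Tendsto (fun x : f.V × CC N => (x.1, f.exists_inv.choose x))
        (𝓝 (0, (p, cj p))) (𝓝 (0, (p, cj p))) := by
      have := h1.continuousAt.tendsto
      rw [h0] at this
      exact (continuous_fst.tendsto' _ _ rfl).prodMk_nhds this
    intro W hW
    filter_upwards [h3, ht.eventually f.rho, ht.eventually (f.reach W hW)] with x hx h h' hx0
    rw [hx] at h h'
    exact (h' (by rw [← h, hx0])).symm

lemma inv_left (f : Fam D) :
    ∀ᶠ x in 𝓝 ((0, (p, cj p)) : f.V × CC N), f.inv.f (x.1, f.f x) = x.2 :=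
  f.exists_inv.choose_spec.2.1

lemma inv_right (f : Fam D) :
    ∀ᶠ x in 𝓝 ((0, (p, cj p)) : f.V × CC N), f.f (x.1, f.inv.f x) = x.2 :=
  f.exists_inv.choose_spec.2.2

variable (D) in
/-- the leaf family -/
def psi : Fam D where
  V := Cn N
  a := cj
  f := D.exists_psi.choose
  an := D.exists_psi.choose_spec.1
  zero := D.exists_psi.choose_spec.2.1
  rho := D.exists_psi.choose_spec.2.2.1.mono fun _ h => h.2
  reach := by
    obtain ⟨h1, h2, h3, -⟩ := D.exists_psi.choose_spec
    have ht : Tendsto D.exists_psi.choose (𝓝 (0, (p, cj p))) (𝓝 (p, cj p)) := by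
      have := h1.continuousAt.tendsto
      rwa [h2.self_of_nhds] at this
    intro W hW
    have ht2 : Tendsto (fun x : Cn N × CC N => x.2) (𝓝 (0, (p, cj p))) (𝓝 (p, cj p)) :=
      continuous_snd.tendsto' _ _ rfl
    filter_upwards [h3, ht hW, ht2 hW] with x h4 h5 h6 h0
    exact Relation.ReflTransGen.single ⟨h6, h5, h0, by rw [h4.2, h0], Or.inl h4.1.symm⟩

variable (D) in
lemma psi_der : ∀ᶠ c in 𝓝 ((p, cj p) : CC N), ∀ v : Cn N, fderiv ℂ D.ρ c (0, v) = 0 →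
      fderiv ℂ (psi D).f ((0 : Cn N), c) ((v : Cn N), (0 : CC N)) = (0, v) :=
  D.exists_psi.choose_spec.2.2.2

end Fam
end CData
end

open Complex Topology
noncomputable section

lemma finrank_range_comp_left {X Y Z : Type*} [NormedAddCommGroup X] [NormedSpace ℂ X]
    [NormedAddCommGroup Y] [NormedSpace ℂ Y] [NormedAddCommGroup Z] [NormedSpace ℂ Z]
    [FiniteDimensional ℂ Z] (A : Y →L[ℂ] Z) (B : X →L[ℂ] Y) :
    Module.finrank ℂ (A.comp B).range ≤ Module.finrank ℂ A.range := by
  apply Submodule.finrank_mono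
  rintro _ ⟨x, rfl⟩
  exact ⟨B x, rfl⟩

lemma finrank_range_comp_right {X Y Z : Type*} [NormedAddCommGroup X] [NormedSpace ℂ X]
    [NormedAddCommGroup Y] [NormedSpace ℂ Y] [NormedAddCommGroup Z] [NormedSpace ℂ Z]
    [FiniteDimensional ℂ Y] (A : Y →L[ℂ] Z) (B : X →L[ℂ] Y) :
    Module.finrank ℂ (A.comp B).range ≤ Module.finrank ℂ B.range := by
  have e : ((A.comp B).range) = Submodule.map (A : Y →ₗ[ℂ] Z) (B.range) := by
    ext y
    constructor
    · rintro ⟨x, rfl⟩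
      exact ⟨B x, ⟨x, rfl⟩, rfl⟩
    · rintro ⟨_, ⟨x, rfl⟩, rfl⟩
      exact ⟨x, rfl⟩
  rw [e]
  exact Submodule.finrank_map_le _ _

namespace CData
open Filter
variable {N d : ℕ} {M : Set (Cn N)} {p : Cn N} {D : CData M p d}

namespace Fam

/-- orbit map of the base point -/
def F (f : Fam D) : f.V → CC N := fun t => f.f (t, (p, cj p))

/-- rank of the orbit map -/
def rk (f : Fam D) (t : f.V) : ℕ := Module.finrank ℂ (fderiv ℂ f.F t).range

lemma F0 (f : Fam D) : f.F 0 = (p, cj p) := f.f0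

lemma slice (f : Fam D) : Tendsto (fun t : f.V => (t, ((p, cj p) : CC N))) (𝓝 0)
    (𝓝 (0, (p, cj p))) := (by fun_prop : Continuous _).tendsto' _ _ rfl

lemma F_an (f : Fam D) : AnalyticAt ℂ f.F 0 :=
  f.an.comp_of_eq (analyticAt_id.prod analyticAt_const) rfl

lemma F_tend (f : Fam D) : Tendsto f.F (𝓝 0) (𝓝 (p, cj p)) := by
  have := f.F_an.continuousAt.tendsto
  rwa [f.F0] at this

variable (D) in
lemma exists_max : ∃ m, (∃ w : Fam D, ∃ᶠ t in 𝓝 0, m ≤ w.rk t) ∧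
    ∀ f : Fam D, ∀ᶠ t in 𝓝 0, f.rk t ≤ m := by
  classical
  let P : ℕ → Prop := fun r => ∃ w : Fam D, ∃ᶠ t in 𝓝 0, r ≤ w.rk t
  have hP0 : P 0 := ⟨psi D, Eventually.frequently (Eventually.of_forall fun _ => Nat.zero_le _)⟩
  let B := Module.finrank ℂ (CC N)
  refine ⟨Nat.findGreatest P B, Nat.findGreatest_spec (P := P) (Nat.zero_le _) hP0, ?_⟩
  intro f
  by_contra hcon
  have h1 : P (Nat.findGreatest P B + 1) := by
    refine ⟨f, fun h => hcon (h.mono fun t ht => ?_)⟩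
    push Not at ht
    omega
  have h2 : ¬ Nat.findGreatest P B + 1 ≤ B := fun h =>
    Nat.findGreatest_is_greatest (Nat.lt_succ_self _) h h1
  obtain ⟨w, hw⟩ := h1
  obtain ⟨t, ht⟩ := hw.exists
  have : w.rk t ≤ B := Submodule.finrank_le _
  omega

/-- the return map -/
def E0 (w : Fam D) (t0 : w.V) : w.V → CC N := fun t => w.inv.f (t0, w.F t)

lemma E0_props (w : Fam D) : ∀ᶠ t0 in 𝓝 (0 : w.V), AnalyticAt ℂ (w.E0 t0) t0 ∧
    w.E0 t0 t0 = (p, cj p) ∧ w.rk t0 ≤ Module.finrank ℂ (fderiv ℂ (w.E0 t0) t0).range := by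
  have hq : Tendsto (fun t : w.V => (t, w.F t)) (𝓝 0) (𝓝 (0, (p, cj p))) :=
    tendsto_id.prodMk_nhds w.F_tend
  have hq2 : Tendsto (fun x : w.V × w.V => (x.2, w.F x.1)) (𝓝 (0, 0)) (𝓝 (0, (p, cj p))) :=
    (continuous_snd.tendsto' _ _ rfl).prodMk_nhds
      (w.F_tend.comp (continuous_fst.tendsto' _ _ rfl))
  have hdiag : Tendsto (fun t : w.V => (t, t)) (𝓝 0) (𝓝 (0, 0)) :=
    (by fun_prop : Continuous _).tendsto' _ _ rfl
  have h3 : ∀ᶠ t0 in 𝓝 (0 : w.V), ∀ᶠ t in 𝓝 t0, w.f (t0, w.E0 t0 t) = w.F t := by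
    filter_upwards [hdiag.eventually (hq2.eventually w.inv_right).eventually_nhds] with t0 h
    have ht : Tendsto (fun t : w.V => (t, t0)) (𝓝 t0) (𝓝 (t0, t0)) :=
      (by fun_prop : Continuous _).tendsto' _ _ rfl
    exact ht.eventually h
  filter_upwards [w.F_an.eventually_analyticAt, hq.eventually w.inv.an.eventually_analyticAt,
    w.slice.eventually w.inv_left, h3, w.slice.eventually w.an.eventually_analyticAt]
    with t0 h1 h2 h4 h3 h5
  have han : AnalyticAt ℂ (w.E0 t0) t0 :=
    h2.comp_of_eq (analyticAt_const.prod h1) rfl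
  have h0 : w.E0 t0 t0 = (p, cj p) := h4
  refine ⟨han, h0, ?_⟩
  have d1 : HasFDerivAt w.f (fderiv ℂ w.f (t0, (p, cj p))) (t0, w.E0 t0 t0) := by
    rw [h0]; exact h5.differentiableAt.hasFDerivAt
  have d2 := HasFDerivAt.comp (g := w.f) t0 d1
    ((hasFDerivAt_const t0 t0).prodMk han.differentiableAt.hasFDerivAt)
  have d3 := d2.congr_of_eventuallyEq (h3.mono fun t ht => ht.symm)
  rw [rk, d3.fderiv]
  refine (finrank_range_comp_right _ _).trans ?_
  have e : ((0 : w.V →L[ℂ] w.V).prod (fderiv ℂ (w.E0 t0) t0)) =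
      (ContinuousLinearMap.inr ℂ w.V (CC N)).comp (fderiv ℂ (w.E0 t0) t0) := rfl
  rw [e]
  exact finrank_range_comp_right _ _

lemma exists_h (w U : Fam D) {m : ℕ} (hw : ∃ᶠ t in 𝓝 0, m ≤ w.rk t)
    (hmax : ∀ f : Fam D, ∀ᶠ t in 𝓝 0, f.rk t ≤ m) :
    ∃ h : CC N → CC N, AnalyticAt ℂ h (p, cj p) ∧ (∀ᶠ x in 𝓝 0, h (U.F x) = 0) ∧
      Module.finrank ℂ (fderiv ℂ h (p, cj p)).ker ≤ m := by
  let Q := (w.comp w.inv).comp U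
  have hQ : ∀ᶠ y in 𝓝 (0 : (w.V × w.V) × U.V), Q.rk y ≤ m ∧ AnalyticAt ℂ Q.F y :=
    (hmax Q).and Q.F_an.eventually_analyticAt
  have hdiag : Tendsto (fun t : w.V => (((t, t), 0) : (w.V × w.V) × U.V)) (𝓝 0) (𝓝 0) :=
    (by fun_prop : Continuous _).tendsto' _ _ rfl
  obtain ⟨t0, ht0, ⟨han, h0, hrk⟩, hQ0⟩ :=
    (hw.and_eventually (w.E0_props.and (hdiag.eventually hQ.eventually_nhds))).exists
  let E : w.V × U.V → CC N := fun y => U.f (y.2, w.E0 t0 y.1)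
  have hE : AnalyticAt ℂ E (t0, 0) :=
    U.an.comp_of_eq (analyticAt_snd.prod (han.comp_of_eq analyticAt_fst rfl))
      (Prod.ext rfl h0)
  have hE0 : E (t0, 0) = (p, cj p) := by
    simp only [E, h0, U.f0]
  have hle : ∀ᶠ x in 𝓝 ((t0, 0) : w.V × U.V), Module.finrank ℂ (fderiv ℂ E x).range ≤ m := by
    let A : w.V × U.V → (w.V × w.V) × U.V := fun y => ((y.1, t0), y.2)
    have hA : Tendsto A (𝓝 (t0, 0)) (𝓝 ((t0, t0), 0)) :=
      (by fun_prop : Continuous _).tendsto' _ _ rfl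
    filter_upwards [hA.eventually hQ0] with x ⟨h1, h2⟩
    have dA : DifferentiableAt ℂ A x := by fun_prop
    have : fderiv ℂ E x = (fderiv ℂ Q.F (A x)).comp (fderiv ℂ A x) :=
      (h2.differentiableAt.hasFDerivAt.comp x dA.hasFDerivAt).fderiv
    rw [this]
    exact (finrank_range_comp_left _ _).trans h1
  have hge : m ≤ Module.finrank ℂ (fderiv ℂ E (t0, 0)).range := by
    refine ht0.trans (hrk.trans ?_)
    have hc : Tendsto (w.E0 t0) (𝓝 t0) (𝓝 (p, cj p)) := by
      have := han.continuousAt.tendsto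
      rwa [h0] at this
    have d1 : HasFDerivAt (fun t : w.V => E (t, 0)) _ t0 :=
      HasFDerivAt.comp (g := E) t0 hE.differentiableAt.hasFDerivAt
        ((hasFDerivAt_id t0).prodMk (hasFDerivAt_const (0 : U.V) t0))
    have d2 := d1.congr_of_eventuallyEq ((hc.eventually U.zero).mono fun t ht => ht.symm)
    have e : w.E0 t0 = fun t => w.E0 t0 t := rfl
    rw [e, d2.fderiv]
    exact finrank_range_comp_left _ _
  obtain ⟨h, hh1, hh2, hh3⟩ := const_rank hE hle hge
  rw [hE0] at hh1 hh3
  refine ⟨h, hh1, ?_, hh3⟩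
  have ht : Tendsto (fun x : U.V => (t0, x)) (𝓝 0) (𝓝 (t0, 0)) :=
    (by fun_prop : Continuous _).tendsto' _ _ rfl
  filter_upwards [ht.eventually hh2] with x hx
  simp only [E, h0] at hx
  exact hx

lemma orbit_A (w : Fam D) {m : ℕ} (hw : ∃ᶠ t in 𝓝 0, m ≤ w.rk t) (hm : 2 * N ≤ m + d)
    {W : Set (CC N)} (hW : W ∈ 𝓝 ((p, cj p) : CC N)) :
    ∀ᶠ z in 𝓝 p, ∃ ζ, D.Reach W (p, cj p) (z, ζ) := by
  let Q := w.comp w.inv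
  have hQ : ∀ᶠ y in 𝓝 (0 : w.V × w.V), D.Reach W (p, cj p) (Q.F y) ∧ D.ρ (Q.F y) = 0 := by
    filter_upwards [Q.slice.eventually (Q.reach W hW), Q.slice.eventually Q.rho] with y h1 h2
    exact ⟨h1 D.rho0, h2.trans D.rho0⟩
  have hdiag : Tendsto (fun t : w.V => ((t, t) : w.V × w.V)) (𝓝 0) (𝓝 0) :=
    (by fun_prop : Continuous _).tendsto' _ _ rfl
  obtain ⟨t0, ht0, ⟨han, h0, hrk⟩, hQ0⟩ :=
    (hw.and_eventually (w.E0_props.and (hdiag.eventually hQ.eventually_nhds))).exists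
  have ht : Tendsto (fun t : w.V => (t, t0)) (𝓝 t0) (𝓝 (t0, t0)) :=
    (by fun_prop : Continuous _).tendsto' _ _ rfl
  have hQ1 : ∀ᶠ t in 𝓝 t0, D.Reach W (p, cj p) (w.E0 t0 t) ∧ D.ρ (w.E0 t0 t) = 0 :=
    ht.eventually hQ0
  have hsub : (fderiv ℂ (w.E0 t0) t0).range ≤ (fderiv ℂ D.ρ (p, cj p)).ker := by
    rintro _ ⟨v, rfl⟩
    have d1 : HasFDerivAt D.ρ (fderiv ℂ D.ρ (p, cj p)) (w.E0 t0 t0) := by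
      rw [h0]; exact D.an.differentiableAt.hasFDerivAt
    have d2 := d1.comp t0 han.differentiableAt.hasFDerivAt
    have d3 : HasFDerivAt (D.ρ ∘ w.E0 t0) (0 : w.V →L[ℂ] Cn d) t0 :=
      (hasFDerivAt_const 0 t0).congr_of_eventuallyEq (hQ1.mono fun t ht => ht.2)
    exact DFunLike.congr_fun (d2.unique d3) v
  have hker : Module.finrank ℂ (fderiv ℂ D.ρ (p, cj p)).ker + d = 2 * N := by
    have h1 := LinearMap.finrank_range_add_finrank_ker
      (fderiv ℂ D.ρ (p, cj p) : CC N →ₗ[ℂ] Cn d)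
    rw [LinearMap.range_eq_top.2 D.surj', finrank_top] at h1
    simp only [Module.finrank_prod, finrank_euclideanSpace, Fintype.card_fin] at h1
    omega
  have heq : (fderiv ℂ (w.E0 t0) t0).range = (fderiv ℂ D.ρ (p, cj p)).ker := by
    refine Submodule.eq_of_le_of_finrank_le hsub ?_
    omega
  have hd : HasStrictFDerivAt (fun t => (w.E0 t0 t).1)
      ((ContinuousLinearMap.fst ℂ (Cn N) (Cn N)).comp (fderiv ℂ (w.E0 t0) t0)) t0 :=
    HasStrictFDerivAt.comp t0 hasStrictFDerivAt_fst han.hasStrictFDerivAt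
  have hsurj : ((ContinuousLinearMap.fst ℂ (Cn N) (Cn N)).comp (fderiv ℂ (w.E0 t0) t0)).range
      = ⊤ := by
    rw [LinearMap.range_eq_top]
    intro y
    obtain ⟨v, hv⟩ := D.surj2 (- fderiv ℂ D.ρ (p, cj p) (y, 0))
    have hv' : fderiv ℂ D.ρ (p, cj p) (0, v) = - fderiv ℂ D.ρ (p, cj p) (y, 0) := hv
    have hmem : ((y, v) : CC N) ∈ (fderiv ℂ (w.E0 t0) t0).range := by
      rw [heq]
      have e : ((y, v) : CC N) = (y, 0) + (0, v) := by simp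
      show fderiv ℂ D.ρ (p, cj p) (y, v) = 0
      rw [e, map_add, hv']; simp
    obtain ⟨x, hx⟩ := hmem
    exact ⟨x, congrArg Prod.fst hx⟩
  have : CompleteSpace w.V := FiniteDimensional.complete ℂ _
  have hmap := hd.map_nhds_eq_of_surj hsurj
  rw [h0] at hmap
  have hmap' : map (fun t => (w.E0 t0 t).1) (𝓝 t0) = 𝓝 p := hmap
  rw [← hmap', eventually_map]
  filter_upwards [hQ1] with t ht
  exact ⟨(w.E0 t0 t).2, ht.1⟩

end Fam
end CData
end

open Complex Topology
noncomputable section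

/-- joint surjectivity of independent functionals -/
lemma surj_of_li {𝕜 X : Type*} [RCLike 𝕜] [NormedAddCommGroup X] [NormedSpace 𝕜 X] {c : ℕ}
    {f : Fin c → X →L[𝕜] 𝕜} (hf : LinearIndependent 𝕜 f) :
    Function.Surjective (ContinuousLinearMap.pi f) := by
  rw [← ContinuousLinearMap.coe_coe, ← LinearMap.range_eq_top]
  by_contra hne
  obtain ⟨φ, hφ, hle⟩ := Submodule.exists_le_ker_of_lt_top _ (lt_top_iff_ne_top.2 hne)
  have key : ∀ y : Fin c → 𝕜, φ y = ∑ i, φ (Pi.single i 1) * y i := by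
    intro y
    conv_lhs => rw [← Finset.univ_sum_single y]
    rw [map_sum]
    refine Finset.sum_congr rfl fun i _ => ?_
    have : (Pi.single i (y i) : Fin c → 𝕜) = y i • Pi.single i 1 := by
      rw [← Pi.single_smul]; simp
    rw [this, map_smul, smul_eq_mul, mul_comm]
  have hz : ∑ i, φ (Pi.single i 1) • f i = 0 := by
    ext v
    have h1 : φ (ContinuousLinearMap.pi f v) = 0 := hle ⟨v, rfl⟩
    rw [key] at h1
    simpa using h1
  have h0 := Fintype.linearIndependent_iff.1 hf _ hz
  apply hφ
  ext i
  simp [h0]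

namespace CData
open Filter
variable {N d : ℕ} {M : Set (Cn N)} {p : Cn N} {D : CData M p d}

namespace Fam

/-- symmetric functions vanishing on an orbit -/
def SymVan (w : Fam D) : Set (CC N → ℂ) :=
  {g | AnalyticAt ℂ g (p, cj p) ∧ (∀ c, g (sg c) = (starRingEnd ℂ) (g c)) ∧
    ∀ᶠ x in 𝓝 0, g (w.F x) = 0}

lemma symm_parts (w : Fam D) {g : CC N → ℂ} (hg : AnalyticAt ℂ g (p, cj p))
    (h1 : ∀ᶠ x in 𝓝 0, g (w.F x) = 0) (h2 : ∀ᶠ x in 𝓝 0, g (sg (w.F x)) = 0) :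
    ∃ g1 ∈ w.SymVan, ∃ g2 ∈ w.SymVan, ∀ c, g c = g1 c + Complex.I * g2 c := by
  have hgs : AnalyticAt ℂ (fun c => (starRingEnd ℂ) (g (sg c))) (p, cj p) := by
    have := AnalyticAt.conj' sg (starₗᵢ ℂ) (f := g) (x := (p, cj p)) (by rw [D.sg_base]; exact hg)
    exact this
  have h2c : (starRingEnd ℂ) 2 = 2 := Complex.conj_ofNat 2
  refine ⟨fun c => (1 / 2) * (g c + (starRingEnd ℂ) (g (sg c))), ⟨?_, ?_, ?_⟩,
    fun c => (-Complex.I / 2) * (g c - (starRingEnd ℂ) (g (sg c))), ⟨?_, ?_, ?_⟩, ?_⟩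
  · exact analyticAt_const.mul (hg.add hgs)
  · intro c
    simp only [map_mul, map_add, map_div₀, map_one, h2c, sg_sg, Complex.conj_conj]
    ring
  · filter_upwards [h1, h2] with x h1 h2
    rw [h1, h2]; simp
  · exact analyticAt_const.mul (hg.sub hgs)
  · intro c
    simp only [map_mul, map_sub, map_div₀, map_neg, Complex.conj_I, h2c, sg_sg, Complex.conj_conj]
    ring
  · filter_upwards [h1, h2] with x h1 h2
    rw [h1, h2]; simp
  · intro c
    have := Complex.I_mul_I
    linear_combination (1 / 2 : ℂ) * (g c - (starRingEnd ℂ) (g (sg c))) * this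

lemma exists_g (w : Fam D) {m : ℕ} (hw : ∃ᶠ t in 𝓝 0, m ≤ w.rk t)
    (hmax : ∀ f : Fam D, ∀ᶠ t in 𝓝 0, f.rk t ≤ m) :
    ∃ (c : ℕ) (g : Fin c → CC N → ℂ), m + c = 2 * N ∧ (∀ i, g i ∈ (w.comp (psi D)).SymVan) ∧
      LinearIndependent ℂ (fun i => fderiv ℂ (g i) (p, cj p)) := by
  classical
  let w1 := w.comp (psi D)
  let U := w1.comp w1.conj
  obtain ⟨h, hh, hU, hker⟩ := exists_h w U hw hmax
  have hdim : Module.finrank ℂ (CC N) = 2 * N := by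
    simp only [Module.finrank_prod, finrank_euclideanSpace, Fintype.card_fin]; omega
  have hm : m ≤ 2 * N := by
    obtain ⟨t, ht⟩ := hw.exists
    exact ht.trans ((Submodule.finrank_le _).trans hdim.le)
  have h1 : ∀ᶠ x in 𝓝 0, h (w1.F x) = 0 := by
    have ht : Tendsto (fun x : w1.V => ((x, 0) : w1.V × w1.V)) (𝓝 0) (𝓝 0) :=
      (by fun_prop : Continuous _).tendsto' _ _ rfl
    filter_upwards [ht.eventually hU, w1.F_tend.eventually w1.conj.zero] with x hx hx2
    have : U.F (x, 0) = w1.F x := hx2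
    rw [← this]; exact hx
  have h2 : ∀ᶠ x in 𝓝 0, h (sg (w1.F x)) = 0 := by
    have ht : Tendsto (fun x : w1.V => ((0, w1.a.symm x) : w1.V × w1.V)) (𝓝 0) (𝓝 0) := by
      have : Continuous (fun x : w1.V => ((0, w1.a.symm x) : w1.V × w1.V)) :=
        continuous_const.prodMk w1.a.symm.continuous
      exact this.tendsto' _ _ (by simp)
    filter_upwards [ht.eventually hU] with x hx
    have : U.F (0, w1.a.symm x) = sg (w1.F x) := by
      show sg (w1.f (w1.a (w1.a.symm x), sg (w1.F 0))) = _
      rw [w1.F0, D.sg_base, LinearIsometryEquiv.apply_symm_apply]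
      rfl
    rw [← this]; exact hx
  let Ds : Set (CC N →L[ℂ] ℂ) := (fun g => fderiv ℂ g (p, cj p)) '' w1.SymVan
  obtain ⟨f, hf1, hf2, hf3⟩ := Submodule.exists_fun_fin_finrank_span_eq ℂ Ds
  have hkill : ∀ v, (∀ i, f i v = 0) → ∀ φ ∈ Ds, φ v = 0 := by
    intro v hv φ hφ
    have h4 : ∀ φ ∈ Submodule.span ℂ (Set.range f), φ v = 0 := by
      intro φ h3
      induction h3 using Submodule.span_induction with
      | mem x hx => obtain ⟨i, rfl⟩ := hx; exact hv i
      | zero => rfl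
      | add x y _ _ hx hy => rw [add_apply, hx, hy, add_zero]
      | smul a x _ hx => rw [smul_apply, hx, smul_zero]
    exact h4 φ (by rw [hf2]; exact Submodule.subset_span hφ)
  have hr : 2 * N ≤ m + Module.finrank ℂ (Submodule.span ℂ Ds) := by
    have h3 := LinearMap.finrank_range_add_finrank_ker
      (ContinuousLinearMap.pi f : CC N →L[ℂ] _).toLinearMap
    rw [hdim] at h3
    have h4 : Module.finrank ℂ (LinearMap.range (ContinuousLinearMap.pi f : CC N →L[ℂ] _).toLinearMap)
        ≤ Module.finrank ℂ (Submodule.span ℂ Ds) :=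
      (Submodule.finrank_le _).trans (by simp)
    have h5 : Module.finrank ℂ (LinearMap.ker (ContinuousLinearMap.pi f : CC N →L[ℂ] _).toLinearMap)
        ≤ m := by
      refine le_trans (Submodule.finrank_mono ?_) hker
      intro v hv
      have hv' : ∀ i, f i v = 0 := fun i => congrFun (show ContinuousLinearMap.pi f v = 0 from hv) i
      show fderiv ℂ h (p, cj p) v = 0
      have hν : ∀ ν : CC N →L[ℂ] ℂ, ν (fderiv ℂ h (p, cj p) v) = 0 := by
        intro ν
        have ha : AnalyticAt ℂ (fun c => ν (h c)) (p, cj p) := (ν.analyticAt _).comp hh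
        obtain ⟨g1, hg1, g2, hg2, hgg⟩ := w1.symm_parts ha
          (h1.mono fun x hx => by simp only [hx, map_zero])
          (h2.mono fun x hx => by simp only [hx, map_zero])
        have d1 : HasFDerivAt (fun c => ν (h c)) (ν.comp (fderiv ℂ h (p, cj p))) (p, cj p) :=
          ν.hasFDerivAt.comp _ hh.differentiableAt.hasFDerivAt
        have d2 : HasFDerivAt (fun c => g1 c + Complex.I * g2 c)
            (fderiv ℂ g1 (p, cj p) + Complex.I • fderiv ℂ g2 (p, cj p)) (p, cj p) :=
          hg1.1.differentiableAt.hasFDerivAt.add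
            (hg2.1.differentiableAt.hasFDerivAt.const_mul Complex.I)
        have e : (fun c => ν (h c)) = fun c => g1 c + Complex.I * g2 c := funext hgg
        rw [e] at d1
        have := DFunLike.congr_fun (d1.unique d2) v
        have k1 := hkill v hv' _ ⟨g1, hg1, rfl⟩
        have k2 := hkill v hv' _ ⟨g2, hg2, rfl⟩
        simp only [ContinuousLinearMap.comp_apply, add_apply, smul_apply] at this
        simp only at k1 k2
        rw [this, k1, k2]; simp
      by_contra hne
      obtain ⟨ν, -, hν2⟩ := exists_dual_vector ℂ _ (norm_ne_zero_iff.2 hne)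
      rw [hν ν] at hν2
      exact hne (norm_eq_zero.1 (by have := hν2.symm; simpa using this))
    omega
  choose g hg1 hg2 using hf1
  have hc : 2 * N - m ≤ Module.finrank ℂ (Submodule.span ℂ Ds) := by omega
  refine ⟨2 * N - m, fun i => g (Fin.castLE hc i), by omega, fun i => hg1 _, ?_⟩
  have := hf3.comp (Fin.castLE hc) (Fin.castLE_injective hc)
  have e : (fun i => fderiv ℂ (g (Fin.castLE hc i)) (p, cj p)) = f ∘ Fin.castLE hc := by
    funext i; exact hg2 _
  rw [e]; exact this

lemma exists_g' (w : Fam D) {m : ℕ} (hw : ∃ᶠ t in 𝓝 0, m ≤ w.rk t)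
    (hmax : ∀ f : Fam D, ∀ᶠ t in 𝓝 0, f.rk t ≤ m) :
    ∃ (c : ℕ) (g : Fin c → CC N → ℂ), m + c = 2 * N ∧
      (∀ i, AnalyticAt ℂ (g i) (p, cj p)) ∧ (∀ i c, g i (sg c) = (starRingEnd ℂ) (g i c)) ∧
      (∀ i, g i (p, cj p) = 0) ∧
      LinearIndependent ℂ (fun i => fderiv ℂ (g i) (p, cj p)) ∧
      (∀ᶠ x in 𝓝 ((p, cj p) : CC N), (∀ i, g i x = 0) → D.ρ x = 0) ∧
      (∀ᶠ x in 𝓝 ((p, cj p) : CC N), (∀ i, g i x = 0) → ∀ v, fderiv ℂ D.ρ x (0, v) = 0 →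
        ∀ i, fderiv ℂ (g i) x (0, v) = 0) := by
  obtain ⟨c, g, hc, hg, hli⟩ := exists_g w hw hmax
  let w1 := w.comp (psi D)
  let G : CC N → (Fin c → ℂ) := fun x i => g i x
  have hG : AnalyticAt ℂ G (p, cj p) := AnalyticAt.pi fun i => (hg i).1
  have hg0 : ∀ i, g i (p, cj p) = 0 := by
    intro i
    have := (hg i).2.2.self_of_nhds
    rwa [F0] at this
  have hGd : ∀ x, AnalyticAt ℂ G x →
      fderiv ℂ G x = ContinuousLinearMap.pi (fun i => fderiv ℂ (g i) x) := by
    intro x hx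
    have : HasFDerivAt G (ContinuousLinearMap.pi (fun i => fderiv ℂ (g i) x)) x :=
      hasFDerivAt_pi.2 fun i =>
        (differentiableAt_pi.1 hx.differentiableAt i).hasFDerivAt
    exact this.fderiv
  have hA : Function.Surjective (fderiv ℂ G (p, cj p)) := by
    rw [hGd _ hG]; exact surj_of_li hli
  have hdim : Module.finrank ℂ (CC N) = 2 * N := by
    simp only [Module.finrank_prod, finrank_euclideanSpace, Fintype.card_fin]; omega
  have hker : Module.finrank ℂ (fderiv ℂ G (p, cj p)).ker = m := by
    have h1 := LinearMap.finrank_range_add_finrank_ker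
      (fderiv ℂ G (p, cj p) : CC N →L[ℂ] _).toLinearMap
    rw [LinearMap.range_eq_top.2 hA, finrank_top, hdim] at h1
    simp only [Module.finrank_fintype_fun_eq_card, Fintype.card_fin] at h1
    have h2 : Module.finrank ℂ (fderiv ℂ G (p, cj p)).ker =
      Module.finrank ℂ (fderiv ℂ G (p, cj p)).toLinearMap.ker := rfl
    omega
  have hG1 : ∀ᶠ x in 𝓝 0, G (w1.F x) = 0 := by
    have : ∀ᶠ x in 𝓝 0, ∀ i, g i (w1.F x) = 0 := eventually_all.2 fun i => (hg i).2.2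
    exact this.mono fun x hx => funext hx
  have hGw : ∀ᶠ t in 𝓝 0, G (w.F t) = 0 := by
    have ht : Tendsto (fun x : w.V => ((x, 0) : w.V × Cn N)) (𝓝 0) (𝓝 0) :=
      (by fun_prop : Continuous _).tendsto' _ _ rfl
    filter_upwards [ht.eventually hG1, w.F_tend.eventually (psi D).zero] with x hx hx2
    have : w1.F (x, 0) = w.F x := hx2
    rw [← this]; exact hx
  have hrank : ∃ᶠ t in 𝓝 0, Module.finrank ℂ (fderiv ℂ G (p, cj p)).ker ≤
      Module.finrank ℂ (fderiv ℂ w.F t).range := by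
    rw [hker]; exact hw
  let T : Cn N × CC N → (Fin c → ℂ) := fun x => G ((psi D).f x)
  have hT : AnalyticAt ℂ T (0, (p, cj p)) := hG.comp_of_eq (psi D).an (psi D).f0
  let pre : (Cn N × CC N →L[ℂ] (Fin c → ℂ)) →L[ℂ] (Cn N →L[ℂ] (Fin c → ℂ)) :=
    (ContinuousLinearMap.compL ℂ (Cn N) (Cn N × CC N) (Fin c → ℂ)).flip
      (ContinuousLinearMap.inl ℂ (Cn N) (CC N))
  let k : CC N → (Cn N →L[ℂ] (Fin c → ℂ)) := fun x => pre (fderiv ℂ T (0, x))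
  have hin : AnalyticAt ℂ (fun x : CC N => ((0 : Cn N), x)) (p, cj p) :=
    analyticAt_const.prod analyticAt_id
  have hk : AnalyticAt ℂ k (p, cj p) :=
    (pre.analyticAt _).comp (hT.fderiv.comp_of_eq hin rfl)
  have hinw : Tendsto (fun t : w.V => ((0 : Cn N), w.F t)) (𝓝 0) (𝓝 (0, (p, cj p))) :=
    tendsto_const_nhds.prodMk_nhds w.F_tend
  have hkw : ∀ᶠ t in 𝓝 0, k (w.F t) = 0 := by
    have hev : ∀ᶠ t in 𝓝 (0 : w.V), ∀ᶠ s in 𝓝 (0 : Cn N), G (w1.F (t, s)) = 0 := by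
      let Gw : w.V × Cn N → (Fin c → ℂ) := fun x => G ((psi D).f (x.2, w.F x.1))
      have : ∀ᶠ x in 𝓝 ((0, 0) : w.V × Cn N), Gw x = 0 := hG1
      rw [nhds_prod_eq] at this
      exact this.curry
    filter_upwards [hev, hinw.eventually hT.eventually_analyticAt] with t h1 h2
    have d1 : HasFDerivAt (fun s : Cn N => T (s, w.F t)) (k (w.F t)) 0 :=
      HasFDerivAt.comp (g := T) (0 : Cn N) h2.differentiableAt.hasFDerivAt
        ((hasFDerivAt_id _).prodMk (hasFDerivAt_const _ _))
    have d2 : HasFDerivAt (fun s : Cn N => T (s, w.F t)) (0 : Cn N →L[ℂ] (Fin c → ℂ)) 0 :=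
      (hasFDerivAt_const 0 0).congr_of_eventuallyEq h1
    exact d1.unique d2
  have hρw : ∀ᶠ t in 𝓝 0, D.ρ (w.F t) = 0 :=
    (w.slice.eventually w.rho).mono fun t ht => ht.trans D.rho0
  have r1 := vanish_of_family hG (funext hg0) hA w.F_an w.F0 hGw hrank D.an hρw
  have r2 := vanish_of_family hG (funext hg0) hA w.F_an w.F0 hGw hrank hk hkw
  refine ⟨c, g, hc, fun i => (hg i).1, fun i => (hg i).2.1, hg0, hli, ?_, ?_⟩
  · filter_upwards [r1] with x hx h0
    exact hx (funext h0)
  · filter_upwards [r2, psi_der D, (psi D).zero, hG.eventually_analyticAt,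
      hin.continuousAt.tendsto.eventually (psi D).an.eventually_analyticAt] with x h1 h2 h3 h4 h5
      h0 v hv i
    have e1 := DFunLike.congr_fun (h1 (funext h0)) v
    let P : Cn N × CC N → CC N := (psi D).f
    have e2 : fderiv ℂ P (0, x) (v, 0) = (0, v) := h2 v hv
    have h3' : P (0, x) = x := h3
    have h5' : AnalyticAt ℂ P (0, x) := h5
    have d1 : HasFDerivAt G (fderiv ℂ G x) (P (0, x)) := by
      rw [h3']; exact h4.differentiableAt.hasFDerivAt
    have d2 : HasFDerivAt T ((fderiv ℂ G x).comp (fderiv ℂ P (0, x))) (0, x) :=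
      d1.comp (0, x) h5'.differentiableAt.hasFDerivAt
    have e3 : fderiv ℂ T (0, x) (v, 0) = 0 := e1
    rw [d2.fderiv, ContinuousLinearMap.comp_apply, e2, hGd x h4] at e3
    exact congrFun e3 i

end Fam
end CData
end

open Complex Topology
noncomputable section

lemma mem_tcone {E : Type*} [NormedAddCommGroup E] [NormedSpace ℝ E] [CompleteSpace E]
    {c : ℕ} {f : E → Fin c → ℝ} {f' : E →L[ℝ] (Fin c → ℝ)} {a : E} (hf : HasStrictFDerivAt f f' a)
    (hs : Function.Surjective f') (ha : f a = 0) {S : Set E} (hS : ∀ᶠ x in 𝓝 a, f x = 0 → x ∈ S)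
    {v : E} (hv : f' v = 0) : v ∈ tangentConeAt ℝ S a := by
  have hr : f'.range = ⊤ := LinearMap.range_eq_top.2 hs
  let γ : f'.ker → E := hf.implicitFunction f f' hr (f a)
  have h0 : γ 0 = a := hf.implicitFunction_apply_image hr
  have hγ : HasStrictFDerivAt γ f'.ker.subtypeL 0 := hf.to_implicitFunction hr
  have h1 : ∀ᶠ x in 𝓝 (0 : f'.ker), f (γ x) = f a := by
    have ht : Filter.Tendsto (fun x : f'.ker => (f a, x)) (𝓝 0) (𝓝 (f a, 0)) :=
      (by fun_prop : Continuous _).tendsto' _ _ rfl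
    exact ht.eventually (hf.map_implicitFunction_eq hr)
  have h2 : ∀ᶠ x in 𝓝 (0 : f'.ker), γ x ∈ S := by
    have ht : Filter.Tendsto γ (𝓝 0) (𝓝 a) := by
      have := hγ.continuousAt.tendsto
      rwa [h0] at this
    filter_upwards [h1, ht.eventually hS] with x h1 h2
    exact h2 (h1.trans ha)
  let s : Set f'.ker := {x | γ x ∈ S}
  have h3 := (hγ.hasFDerivAt.hasFDerivWithinAt (s := s)).mapsTo_tangent_cone
  have h4 : (⟨v, hv⟩ : f'.ker) ∈ tangentConeAt ℝ s 0 := by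
    rw [tangentConeAt_congr (s := s) (t := Set.univ) (by
      rw [nhdsWithin_univ]; exact nhdsWithin_eq_nhds.2 h2), tangentConeAt_univ]
    trivial
  have h5 := h3 h4
  rw [h0] at h5
  refine tangentConeAt_mono ?_ h5
  rintro _ ⟨x, hx, rfl⟩
  exact hx

namespace CData
open Filter
variable {N d : ℕ} {M : Set (Cn N)} {p : Cn N} {D : CData M p d}

lemma not_minimal {m : ℕ} (hm : m + d < 2 * N) {c : ℕ} {g : Fin c → CC N → ℂ}
    (hc : m + c = 2 * N) (ha : ∀ i, AnalyticAt ℂ (g i) (p, cj p))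
    (hsy : ∀ i c, g i (sg c) = (starRingEnd ℂ) (g i c)) (h0 : ∀ i, g i (p, cj p) = 0)
    (hli : LinearIndependent ℂ (fun i => fderiv ℂ (g i) (p, cj p)))
    (hv : ∀ᶠ x in 𝓝 ((p, cj p) : CC N), (∀ i, g i x = 0) → D.ρ x = 0)
    (hd : ∀ᶠ x in 𝓝 ((p, cj p) : CC N), (∀ i, g i x = 0) → ∀ v, fderiv ℂ D.ρ x (0, v) = 0 →
        ∀ i, fderiv ℂ (g i) x (0, v) = 0) : ¬ IsMinimalAt M d p := by
  have hli' : ∀ᶠ x in 𝓝 ((p, cj p) : CC N), LinearIndependent ℂ (fun i => fderiv ℂ (g i) x) := by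
    have ht : Tendsto (fun x i => fderiv ℂ (g i) x) (𝓝 ((p, cj p) : CC N))
        (𝓝 (fun i => fderiv ℂ (g i) (p, cj p))) :=
      tendsto_pi_nhds.2 fun i => (ha i).fderiv.continuousAt
    exact ht.eventually hli.eventually
  have ha' : ∀ᶠ x in 𝓝 ((p, cj p) : CC N), ∀ i, AnalyticAt ℂ (g i) x :=
    eventually_all.2 fun i => (ha i).eventually_analyticAt
  have hdg : Tendsto (fun z : Cn N => (z, cj z)) (𝓝 p) (𝓝 (p, cj p)) :=
    dg.continuous.tendsto p
  have hall := (hdg.eventually (hli'.and (ha'.and (hv.and (hd.and D.an.eventually_analyticAt))))).and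
    D.mem.eventually_nhds
  obtain ⟨B, hB, hBo, hpB⟩ := mem_nhds_iff.1 hall
  have hre : ∀ i z, ((g i (z, cj z)).re : ℂ) = g i (z, cj z) := by
    intro i z
    have := hsy i (z, cj z)
    simp only [sg_apply, cj_cj] at this
    exact Complex.conj_eq_iff_re.1 this.symm
  intro hmin
  apply hmin
  let R : Cn N → Fin c → ℝ := fun z k => (g k (z, cj z)).re
  have hR0 : ∀ z k, R z k = 0 ↔ g k (z, cj z) = 0 := by
    intro z k
    rw [← hre k z]; simp [R]
  let S : Set (Cn N) := {z | z ∈ B ∧ ∀ k, R z k = 0}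
  have hRan : ∀ z ∈ B, ∀ k, AnalyticAt ℝ (fun z => R z k) z := by
    intro z hz k
    have h1 : AnalyticAt ℝ (g k) (dg z) := ((hB hz).1.2.1 k).restrictScalars
    have h2 := h1.comp (dg.analyticAt z)
    exact (Complex.reCLM.analyticAt _).comp h2
  have hRd : ∀ z ∈ B, ∀ k v, ((fderiv ℝ (fun z => R z k) z v : ℝ) : ℂ) =
      fderiv ℂ (g k) (z, cj z) (v, cj v) := by
    intro z hz k v
    exact (real_fderiv ((hB hz).1.2.1 k).differentiableAt
      (Eventually.of_forall fun z => hre k z) v).2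
  have hRli : ∀ z ∈ B, LinearIndependent ℝ (fun k => fderiv ℝ (fun z => R z k) z) := by
    intro z hz
    rw [Fintype.linearIndependent_iff]
    intro a hsum
    have h1 := (Fintype.linearIndependent_iff.1 (hB hz).1.1) (fun i => (a i : ℂ)) ?_
    · intro i; exact_mod_cast h1 i
    · have key : ∀ v, (∑ i, (a i : ℂ) • fderiv ℂ (g i) (z, cj z)) (v, cj v) = 0 := by
        intro v
        have h2 := congrArg (fun r : ℝ => (r : ℂ)) (DFunLike.congr_fun hsum v)
        simp only [_root_.sum_apply, smul_apply, smul_eq_mul] at h2 ⊢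
        push_cast at h2
        rw [← Complex.ofReal_zero]
        refine Eq.trans ?_ h2
        refine Finset.sum_congr rfl fun i _ => ?_
        rw [hRd z hz]
      set Λ := ∑ i, (a i : ℂ) • fderiv ℂ (g i) (z, cj z) with hΛ
      have k2 : ∀ v : Cn N, Λ (v, 0) = 0 ∧ Λ (0, cj v) = 0 := by
        intro v
        have e1 := key v
        have e2 := key (Complex.I • v)
        have f1 : ((v, cj v) : CC N) = (v, 0) + (0, cj v) := by simp
        have f2 : ((Complex.I • v, cj (Complex.I • v)) : CC N) =
            Complex.I • (v, 0) - Complex.I • (0, cj v) := by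
          rw [map_smulₛₗ]; simp
        rw [f1, map_add] at e1
        rw [f2, map_sub, map_smul, map_smul, smul_eq_mul, smul_eq_mul] at e2
        have := Complex.I_mul_I
        constructor
        · linear_combination (1/2) * e1 - (Complex.I/2) * e2 + (Λ (v, 0) - Λ (0, cj v)) / 2 * this
        · linear_combination (1/2) * e1 + (Complex.I/2) * e2 - (Λ (v, 0) - Λ (0, cj v)) / 2 * this
      ext x
      · simpa using (k2 _).1
      · have := (k2 (cj x)).2
        simpa using this
  have hSM : S ⊆ M := by
    intro z hz
    have h1 := hB hz.1
    exact h1.2.self_of_nhds.2 (h1.1.2.2.1 fun i => (hR0 z i).1 (hz.2 i))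
  refine ⟨S, m, hSM, ⟨hpB, fun k => (hR0 p k).2 (h0 k)⟩, by omega, ?_, ?_⟩
  · intro q hq
    refine ⟨c, B, R, hBo, hq.1, ?_, fun k z hz => hRan z hz k, ?_, fun x hx => hRli x hx.2⟩
    · rw [hc]
      have h1 := finrank_real_of_complex (Cn N)
      rw [h1]; simp
    · ext z
      constructor
      · intro h; exact h.1
      · intro h; exact ⟨h, h.1⟩
  · intro q hq v hvv
    have hqB := hB hq.1
    have hTM : ∀ u ∈ tangentSpaceAt M q, fderiv ℂ D.ρ (q, cj q) (u, cj u) = 0 := by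
      let Lr : Cn N →L[ℝ] Cn d := ((fderiv ℂ D.ρ (q, cj q)).restrictScalars ℝ).comp dg
      have h1 : HasFDerivAt (fun z => D.ρ (z, cj z)) Lr q :=
        diag_hasFDerivAt hqB.1.2.2.2.2.differentiableAt (Eventually.of_forall fun _ => rfl)
      have h2 : HasFDerivWithinAt (fun z => D.ρ (z, cj z)) (0 : Cn N →L[ℝ] Cn d) M q := by
        refine (hasFDerivWithinAt_const (0 : Cn d) q M).congr_of_eventuallyEq ?_ ?_
        · filter_upwards [nhdsWithin_le_nhds hqB.2, self_mem_nhdsWithin] with z hz hzM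
          exact hz.1 hzM
        · exact hqB.2.self_of_nhds.1 (hSM hq)
      have h3 := (h1.hasFDerivWithinAt (s := M)).unique_on h2
      intro u hu
      have h4 : tangentSpaceAt M q ≤ Lr.toLinearMap.ker := by
        refine Submodule.span_le.2 ?_
        intro u hu
        exact h3 hu
      exact h4 hu
    obtain ⟨h1, u, hu, huv⟩ := hvv
    have h2 : Complex.I • u = v := huv
    have e1 := hTM v h1
    have e2 := hTM u hu
    have hu' : u = -(Complex.I • v) := by
      rw [← h2, smul_smul, Complex.I_mul_I]; simp
    have e3 : fderiv ℂ D.ρ (q, cj q) (0, cj v) = 0 := by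
      have f1 : ((v, cj v) : CC N) = (v, 0) + (0, cj v) := by simp
      have f2 : ((u, cj u) : CC N) = Complex.I • ((0, cj v) - (v, 0)) := by
        rw [hu', map_neg, map_smulₛₗ]; simp
      rw [f1, map_add] at e1
      rw [f2, map_smul, map_sub, smul_eq_zero] at e2
      have e4 := e2.resolve_left Complex.I_ne_zero
      have e5 : (2 : ℂ) • fderiv ℂ D.ρ (q, cj q) (0, cj v) = 0 := by
        rw [two_smul]
        calc _ = _ := rfl
          _ = (fderiv ℂ D.ρ (q, cj q) (v, 0) + fderiv ℂ D.ρ (q, cj q) (0, cj v)) +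
            (fderiv ℂ D.ρ (q, cj q) (0, cj v) - fderiv ℂ D.ρ (q, cj q) (v, 0)) := by abel
          _ = 0 := by rw [e1, e4, add_zero]
      exact (smul_eq_zero.1 e5).resolve_left two_ne_zero
    have e6 := hqB.1.2.2.2.1 (fun i => (hR0 q i).1 (hq.2 i)) _ e3
    have e7 : ∀ i, fderiv ℂ (g i) (q, cj q) (v, cj v) = 0 := by
      intro i
      have hda := (hqB.1.2.1 i).differentiableAt
      have hs : sg ((q, cj q) : CC N) = (q, cj q) := by simp
      have c1 : HasFDerivAt (g i) (fderiv ℂ (g i) (q, cj q)) (sg (q, cj q)) := by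
        rw [hs]; exact hda.hasFDerivAt
      have c2 := c1.conj' sg (starₗᵢ ℂ)
      have c3 : (fun y => (starₗᵢ ℂ : ℂ ≃ₛₗᵢ[starRingEnd ℂ] ℂ) (g i (sg y))) = g i := by
        funext y
        show (starRingEnd ℂ) (g i (sg y)) = _
        rw [hsy, Complex.conj_conj]
      rw [c3] at c2
      have c4 := DFunLike.congr_fun (c2.unique hda.hasFDerivAt) (v, 0)
      have c5 : (starRingEnd ℂ) (fderiv ℂ (g i) (q, cj q) (0, cj v)) =
        fderiv ℂ (g i) (q, cj q) (v, 0) := by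
        rw [← c4, conjCLM_apply]
        simp
      rw [e6 i, map_zero] at c5
      have f1 : ((v, cj v) : CC N) = (v, 0) + (0, cj v) := by simp
      rw [f1, map_add, ← c5, e6 i, add_zero]
    refine Submodule.subset_span ?_
    have hst : HasStrictFDerivAt R
        (ContinuousLinearMap.pi (fun k => fderiv ℝ (fun z => R z k) q)) q := by
      rw [hasStrictFDerivAt_pi]
      intro k
      exact (hRan q hq.1 k).hasStrictFDerivAt
    refine mem_tcone hst (surj_of_li (hRli q hq.1)) (funext hq.2) ?_ ?_
    · filter_upwards [hBo.mem_nhds hq.1] with z hz hz0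
      exact ⟨hz, fun k => congrFun hz0 k⟩
    · funext k
      have := hRd q hq.1 k v
      rw [e7 k] at this
      exact_mod_cast this

theorem orbit (D : CData M p d) (hmin : IsMinimalAt M d p) {W : Set (CC N)}
    (hW : W ∈ 𝓝 ((p, cj p) : CC N)) :
    ∀ᶠ z in 𝓝 p, ∃ ζ, D.Reach W (p, cj p) (z, ζ) := by
  obtain ⟨m, ⟨w, hw⟩, hmax⟩ := Fam.exists_max D
  by_cases hm : 2 * N ≤ m + d
  · exact Fam.orbit_A w hw hm hW
  · obtain ⟨c, g, h1, h2, h3, h4, h5, h6, h7⟩ := Fam.exists_g' w hw hmax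
    exact absurd hmin (not_minimal (D := D) (by omega) h1 h2 h3 h4 h5 h6 h7)

end CData
end

open Complex Topology
noncomputable section

/-- holomorphic near a point -/
def HolNear {E F : Type*} [NormedAddCommGroup E] [NormedSpace ℂ E]
    [NormedAddCommGroup F] [NormedSpace ℂ F] (f : E → F) (x : E) : Prop :=
  ∀ᶠ y in 𝓝 x, DifferentiableAt ℂ f y

lemma AnalyticAt.holNear {E F : Type*} [NormedAddCommGroup E] [NormedSpace ℂ E]
    [NormedAddCommGroup F] [NormedSpace ℂ F] [CompleteSpace F] {f : E → F} {x : E}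
    (hf : AnalyticAt ℂ f x) :
    HolNear f x := hf.eventually_analyticAt.mono fun _ h => h.differentiableAt

lemma HolNear.fderiv {E F : Type*} [NormedAddCommGroup E] [NormedSpace ℂ E]
    [NormedAddCommGroup F] [NormedSpace ℂ F] [FiniteDimensional ℂ E] [FiniteDimensional ℂ F]
    {f : E → F} {x : E} (hf : HolNear f x) : HolNear (fderiv ℂ f) x := by
  obtain ⟨U, hU, hUo, hx⟩ := mem_nhds_iff.1 hf
  have hd : DifferentiableOn ℂ f U := fun y hy => (hU hy).differentiableWithinAt
  filter_upwards [hUo.mem_nhds hx] with y hy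
  have h1 := hol_contDiffAt hUo hd hy
  have h2 : ContDiffAt ℂ 1 (_root_.fderiv ℂ f) y := h1.fderiv_right (by
    have : ((1 + 1 : ℕ∞) : WithTop ℕ∞) ≤ ((⊤ : ℕ∞) : WithTop ℕ∞) := WithTop.coe_le_coe.2 le_top
    exact this)
  exact h2.differentiableAt one_ne_zero

namespace CData
open Filter
variable {N d : ℕ} {M : Set (Cn N)} {p : Cn N} {D : CData M p d}

/-- complexified tuple annihilated by `v` along the Segre variety of `p` -/
def Good (D : CData M p d) {N' : ℕ} (v : Fin N' → ℂ) (g : Fin N' → Cn N → ℂ) : Prop :=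
  ∃ G : Fin N' → CC N → ℂ, (∀ j, HolNear (G j) (p, cj p)) ∧
    (∀ j, ∀ᶠ z in 𝓝 p, g j z = G j (z, cj z)) ∧
    ∀ᶠ ζ in 𝓝 (cj p), D.ρ (p, ζ) = 0 → ∑ j, v j * G j (p, ζ) = 0

lemma CR_complexify (D : CData M p d) (L : CRVectorField M p) :
    ∃ A : CC N → Cn N, HolNear A (p, cj p) ∧ (∀ᶠ z in 𝓝 p, ∀ j, A (z, cj z) j = L.coeff z j) ∧
      ∀ᶠ c in 𝓝 ((p, cj p) : CC N), D.ρ c = 0 → fderiv ℂ D.ρ c (0, A c) = 0 := by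
  have h0 : ∀ j, ∃ F : CC N → ℂ, AnalyticAt ℂ F (p, cj p) ∧
      ∀ᶠ z in 𝓝 p, F (z, cj z) = L.coeff z j := fun j => complexify (L.analytic j p L.mem)
  choose a ha ha2 using h0
  let A : CC N → Cn N := fun c => WithLp.toLp 2 (fun j => a j c)
  have hA : HolNear A (p, cj p) := by
    have : ∀ᶠ c in 𝓝 ((p, cj p) : CC N), ∀ j, DifferentiableAt ℂ (a j) c :=
      eventually_all.2 fun j => (ha j).holNear
    filter_upwards [this] with c hc
    rw [differentiableAt_euclidean]
    exact hc
  have hA2 : ∀ᶠ z in 𝓝 p, ∀ j, A (z, cj z) j = L.coeff z j := eventually_all.2 ha2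
  refine ⟨A, hA, hA2, ?_⟩
  have hdg : Tendsto (fun z : Cn N => (z, cj z)) (𝓝 p) (𝓝 (p, cj p)) :=
    dg.continuous.tendsto p
  -- tangency on M
  have htan : ∀ᶠ z in 𝓝 p, z ∈ M → fderiv ℂ D.ρ (z, cj z) (0, A (z, cj z)) = 0 := by
    have hk : ∀ k, ∀ᶠ z in 𝓝 p, z ∈ M →
        (fderiv ℂ D.ρ (z, cj z) (0, A (z, cj z))) k = 0 := by
      intro k
      have hev := (hdg.eventually D.an.eventually_analyticAt).and D.mem
      obtain ⟨U, hU, hUo, hpU⟩ := mem_nhds_iff.1 hev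
      let f : Cn N → ℝ := fun z => (D.ρ (z, cj z) k).re
      have hre : ∀ z, (f z : ℂ) = D.ρ (z, cj z) k := by
        intro z
        have := congrArg (fun y : Cn d => y k) (D.symm (z, cj z))
        simp only [sg_apply, cj_cj, cj_apply] at this
        exact Complex.conj_eq_iff_re.1 this.symm
      have hprj : ∀ y : Cn d, (EuclideanSpace.proj k : Cn d →L[ℂ] ℂ) y = y k := fun y => rfl
      have hfan : AnalyticOnNhd ℝ f U := by
        intro z hz
        have h1 : AnalyticAt ℝ D.ρ (dg z) := ((hU hz).1).restrictScalars
        have h2 := h1.comp (dg.analyticAt z)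
        have h3 := ((Complex.reCLM.comp
          ((EuclideanSpace.proj k : Cn d →L[ℂ] ℂ).restrictScalars ℝ)).analyticAt _).comp h2
        exact h3
      obtain ⟨V, hVo, hpV, hV⟩ := L.tangent f U hUo hpU hfan (by
        intro z hz
        show (D.ρ (z, cj z) k).re = 0
        rw [(hU hz.2).2.1 hz.1]; simp)
      filter_upwards [hVo.mem_nhds hpV, hUo.mem_nhds hpU, hA2] with z hzV hzU hzA hzM
      have h1 := hV z ⟨hzM, hzV⟩
      have hρd := (hU hzU).1.differentiableAt
      have hGd : HasFDerivAt (fun c => D.ρ c k)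
          ((EuclideanSpace.proj k : Cn d →L[ℂ] ℂ).comp (fderiv ℂ D.ρ (z, cj z))) (z, cj z) :=
        (EuclideanSpace.proj k : Cn d →L[ℂ] ℂ).hasFDerivAt.comp _ hρd.hasFDerivAt
      have h2 : ∀ j, wirtDBarR f z j = (fderiv ℂ D.ρ (z, cj z) (0, cbasis j 1)) k := by
        intro j
        rw [wirtDBarR_eq (G := fun c => D.ρ c k) hGd.differentiableAt
          (Eventually.of_forall fun z => hre z), hGd.fderiv]
        rfl
      rw [← sum_right, WithLp.ofLp_sum, Finset.sum_apply]
      refine Eq.trans (Finset.sum_congr rfl fun j _ => ?_) h1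
      rw [h2, hzA]; rfl
    filter_upwards [eventually_all.2 hk] with z hz hzM
    ext k
    exact hz k hzM
  -- propagate
  have hF : HolNear (fun c => fderiv ℂ D.ρ c (0, A c)) (p, cj p) := by
    filter_upwards [D.an.holNear.fderiv, hA] with c h1 h2
    exact h1.clm_apply ((differentiableAt_const _).prodMk h2)
  have htan' : ∀ᶠ c in 𝓝 ((p, cj p) : CC N), c.1 ∈ {z | z ∈ M →
      fderiv ℂ D.ρ (z, cj z) (0, A (z, cj z)) = 0} :=
    continuous_fst.continuousAt.tendsto.eventually htan
  obtain ⟨W', hW', hid⟩ := D.ident (hF.and htan')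
  filter_upwards [hW'] with c hc hρ
  exact hid _ (fun c => fderiv ℂ D.ρ c (0, A c)) (fun c hc => hc.1.differentiableWithinAt)
    (fun z hz hzW => hzW.2 hz) c hc hρ

lemma Good.apply {N' : ℕ} {v : Fin N' → ℂ} {g : Fin N' → Cn N → ℂ} (hg : D.Good v g)
    (L : CRVectorField M p) : D.Good v (fun j => L.apply (g j)) := by
  obtain ⟨G, hG, hGg, hv⟩ := hg
  obtain ⟨A, hA, hA2, hA3⟩ := D.CR_complexify L
  have hdg : Tendsto (fun z : Cn N => (z, cj z)) (𝓝 p) (𝓝 (p, cj p)) :=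
    dg.continuous.tendsto p
  refine ⟨fun j c => fderiv ℂ (G j) c (0, A c), ?_, ?_, ?_⟩
  · intro j
    filter_upwards [(hG j).fderiv, hA] with c h1 h2
    exact h1.clm_apply ((differentiableAt_const _).prodMk h2)
  · intro j
    filter_upwards [hdg.eventually (hG j), (hGg j).eventually_nhds, hA2] with z h1 h2 h3
    show ∑ l, L.coeff z l * wirtDBar (g j) z l = _
    rw [← sum_right]
    refine Finset.sum_congr rfl fun l _ => ?_
    rw [wirtDBar_eq h1 h2, h3]; rfl
  · obtain ⟨ψ, ψa, ψ0, ψ1, ψ2⟩ := D.exists_psi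
    have hin : Tendsto (fun ζ : Cn N => (p, ζ)) (𝓝 (cj p)) (𝓝 (p, cj p)) :=
      (by fun_prop : Continuous _).tendsto' _ _ rfl
    have hin0 : Tendsto (fun ζ : Cn N => ((0 : Cn N), (p, ζ))) (𝓝 (cj p)) (𝓝 (0, (p, cj p))) :=
      (by fun_prop : Continuous _).tendsto' _ _ rfl
    have hψt : Tendsto ψ (𝓝 (0, (p, cj p))) (𝓝 (p, cj p)) := by
      have := ψa.continuousAt.tendsto
      rwa [ψ0.self_of_nhds] at this
    have hv' : ∀ᶠ c in 𝓝 ((p, cj p) : CC N), D.ρ (p, c.2) = 0 → ∑ j, v j * G j (p, c.2) = 0 :=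
      (continuous_snd.tendsto ((p, cj p) : CC N)).eventually hv
    have hall := hin0.eventually (((hψt.eventually hv').and ψ1).eventually_nhds.and ψa.holNear)
    have hGd : ∀ᶠ c in 𝓝 ((p, cj p) : CC N), ∀ j, DifferentiableAt ℂ (G j) c :=
      eventually_all.2 hG
    filter_upwards [hall, hin.eventually ψ0, hin.eventually ψ2, hin.eventually hA3,
      hin.eventually hGd] with ζ h1 h2 h3 h4 h5 hρ
    have e1 := h3 _ (h4 hρ)
    obtain ⟨h6, h7⟩ := h1
    have hs : Tendsto (fun s : Cn N => (s, ((p, ζ) : CC N))) (𝓝 0) (𝓝 (0, (p, ζ))) :=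
      (by fun_prop : Continuous _).tendsto' _ _ rfl
    let T : CC N → ℂ := fun c => ∑ j, v j * G j c
    have hT : HasFDerivAt T (∑ j, v j • fderiv ℂ (G j) (p, ζ)) (p, ζ) :=
      HasFDerivAt.fun_sum fun j _ => (h5 j).hasFDerivAt.const_mul (v j)
    have hz : ∀ᶠ s in 𝓝 (0 : Cn N), T (ψ (s, (p, ζ))) = 0 := by
      filter_upwards [hs.eventually h6] with s hs
      have e2 : ψ (s, (p, ζ)) = (p, (ψ (s, (p, ζ))).2) := Prod.ext hs.2.1 rfl
      have e3 := hs.1 (by rw [← e2, hs.2.2]; exact hρ)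
      rw [← e2] at e3
      exact e3
    have hT' : HasFDerivAt T (∑ j, v j • fderiv ℂ (G j) (p, ζ)) (ψ (0, (p, ζ))) := by
      rw [h2]; exact hT
    have d1 := HasFDerivAt.comp (g := T) ((0 : Cn N), ((p, ζ) : CC N)) hT' h7.hasFDerivAt
    have d2 : HasFDerivAt (fun s : Cn N => (s, ((p, ζ) : CC N)))
        (ContinuousLinearMap.inl ℂ (Cn N) (CC N)) 0 :=
      (hasFDerivAt_id _).prodMk (hasFDerivAt_const _ _)
    have d3 := HasFDerivAt.comp (0 : Cn N) (f := fun s : Cn N => (s, ((p, ζ) : CC N))) d1 d2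
    have d4 : HasFDerivAt (fun s : Cn N => T (ψ (s, (p, ζ)))) (0 : Cn N →L[ℂ] ℂ) 0 :=
      (hasFDerivAt_const 0 0).congr_of_eventuallyEq hz
    have e4 := DFunLike.congr_fun (d3.unique d4) (A (p, ζ))
    simp only [ContinuousLinearMap.comp_apply, ContinuousLinearMap.inl_apply, e1,
      _root_.sum_apply, smul_apply, smul_eq_mul, zero_apply] at e4
    exact e4

lemma Good.applyList {N' : ℕ} {v : Fin N' → ℂ} {g : Fin N' → Cn N → ℂ} (hg : D.Good v g)
    (Ls : List (CRVectorField M p)) : D.Good v (fun j => CRApplyList Ls (g j)) := by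
  induction Ls with
  | nil => exact hg
  | cons L Ls ih => exact ih.apply L

lemma Good.value {N' : ℕ} {v : Fin N' → ℂ} {g : Fin N' → Cn N → ℂ} (hg : D.Good v g) :
    ∑ j, v j * g j p = 0 := by
  obtain ⟨G, hG, hGg, hv⟩ := hg
  have := hv.self_of_nhds D.rho0
  refine Eq.trans (Finset.sum_congr rfl fun j _ => ?_) this
  rw [(hGg j).self_of_nhds]

end CData
end

open Complex Topology
noncomputable section

/-- conjugate of a map -/
def star' {N N' : ℕ} (H : Cn N → Cn N') : Cn N → Cn N' := fun ζ => cj (H (cj ζ))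

lemma star'_hol {N N' : ℕ} {H : Cn N → Cn N'} {ζ : Cn N} (h : DifferentiableAt ℂ H (cj ζ)) :
    DifferentiableAt ℂ (star' H) ζ := DifferentiableAt.conj' cj cj h

lemma cj_tendsto {N : ℕ} (z : Cn N) : Filter.Tendsto (cj : Cn N → Cn N) (𝓝 z) (𝓝 (cj z)) :=
  cj.continuous.tendsto z

lemma cj_tendsto' {N : ℕ} (z : Cn N) : Filter.Tendsto (cj : Cn N → Cn N) (𝓝 (cj z)) (𝓝 z) := by
  have := cj_tendsto (cj z)
  rwa [cj_cj] at this

namespace CData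
open Filter
variable {N d : ℕ} {M : Set (Cn N)} {p : Cn N} {D : CData M p d}

lemma exists_R (D : CData M p d) {N' ℓ : ℕ} {M' : Set (Cn N')} {H : Cn N → Cn N'}
    (hH : HolNear H p) (hnd : FinNondeg M p M' ℓ H) :
    ∃ (k : ℕ) (R : CC N' → Cn k), AnalyticAt ℂ R (H p, cj (H p)) ∧
      (∀ᶠ w in 𝓝 (H p), w ∈ M' → R (w, cj w) = 0) ∧
      ∀ v : Cn N', (∀ᶠ ζ in 𝓝 (cj p), D.ρ (p, ζ) = 0 →
        fderiv ℂ R (H p, star' H ζ) (v, 0) = 0) → v = 0 := by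
  unfold FinNondeg at hnd
  obtain ⟨u, hu1, hu2, -⟩ := Submodule.exists_fun_fin_finrank_span_eq ℂ
    { v : Fin N' → ℂ | ∃ (Ls : List (CRVectorField M p)) (ρ' : Cn N' → ℝ) (U' : Set (Cn N')),
        Ls.length ≤ ℓ ∧ IsOpen U' ∧ H p ∈ U' ∧ AnalyticOnNhd ℝ ρ' U' ∧
        (∀ w ∈ M' ∩ U', ρ' w = 0) ∧
        v = fun j => CRApplyList Ls (fun z => wirtD ρ' (H z) j) p }
  have hu2' := hu2.trans hnd
  clear hu2
  choose Ls r U' hlen hUo hpU ha hz hu3 using hu1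
  obtain ⟨R, hR1, -, hR3⟩ := complexify_real (f := fun w i => r i w) (p := H p)
    (fun i => ha i _ (hpU i))
  refine ⟨_, R, hR1, ?_, ?_⟩
  · filter_upwards [hR3, eventually_all.2 fun i => (hUo i).mem_nhds (hpU i)] with w h1 h2 h3
    rw [h1]
    ext i
    simp [hz i w ⟨h3, h2 i⟩]
  · intro v hv
    let φ : (Fin N' → ℂ) →ₗ[ℂ] ℂ :=
      { toFun := fun x => ∑ j, v j * x j
        map_add' := fun x y => by simp [mul_add, Finset.sum_add_distrib]
        map_smul' := fun c x => by
          simp only [Pi.smul_apply, smul_eq_mul, RingHom.id_apply, Finset.mul_sum]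
          exact Finset.sum_congr rfl fun j _ => by ring }
    have hHc : Tendsto H (𝓝 p) (𝓝 (H p)) := hH.self_of_nhds.continuousAt.tendsto
    have hs : Tendsto (star' H) (𝓝 (cj p)) (𝓝 (cj (H p))) :=
      (cj_tendsto _).comp (hHc.comp (cj_tendsto' p))
    have hHH : Tendsto (fun c : CC N => (H c.1, star' H c.2)) (𝓝 (p, cj p)) (𝓝 (H p, cj (H p))) :=
      (hHc.comp (continuous_fst.tendsto _)).prodMk_nhds (hs.comp (continuous_snd.tendsto _))
    have hdg : Tendsto (fun z : Cn N' => (z, cj z)) (𝓝 (H p)) (𝓝 (H p, cj (H p))) :=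
      dg.continuous.tendsto _
    have hgood : ∀ i, D.Good v (fun j z => wirtD (r i) (H z) j) := by
      intro i
      have hprj : ∀ q, DifferentiableAt ℂ R q → HasFDerivAt (fun c => R c i)
          ((EuclideanSpace.proj i : Cn _ →L[ℂ] ℂ).comp (fderiv ℂ R q)) q := fun q hq =>
        (EuclideanSpace.proj i : Cn _ →L[ℂ] ℂ).hasFDerivAt.comp _ hq.hasFDerivAt
      refine ⟨fun j c => (fderiv ℂ R (H c.1, star' H c.2) (cbasis j 1, 0)) i, ?_, ?_, ?_⟩
      · intro j
        have e1 : ∀ᶠ c in 𝓝 ((p, cj p) : CC N), DifferentiableAt ℂ H c.1 :=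
          (continuous_fst.tendsto ((p, cj p) : CC N)).eventually hH
        have e2 : ∀ᶠ c in 𝓝 ((p, cj p) : CC N), DifferentiableAt ℂ H (cj c.2) :=
          ((cj_tendsto' p).comp (continuous_snd.tendsto ((p, cj p) : CC N))).eventually hH
        filter_upwards [hHH.eventually hR1.holNear.fderiv, e1, e2] with c h1 h2 h3
        have h4 : DifferentiableAt ℂ (fun c : CC N => (H c.1, star' H c.2)) c :=
          (h2.comp c differentiableAt_fst).prodMk
            (DifferentiableAt.comp (g := star' H) c (star'_hol h3) differentiableAt_snd)
        have h5 : DifferentiableAt ℂ (fun c : CC N => fderiv ℂ R (H c.1, star' H c.2)) c :=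
          DifferentiableAt.comp (g := fderiv ℂ R) c h1 h4
        exact (EuclideanSpace.proj i : Cn _ →L[ℂ] ℂ).differentiableAt.comp c
          (h5.clm_apply (differentiableAt_const _))
      · intro j
        filter_upwards [hHc.eventually (hdg.eventually hR1.holNear),
          hHc.eventually hR3.eventually_nhds] with z h1 h2
        rw [wirtD_eq (G := fun c => R c i) (hprj _ h1).differentiableAt
          (h2.mono fun w hw => by rw [hw]), (hprj _ h1).fderiv]
        simp [star']
      · filter_upwards [hv] with ζ h1 h2
        have h3 := h1 h2
        rw [← sum_left] at h3
        have h4 := congrArg (fun y : Cn _ => y i) h3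
        simpa [WithLp.ofLp_sum, Finset.sum_apply] using h4
    have hφ : ∀ i, φ (u i) = 0 := by
      intro i
      have := ((hgood i).applyList (Ls i)).value
      rw [hu3 i]
      exact this
    have hφ0 : ∀ x, φ x = 0 := by
      intro x
      have hx : x ∈ Submodule.span ℂ (Set.range u) := by rw [hu2']; trivial
      induction hx using Submodule.span_induction with
      | mem x hx => obtain ⟨i, rfl⟩ := hx; exact hφ i
      | zero => exact map_zero φ
      | add x y _ _ hx hy => rw [map_add, hx, hy, add_zero]
      | smul a x _ hx => rw [map_smul, hx, smul_zero]
    ext j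
    have := hφ0 (Pi.single j 1)
    simpa [φ, Pi.single_apply] using this

lemma exists_chart (D : CData M p d) : ∃ (K : Submodule ℂ (CC N)) (l : CC N →L[ℂ] K)
    (Γ : Cn N × K → CC N), AnalyticAt ℂ Γ (p, l (p, cj p)) ∧ Γ (p, l (p, cj p)) = (p, cj p) ∧
      (∀ᶠ c in 𝓝 ((p, cj p) : CC N), D.ρ c = 0 → Γ (c.1, l c) = c) ∧
      ∀ᶠ y in 𝓝 (p, l (p, cj p)), (Γ y).1 = y.1 ∧ D.ρ (Γ y) = 0 := by
  let g : CC N → Cn N × Cn d := fun c => (c.1, D.ρ c)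
  have hg : AnalyticAt ℂ g (p, cj p) := analyticAt_fst.prod D.an
  have hgd : ∀ v, fderiv ℂ g (p, cj p) v = (v.1, fderiv ℂ D.ρ (p, cj p) v) := by
    intro v
    have : HasFDerivAt g ((ContinuousLinearMap.fst ℂ (Cn N) (Cn N)).prod
        (fderiv ℂ D.ρ (p, cj p))) (p, cj p) :=
      hasFDerivAt_fst.prodMk D.an.differentiableAt.hasFDerivAt
    rw [this.fderiv]; rfl
  have hA : Function.Surjective (fderiv ℂ g (p, cj p)) := by
    rintro ⟨a, b⟩
    obtain ⟨v, hv⟩ := D.surj2 (b - fderiv ℂ D.ρ (p, cj p) (a, 0))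
    refine ⟨(a, v), ?_⟩
    rw [hgd]
    have e : ((a, v) : CC N) = (a, 0) + (0, v) := by simp
    have hv' : fderiv ℂ D.ρ (p, cj p) (0, v) = b - fderiv ℂ D.ρ (p, cj p) (a, 0) := hv
    rw [e, map_add, hv', add_sub_cancel]
    simp
  obtain ⟨K, -, l, Γ, hΓ, hΓ0, hΓl, hΓr⟩ := straighten' hg hA
  have hg0 : g (p, cj p) = (p, 0) := Prod.ext rfl D.rho0
  rw [hg0] at hΓ hΓ0 hΓr
  have hin : AnalyticAt ℂ (fun y : Cn N × K => ((y.1, (0 : Cn d)), y.2)) (p, l (p, cj p)) :=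
    (analyticAt_fst.prod analyticAt_const).prod analyticAt_snd
  refine ⟨K, l, fun y => Γ ((y.1, 0), y.2), hΓ.comp_of_eq hin rfl, hΓ0, ?_, ?_⟩
  · filter_upwards [hΓl] with c h1 h2
    have : g c = (c.1, 0) := Prod.ext rfl h2
    rw [this] at h1
    exact h1
  · filter_upwards [hin.continuousAt.tendsto.eventually hΓr] with y hy
    exact ⟨congrArg Prod.fst hy.1, congrArg Prod.snd hy.1⟩

lemma exists_section (D : CData M p d) : ∀ᶠ c in 𝓝 ((p, cj p) : CC N), D.ρ c = 0 →
    ∃ σ : Cn N → Cn N, Tendsto σ (𝓝 c.1) (𝓝 c.2) ∧ ∀ᶠ z in 𝓝 c.1, D.ρ (z, σ z) = 0 := by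
  obtain ⟨K, l, Γ, h1, h2, h3, h4⟩ := D.exists_chart
  have ht : Tendsto (fun c : CC N => (c.1, l c)) (𝓝 (p, cj p)) (𝓝 (p, l (p, cj p))) :=
    (continuous_fst.prodMk l.continuous).tendsto _
  filter_upwards [h3, ht.eventually h4.eventually_nhds,
    ht.eventually h1.eventually_analyticAt] with c g1 g2 g3 hρ
  have hz : Tendsto (fun z : Cn N => (z, l c)) (𝓝 c.1) (𝓝 (c.1, l c)) :=
    (by fun_prop : Continuous _).tendsto' _ _ rfl
  refine ⟨fun z => (Γ (z, l c)).2, ?_, ?_⟩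
  · have := (g3.continuousAt.tendsto.comp hz)
    rw [g1 hρ] at this
    exact (continuous_snd.tendsto c).comp this
  · filter_upwards [hz.eventually g2] with z hz
    have e : (z, (Γ (z, l c)).2) = Γ (z, l c) := Prod.ext hz.1.symm rfl
    rw [e]; exact hz.2

lemma nondeg (D : CData M p d) {V Z : Type*} [NormedAddCommGroup V] [NormedSpace ℂ V]
    [FiniteDimensional ℂ V] [NormedAddCommGroup Z] [NormedSpace ℂ Z] [CompleteSpace Z]
    {J : CC N → V →L[ℂ] Z} (hJ : HolNear J (p, cj p))
    (h0 : ∀ v, (∀ᶠ ζ in 𝓝 (cj p), D.ρ (p, ζ) = 0 → J (p, ζ) v = 0) → v = 0) :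
    ∀ᶠ c in 𝓝 ((p, cj p) : CC N), D.ρ c = 0 →
      ∀ v, (∀ᶠ ζ in 𝓝 c.2, D.ρ (c.1, ζ) = 0 → J (c.1, ζ) v = 0) → v = 0 := by
  have : ProperSpace V := FiniteDimensional.proper ℂ V
  obtain ⟨K, l, Γ, h1, h2, h3, h4⟩ := D.exists_chart
  set b := l (p, cj p) with hb
  have hΓt : Tendsto Γ (𝓝 (p, b)) (𝓝 (p, cj p)) := by
    have := h1.continuousAt.tendsto
    rwa [h2] at this
  obtain ⟨r, hr, hball⟩ := Metric.eventually_nhds_iff_ball.1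
    ((h4.and h1.eventually_analyticAt).and (hΓt.eventually hJ))
  have ht : Tendsto (fun c : CC N => (c.1, l c)) (𝓝 (p, cj p)) (𝓝 (p, b)) :=
    (continuous_fst.prodMk l.continuous).tendsto _
  have hmem : ∀ z ∈ Metric.ball p r, ∀ s ∈ Metric.ball b r, (z, s) ∈ Metric.ball (p, b) r := by
    intro z hz s hs
    rw [← ball_prod_same]; exact ⟨hz, hs⟩
  by_contra hcon
  rw [not_eventually] at hcon
  have hcon2 : ∃ᶠ c in 𝓝 ((p, cj p) : CC N), ∃ v : V, ‖v‖ = 1 ∧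
      ∀ s ∈ Metric.ball b r, J (Γ (c.1, s)) v = 0 := by
    refine (hcon.and_eventually (h3.and (ht.eventually (Metric.ball_mem_nhds _ hr)))).mono ?_
    rintro c ⟨g1, g2, g3⟩
    push Not at g1
    obtain ⟨hρ, v, hv, hv0⟩ := g1
    replace g3 : (c.1, l c) ∈ Metric.ball (p, b) r := g3
    rw [← ball_prod_same] at g3
    have hc1 : c.1 ∈ Metric.ball p r := g3.1
    have hc2 : l c ∈ Metric.ball b r := g3.2
    have g2' := g2 hρ
    have hsl : Tendsto (fun s : K => Γ (c.1, s)) (𝓝 (l c)) (𝓝 c) := by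
      have e1 : Tendsto (fun s : K => (c.1, s)) (𝓝 (l c)) (𝓝 (c.1, l c)) :=
        (by fun_prop : Continuous _).tendsto' _ _ rfl
      have e2 := (hball _ (hmem _ hc1 _ hc2)).1.2.continuousAt.tendsto.comp e1
      rw [g2'] at e2
      exact e2
    have hzero : ∀ s ∈ Metric.ball b r, J (Γ (c.1, s)) v = 0 := by
      refine hol_ball_zero (f := fun s => J (Γ (c.1, s)) v) ?_ hc2 ?_
      · intro s hs
        have e := hball _ (hmem _ hc1 _ hs)
        have e1 : DifferentiableAt ℂ (fun s : K => (c.1, s)) s :=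
          (differentiableAt_const _).prodMk differentiableAt_id
        have e2 : DifferentiableAt ℂ (fun s : K => Γ (c.1, s)) s :=
          DifferentiableAt.comp (g := Γ) s e.1.2.differentiableAt e1
        have e3 : DifferentiableAt ℂ (fun s : K => J (Γ (c.1, s))) s :=
          DifferentiableAt.comp (g := J) s e.2 e2
        exact (e3.clm_apply (differentiableAt_const v)).differentiableWithinAt
      · have e1 : ∀ᶠ s in 𝓝 (l c), (Γ (c.1, s)).2 ∈ {ζ | D.ρ (c.1, ζ) = 0 → J (c.1, ζ) v = 0} :=
          ((continuous_snd.tendsto c).comp hsl).eventually hv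
        filter_upwards [e1, Metric.isOpen_ball.mem_nhds hc2] with s hs hsb
        have e := hball _ (hmem _ hc1 _ hsb)
        have e3 : (c.1, (Γ (c.1, s)).2) = Γ (c.1, s) := Prod.ext e.1.1.1.symm rfl
        have e4 : D.ρ (c.1, (Γ (c.1, s)).2) = 0 → J (c.1, (Γ (c.1, s)).2) v = 0 := hs
        rw [e3] at e4
        exact e4 e.1.1.2
    have hn : (‖v‖ : ℂ) ≠ 0 := by exact_mod_cast norm_ne_zero_iff.2 hv0
    refine ⟨((‖v‖ : ℂ))⁻¹ • v, ?_, fun s hs => by rw [map_smul, hzero s hs, smul_zero]⟩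
    rw [norm_smul, norm_inv, Complex.norm_real, norm_norm]
    exact inv_mul_cancel₀ (norm_ne_zero_iff.2 hv0)
  have hne : NeBot (𝓝 ((p, cj p) : CC N) ⊓ 𝓟 {c | ∃ v : V, ‖v‖ = 1 ∧
      ∀ s ∈ Metric.ball b r, J (Γ (c.1, s)) v = 0}) := frequently_iff_neBot.1 hcon2
  let U : Ultrafilter (CC N) := Ultrafilter.of (𝓝 ((p, cj p) : CC N) ⊓ 𝓟 {c | ∃ v : V, ‖v‖ = 1 ∧
      ∀ s ∈ Metric.ball b r, J (Γ (c.1, s)) v = 0})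
  have hU1 : (U : Filter (CC N)) ≤ 𝓝 (p, cj p) := (Ultrafilter.of_le _).trans inf_le_left
  have hU2 : ∀ᶠ c in (U : Filter (CC N)), ∃ v : V, ‖v‖ = 1 ∧
      ∀ s ∈ Metric.ball b r, J (Γ (c.1, s)) v = 0 :=
    le_principal_iff.1 ((Ultrafilter.of_le _).trans inf_le_right)
  have hch : ∃ w : CC N → V, ∀ᶠ c in (U : Filter (CC N)), ‖w c‖ = 1 ∧
      ∀ s ∈ Metric.ball b r, J (Γ (c.1, s)) (w c) = 0 := by
    classical
    refine ⟨fun c => if h : ∃ v : V, ‖v‖ = 1 ∧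
      ∀ s ∈ Metric.ball b r, J (Γ (c.1, s)) v = 0 then h.choose else 0, ?_⟩
    filter_upwards [hU2] with c hc
    rw [dif_pos hc]
    exact hc.choose_spec
  obtain ⟨w, hw⟩ := hch
  obtain ⟨v, hv1, hv2⟩ := (isCompact_sphere (0 : V) 1).ultrafilter_le_nhds' (U.map w)
    (Ultrafilter.mem_map.2 (by filter_upwards [hw] with c hc; simpa using hc.1))
  have hvt : Tendsto w U (𝓝 v) := hv2
  have hlim : ∀ s ∈ Metric.ball b r, J (Γ (p, s)) v = 0 := by
    intro s hs
    have e := hball _ (hmem p (Metric.mem_ball_self hr) s hs)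
    have t1 : Tendsto (fun c : CC N => (c.1, s)) U (𝓝 (p, s)) := by
      have : Tendsto (fun c : CC N => (c.1, s)) (𝓝 (p, cj p)) (𝓝 (p, s)) :=
        (by fun_prop : Continuous _).tendsto' _ _ rfl
      exact this.mono_left hU1
    have t2 := e.2.continuousAt.tendsto.comp (e.1.2.continuousAt.tendsto.comp t1)
    have t3 : Tendsto (fun c : CC N => J (Γ (c.1, s)) (w c)) U (𝓝 (J (Γ (p, s)) v)) :=
      ((isBoundedBilinearMap_apply (𝕜 := ℂ) (E := V) (F := Z)).continuous.tendsto
        (J (Γ (p, s)), v)).comp (t2.prodMk_nhds hvt)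
    have t4 : Tendsto (fun c : CC N => J (Γ (c.1, s)) (w c)) U (𝓝 0) :=
      tendsto_const_nhds.congr' (by filter_upwards [hw] with c hc; exact (hc.2 s hs).symm)
    exact tendsto_nhds_unique t3 t4
  have hv0 : v = 0 := by
    apply h0
    have hin : Tendsto (fun ζ : Cn N => (p, ζ)) (𝓝 (cj p)) (𝓝 (p, cj p)) :=
      (by fun_prop : Continuous _).tendsto' _ _ rfl
    have hl : Tendsto (fun c : CC N => l c) (𝓝 (p, cj p)) (𝓝 b) := l.continuous.tendsto _
    filter_upwards [hin.eventually h3,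
      hin.eventually (hl.eventually (Metric.ball_mem_nhds _ hr))] with ζ g1 g2 hρ
    have := hlim _ g2
    rwa [g1 hρ] at this
  rw [hv0] at hv1
  simp at hv1

end CData
end

open Complex Topology
noncomputable section

open Filter Asymptotics in
lemma ultra_of_not_isBigO {X E : Type*} [NormedAddCommGroup E] {F : Filter X} {f : X → E}
    {g : X → ℝ} (h : ¬ f =O[F] g) :
    ∃ U : Ultrafilter X, (U : Filter X) ≤ F ∧ ∀ C : ℝ, ∀ᶠ x in (U : Filter X), C * ‖g x‖ < ‖f x‖ := by
  let S : ℕ → Set X := fun n => {x | (n : ℝ) * ‖g x‖ < ‖f x‖}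
  have hne : NeBot (⨅ n : ℕ, F ⊓ 𝓟 (S n)) := by
    have hd : Antitone fun n : ℕ => F ⊓ 𝓟 (S n) := by
      intro m n hmn
      refine inf_le_inf_left _ (principal_mono.2 ?_)
      intro x hx
      have hx' : (n : ℝ) * ‖g x‖ < ‖f x‖ := hx
      have : (m : ℝ) * ‖g x‖ ≤ n * ‖g x‖ := by gcongr
      exact this.trans_lt hx'
    refine iInf_neBot_of_directed' hd.directed_ge fun n => ?_
    rw [← frequently_iff_neBot]
    by_contra hcon
    rw [not_frequently] at hcon
    refine h (IsBigO.of_bound n ?_)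
    filter_upwards [hcon] with x hx
    exact not_lt.1 hx
  refine ⟨Ultrafilter.of (⨅ n : ℕ, F ⊓ 𝓟 (S n)),
    (Ultrafilter.of_le _).trans ((iInf_le _ (0 : ℕ)).trans inf_le_left), ?_⟩
  intro C
  obtain ⟨n, hn⟩ := exists_nat_ge C
  have h1 : ((Ultrafilter.of (⨅ n : ℕ, F ⊓ 𝓟 (S n))) : Filter X) ≤ 𝓟 (S n) :=
    (Ultrafilter.of_le _).trans ((iInf_le _ n).trans inf_le_right)
  filter_upwards [le_principal_iff.1 h1] with x hx
  have hx' : (n : ℝ) * ‖g x‖ < ‖f x‖ := hx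
  have : C * ‖g x‖ ≤ n * ‖g x‖ := by gcongr
  exact this.trans_lt hx'

open Filter in
lemma ultra_normalize {X : Type*} {n : ℕ} {U : Ultrafilter X} {f : X → Cn n}
    (h : ∀ᶠ x in (U : Filter X), 0 < ‖f x‖) :
    ∃ v : Cn n, ‖v‖ = 1 ∧ Tendsto (fun x => (‖f x‖⁻¹ : ℝ) • f x) U (𝓝 v) := by
  obtain ⟨v, hv1, hv2⟩ := (isCompact_sphere (0 : Cn n) 1).ultrafilter_le_nhds'
    (U.map fun x => (‖f x‖⁻¹ : ℝ) • f x)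
    (Ultrafilter.mem_map.2 (by
      filter_upwards [h] with x hx
      have : ‖(‖f x‖⁻¹ : ℝ) • f x‖ = 1 := by
        rw [norm_smul, norm_inv, norm_norm, inv_mul_cancel₀ hx.ne']
      simpa using this))
  exact ⟨v, by simpa using hv1, hv2⟩

open Filter Asymptotics in
lemma linearize {X : Type*} {n k : ℕ} {U : Filter X} [U.NeBot] {R : CC n → Cn k}
    {L : CC n →L[ℂ] Cn k} {q : CC n} (hR : HasStrictFDerivAt R L q) {P Q : X → CC n}
    (hP : Tendsto P U (𝓝 q)) (hQ : Tendsto Q U (𝓝 q))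
    (hRP : ∀ᶠ x in U, R (P x) = 0) (hRQ : ∀ᶠ x in U, R (Q x) = 0)
    {f e : X → Cn n} (hPQ : ∀ x, P x - Q x = (f x, e x)) (he : e =o[U] f) {v : Cn n}
    (hv : Tendsto (fun x => (‖f x‖⁻¹ : ℝ) • f x) U (𝓝 v)) : L (v, 0) = 0 := by
  have h1 := hR.isLittleO.comp_tendsto (hP.prodMk_nhds hQ)
  have h2 : (fun x => L (P x - Q x)) =o[U] fun x => P x - Q x := by
    refine (h1.neg_left).congr' ?_ ?_
    · filter_upwards [hRP, hRQ] with x h3 h4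
      simp [h3, h4]
    · exact Eventually.of_forall fun x => rfl
  have h3 : (fun x => P x - Q x) =O[U] f := by
    have : (fun x => (f x, e x)) =O[U] f := (isBigO_refl _ _).prod_left he.isBigO
    exact this.congr_left fun x => (hPQ x).symm
  have h4 := h2.trans_isBigO h3
  have h5 : (fun x => L ((0 : Cn n), e x)) =o[U] f := by
    refine IsBigO.trans_isLittleO (IsBigO.of_bound ‖L‖ (Eventually.of_forall fun x => ?_)) he
    refine (L.le_opNorm _).trans (le_of_eq ?_)
    simp [Prod.norm_def]
  have h6 : (fun x => L (f x, (0 : Cn n))) =o[U] f := by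
    refine (h4.sub h5).congr_left fun x => ?_
    rw [hPQ, ← map_sub]; simp
  have h7 : Tendsto (fun x => (‖f x‖⁻¹ : ℝ) • L (f x, (0 : Cn n))) U (𝓝 0) := by
    have := h6.norm_right.tendsto_inv_smul_nhds_zero
    exact this
  have h8 : Tendsto (fun x => L ((‖f x‖⁻¹ : ℝ) • f x, (0 : Cn n))) U (𝓝 (L (v, 0))) :=
    (L.continuous.tendsto _).comp (hv.prodMk_nhds tendsto_const_nhds)
  refine tendsto_nhds_unique h8 (h7.congr fun x => ?_)
  have e : (((‖f x‖⁻¹ : ℝ) • f x, (0 : Cn n)) : CC n) = ((‖f x‖⁻¹ : ℝ) : ℂ) • (f x, (0 : Cn n)) := by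
    ext <;> simp
  rw [e, map_smul]
  rfl

open Filter Asymptotics in
/-- the set where `Hn - H` is locally uniformly `O(a)` -/
def GSet {N N' : ℕ} (l : Filter ℕ) (Hn : ℕ → Cn N → Cn N') (H : Cn N → Cn N') (a : ℕ → ℝ) :
    Set (Cn N) :=
  {z | (fun x : ℕ × Cn N => Hn x.1 x.2 - H x.2) =O[l ×ˢ 𝓝 z] fun x : ℕ × Cn N => a x.1}

open Filter Asymptotics in
lemma GSet_open {N N' : ℕ} {l : Filter ℕ} {Hn : ℕ → Cn N → Cn N'} {H : Cn N → Cn N'} {a : ℕ → ℝ}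
    {z : Cn N} (hz : z ∈ GSet l Hn H a) : ∀ᶠ w in 𝓝 z, w ∈ GSet l Hn H a := by
  obtain ⟨C, hC⟩ := IsBigO.bound hz
  obtain ⟨A, hA, B, hB, hAB⟩ := eventually_prod_iff.1 hC
  filter_upwards [hB.eventually_nhds] with w hw
  exact IsBigO.of_bound C (eventually_prod_iff.2 ⟨A, hA, B, hw, hAB⟩)

namespace CData
open Filter Asymptotics
variable {N d : ℕ} {M : Set (Cn N)} {p : Cn N}

lemma propagate (D : CData M p d) {N' k : ℕ} {l : Filter ℕ} {Hn : ℕ → Cn N → Cn N'}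
    {H : Cn N → Cn N'} {R : CC N' → Cn k} (hH : HolNear H p)
    (hHn : ∀ᶠ z in 𝓝 p, Tendsto (fun x : ℕ × Cn N => Hn x.1 x.2 - H x.2) (l ×ˢ 𝓝 z) (𝓝 0))
    (hR : AnalyticAt ℂ R (H p, cj (H p)))
    {W : Set (CC N)} (hW : W ∈ 𝓝 ((p, cj p) : CC N))
    (hRn : ∀ᶠ n in l, ∀ c ∈ W, D.ρ c = 0 → R (Hn n c.1, star' (Hn n) c.2) = 0)
    (hRH : ∀ c ∈ W, D.ρ c = 0 → R (H c.1, star' H c.2) = 0)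
    (hnd : ∀ v : Cn N', (∀ᶠ ζ in 𝓝 (cj p), D.ρ (p, ζ) = 0 →
        fderiv ℂ R (H p, star' H ζ) (v, 0) = 0) → v = 0) :
    ∀ᶠ c in 𝓝 ((p, cj p) : CC N), D.ρ c = 0 → ∀ a : ℕ → ℝ, cj c.2 ∈ GSet l Hn H a →
      c.1 ∈ GSet l Hn H a := by
  have hHc : Tendsto H (𝓝 p) (𝓝 (H p)) := hH.self_of_nhds.continuousAt.tendsto
  have hs : Tendsto (star' H) (𝓝 (cj p)) (𝓝 (cj (H p))) :=
    (cj_tendsto _).comp (hHc.comp (cj_tendsto' p))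
  have hHH : Tendsto (fun c : CC N => (H c.1, star' H c.2)) (𝓝 (p, cj p)) (𝓝 (H p, cj (H p))) :=
    (hHc.comp (continuous_fst.tendsto _)).prodMk_nhds (hs.comp (continuous_snd.tendsto _))
  have t1 : Tendsto (fun c : CC N => c.1) (𝓝 (p, cj p)) (𝓝 p) := continuous_fst.tendsto _
  have t2 : Tendsto (fun c : CC N => cj c.2) (𝓝 (p, cj p)) (𝓝 p) :=
    (cj_tendsto' p).comp (continuous_snd.tendsto ((p, cj p) : CC N))
  have e1 := t1.eventually hH
  have e2 := t2.eventually hH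
  have f1 := t1.eventually hHn
  have f2 := t2.eventually hHn
  let inl' : Cn N' →L[ℂ] CC N' := ContinuousLinearMap.inl ℂ (Cn N') (Cn N')
  let J : CC N → Cn N' →L[ℂ] Cn k := fun c => (fderiv ℂ R (H c.1, star' H c.2)).comp inl'
  have hJa : ∀ c v, J c v = fderiv ℂ R (H c.1, star' H c.2) (v, 0) := fun c v => rfl
  have hJ : HolNear J (p, cj p) := by
    filter_upwards [hHH.eventually hR.holNear.fderiv, e1, e2] with c h1 h2 h3
    have h4 : DifferentiableAt ℂ (fun c : CC N => (H c.1, star' H c.2)) c :=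
      (h2.comp c differentiableAt_fst).prodMk
        (DifferentiableAt.comp (g := star' H) c (star'_hol h3) differentiableAt_snd)
    have h5 : DifferentiableAt ℂ (fun c : CC N => fderiv ℂ R (H c.1, star' H c.2)) c :=
      DifferentiableAt.comp (g := fderiv ℂ R) c h1 h4
    exact h5.clm_comp (differentiableAt_const _)
  have hN := D.nondeg hJ hnd
  filter_upwards [hN, D.exists_section.eventually_nhds, f1, f2.eventually_nhds, e1,
    e2.eventually_nhds, (hHH.eventually hR.eventually_analyticAt).eventually_nhds,
    (eventually_mem_nhds_iff.2 hW).eventually_nhds]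
    with c hN hS hf1 hf2 he1 he2 hRa hWc hρ a hG
  by_contra hcon
  obtain ⟨U, hU, hUC⟩ := ultra_of_not_isBigO hcon
  obtain ⟨v, hv1, hv⟩ := ultra_normalize (U := U)
    (f := fun x : ℕ × Cn N => Hn x.1 x.2 - H x.2) (by simpa using hUC 0)
  have hUa : (fun x : ℕ × Cn N => a x.1) =o[(U : Filter _)]
      fun x : ℕ × Cn N => Hn x.1 x.2 - H x.2 := by
    refine IsLittleO.of_bound fun C hC => ?_
    filter_upwards [hUC C⁻¹] with x hx
    rw [inv_mul_lt_iff₀ hC] at hx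
    exact hx.le
  have u1 : Tendsto (fun x : ℕ × Cn N => x.1) U l := tendsto_fst.mono_left hU
  have u2 : Tendsto (fun x : ℕ × Cn N => x.2) U (𝓝 c.1) := tendsto_snd.mono_left hU
  have hv0 : v = 0 := by
    apply hN hρ v
    have hin : Tendsto (fun ζ : Cn N => (c.1, ζ)) (𝓝 c.2) (𝓝 c) :=
      (by fun_prop : Continuous _).tendsto' _ _ rfl
    filter_upwards [hin.eventually hS, hin.eventually hf2, hin.eventually he2, hin.eventually hRa,
      hin.eventually hWc, (cj_tendsto c.2).eventually (GSet_open hG)]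
      with ζ hS hf2 he2 hRa hWc hGζ hρζ
    obtain ⟨σ, hσ1, hσ2⟩ := hS hρζ
    have s1 : Tendsto (fun x : ℕ × Cn N => σ x.2) U (𝓝 ζ) := hσ1.comp u2
    have s2 : Tendsto (fun x : ℕ × Cn N => cj (σ x.2)) U (𝓝 (cj ζ)) := (cj_tendsto ζ).comp s1
    have s3 : Tendsto (fun x : ℕ × Cn N => (x.1, cj (σ x.2))) U (l ×ˢ 𝓝 (cj ζ)) :=
      u1.prodMk s2
    have s4 : Tendsto (fun x : ℕ × Cn N => (x.2, σ x.2)) U (𝓝 (c.1, ζ)) :=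
      u2.prodMk_nhds s1
    let f : ℕ × Cn N → Cn N' := fun x => Hn x.1 x.2 - H x.2
    let e : ℕ × Cn N → Cn N' := fun x => cj (Hn x.1 (cj (σ x.2)) - H (cj (σ x.2)))
    have hf0 : Tendsto f U (𝓝 0) := hf1.mono_left hU
    have he0' : Tendsto (fun x : ℕ × Cn N => Hn x.1 (cj (σ x.2)) - H (cj (σ x.2))) U (𝓝 0) :=
      hf2.comp s3
    have he0 : Tendsto e U (𝓝 0) := by
      have := (cj_tendsto (0 : Cn N')).comp he0'
      rwa [map_zero] at this
    have heO : e =o[(U : Filter _)] f := by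
      have b1 : (fun x : ℕ × Cn N => Hn x.1 (cj (σ x.2)) - H (cj (σ x.2))) =O[(U : Filter _)]
          fun x : ℕ × Cn N => a x.1 := IsBigO.comp_tendsto hGζ s3
      have b2 := b1.trans_isLittleO hUa
      refine IsBigO.trans_isLittleO (IsBigO.of_bound 1 (Eventually.of_forall fun x => ?_)) b2
      rw [one_mul]
      exact (cj.norm_map _).le
    have hQ : Tendsto (fun x : ℕ × Cn N => (H x.2, star' H (σ x.2))) U (𝓝 (H c.1, star' H ζ)) :=
      (he1.continuousAt.tendsto.comp u2).prodMk_nhds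
        ((star'_hol he2).continuousAt.tendsto.comp s1)
    have hPe : ∀ x : ℕ × Cn N, (Hn x.1 x.2, star' (Hn x.1) (σ x.2)) =
        ((H x.2, star' H (σ x.2)) : CC N') + (f x, e x) := by
      intro x
      simp [f, e, star']
    have hP : Tendsto (fun x : ℕ × Cn N => (Hn x.1 x.2, star' (Hn x.1) (σ x.2))) U
        (𝓝 (H c.1, star' H ζ)) := by
      have := hQ.add (hf0.prodMk_nhds he0)
      rw [Prod.mk_zero_zero, add_zero] at this
      exact this.congr fun x => (hPe x).symm
    have hρσ : ∀ᶠ x in (U : Filter (ℕ × Cn N)), D.ρ (x.2, σ x.2) = 0 := u2.eventually hσ2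
    have hWσ : ∀ᶠ x in (U : Filter (ℕ × Cn N)), (x.2, σ x.2) ∈ W := s4.eventually hWc
    refine linearize hRa.hasStrictFDerivAt hP hQ ?_ ?_ (f := f) (e := e)
      (fun x => by rw [hPe, add_sub_cancel_left]) heO hv
    · filter_upwards [u1.eventually hRn, hρσ, hWσ] with x h1 h2 h3
      exact h1 _ h3 h2
    · filter_upwards [hρσ, hWσ] with x h2 h3
      exact hRH _ h3 h2
  rw [hv0] at hv1
  simp at hv1

lemma spread (D : CData M p d) (hmin : IsMinimalAt M d p) {N' k : ℕ} {l : Filter ℕ}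
    {Hn : ℕ → Cn N → Cn N'}
    {H : Cn N → Cn N'} {R : CC N' → Cn k} (hH : HolNear H p)
    (hHn : ∀ᶠ z in 𝓝 p, Tendsto (fun x : ℕ × Cn N => Hn x.1 x.2 - H x.2) (l ×ˢ 𝓝 z) (𝓝 0))
    (hR : AnalyticAt ℂ R (H p, cj (H p)))
    {W : Set (CC N)} (hW : W ∈ 𝓝 ((p, cj p) : CC N))
    (hRn : ∀ᶠ n in l, ∀ c ∈ W, D.ρ c = 0 → R (Hn n c.1, star' (Hn n) c.2) = 0)
    (hRH : ∀ c ∈ W, D.ρ c = 0 → R (H c.1, star' H c.2) = 0)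
    (hnd : ∀ v : Cn N', (∀ᶠ ζ in 𝓝 (cj p), D.ρ (p, ζ) = 0 →
        fderiv ℂ R (H p, star' H ζ) (v, 0) = 0) → v = 0) :
    ∀ᶠ z in 𝓝 p, ∀ a : ℕ → ℝ, p ∈ GSet l Hn H a → z ∈ GSet l Hn H a := by
  have h1 := D.propagate hH hHn hR hW hRn hRH hnd
  have hsg : Tendsto (sg : CC N → CC N) (𝓝 (p, cj p)) (𝓝 (p, cj p)) := by
    have := (sg (N := N)).continuous.tendsto (p, cj p)
    simpa using this
  have h2 := hsg.eventually h1
  filter_upwards [D.orbit hmin (h1.and h2)] with z hz a hp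
  obtain ⟨ζ, hζ⟩ := hz
  have key : ∀ c : CC N, D.Reach {x |
      (D.ρ x = 0 → ∀ (a : ℕ → ℝ), cj x.2 ∈ GSet l Hn H a → x.1 ∈ GSet l Hn H a) ∧
        (D.ρ (sg x) = 0 → ∀ (a : ℕ → ℝ), cj (sg x).2 ∈ GSet l Hn H a →
          (sg x).1 ∈ GSet l Hn H a)} (p, cj p) c →
      c.1 ∈ GSet l Hn H a ∧ cj c.2 ∈ GSet l Hn H a := by
    intro c hc
    induction hc with
    | refl => exact ⟨hp, by simpa using hp⟩
    | tail _ hst ih =>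
      rename_i c1 c2 _
      obtain ⟨_, hc2, _, hρ, hor⟩ := hst
      rcases hor with h | h
      · have g1 : c2.1 ∈ GSet l Hn H a := h ▸ ih.1
        refine ⟨g1, ?_⟩
        have g2 : D.ρ (sg c2) = 0 := by rw [D.symm]; simp [hρ]
        have := hc2.2 g2 a (by simpa using g1)
        simpa using this
      · have g1 : cj c2.2 ∈ GSet l Hn H a := h ▸ ih.2
        exact ⟨hc2.1 hρ a g1, g1⟩
  exact (key _ hζ).1

end CData
end


namespace CData
open Filter Asymptotics
variable {N d : ℕ} {M : Set (Cn N)} {p : Cn N}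

lemma exists_W (D : CData M p d) {N' k : ℕ} {M' : Set (Cn N')} {H : Cn N → Cn N'}
    {R : CC N' → Cn k} (hR : AnalyticAt ℂ R (H p, cj (H p)))
    (hRz : ∀ᶠ w in 𝓝 (H p), w ∈ M' → R (w, cj w) = 0) {r : ℝ} (hr : 0 < r)
    (hd : DifferentiableOn ℂ H (Metric.ball p r)) :
    ∃ W ∈ 𝓝 ((p, cj p) : CC N), ∃ η : ℝ, 0 < η ∧ ∀ G : Cn N → Cn N',
      DifferentiableOn ℂ G (Metric.ball p r) → (∀ z ∈ M ∩ Metric.ball p r, G z ∈ M') →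
      (∀ z ∈ Metric.ball p r, ‖G z - H z‖ < η) →
      ∀ c ∈ W, D.ρ c = 0 → R (G c.1, star' G c.2) = 0 := by
  obtain ⟨η1, h1, hb1⟩ := Metric.eventually_nhds_iff_ball.1 hR.eventually_analyticAt
  obtain ⟨η2, h2, hb2⟩ := Metric.eventually_nhds_iff_ball.1 hRz
  have hpr : Metric.ball p r ∈ 𝓝 p := Metric.ball_mem_nhds _ hr
  have hHc : Tendsto H (𝓝 p) (𝓝 (H p)) := (hd.continuousOn.continuousAt hpr).tendsto
  have t1 : Tendsto (fun c : CC N => c.1) (𝓝 (p, cj p)) (𝓝 p) := continuous_fst.tendsto _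
  have t2 : Tendsto (fun c : CC N => cj c.2) (𝓝 (p, cj p)) (𝓝 p) :=
    (cj_tendsto' p).comp (continuous_snd.tendsto ((p, cj p) : CC N))
  let η := min η1 η2 / 2
  have hη : 0 < η := by positivity
  have hnear : ∀ᶠ z in 𝓝 p, z ∈ Metric.ball p r ∧ ‖H z - H p‖ < η := by
    have := hHc.eventually (Metric.ball_mem_nhds _ hη)
    filter_upwards [hpr, this] with z hz1 hz2
    exact ⟨hz1, by rwa [← dist_eq_norm]⟩
  obtain ⟨W, hW, hWid⟩ := D.ident ((t1.eventually hnear).and (t2.eventually hnear))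
  refine ⟨W, hW, η, hη, fun G hG hGM hGH => ?_⟩
  have hGp : ∀ z, z ∈ Metric.ball p r ∧ ‖H z - H p‖ < η → dist (G z) (H p) < min η1 η2 := by
    rintro z ⟨hz1, hz2⟩
    rw [dist_eq_norm]
    have : G z - H p = (G z - H z) + (H z - H p) := by abel
    rw [this]
    refine (norm_add_le _ _).trans_lt ?_
    have := hGH z hz1
    have e : η + η = min η1 η2 := by simp [η]
    linarith
  refine hWid (Cn k) (fun c => R (G c.1, star' G c.2)) ?_ ?_
  · rintro c ⟨hc1, hc2⟩
    have hm : (G c.1, star' G c.2) ∈ Metric.ball (H p, cj (H p)) η1 := by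
      rw [← ball_prod_same]
      refine ⟨(hGp _ hc1).trans_le (min_le_left _ _), ?_⟩
      have : dist (star' G c.2) (cj (H p)) = dist (G (cj c.2)) (H p) := cj.dist_map _ _
      rw [Metric.mem_ball, this]
      exact (hGp _ hc2).trans_le (min_le_left _ _)
    have d1 : DifferentiableAt ℂ G c.1 :=
      (hG _ hc1.1).differentiableAt (Metric.isOpen_ball.mem_nhds hc1.1)
    have d2 : DifferentiableAt ℂ G (cj c.2) :=
      (hG _ hc2.1).differentiableAt (Metric.isOpen_ball.mem_nhds hc2.1)
    have h4 : DifferentiableAt ℂ (fun c : CC N => (G c.1, star' G c.2)) c :=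
      (d1.comp c differentiableAt_fst).prodMk
        (DifferentiableAt.comp (g := star' G) c (star'_hol d2) differentiableAt_snd)
    exact (DifferentiableAt.comp (g := R) c (hb1 _ hm).differentiableAt h4).differentiableWithinAt
  · rintro z hz ⟨hc1, -⟩
    have := hb2 (G z) ((hGp _ hc1).trans_le (min_le_right _ _)) (hGM z ⟨hz, hc1.1⟩)
    simpa [star'] using this

end CData

lemma re_wirtD {n : ℕ} (f : Cn n → ℝ) (q v : Cn n) :
    (∑ j, wirtD f q j * v j).re = (1 / 2) * fderiv ℝ f q v := by
  have h1 : v = ∑ j, ((v j).re • cbasis j 1 + (v j).im • cbasis j Complex.I) := by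
    ext k
    simp only [cbasis, WithLp.ofLp_sum, Finset.sum_apply, WithLp.ofLp_add, WithLp.ofLp_smul,
      Pi.add_apply, Pi.smul_apply, PiLp.single_apply, Finset.sum_add_distrib]
    simp only [smul_ite, smul_zero, Finset.sum_ite_eq, Finset.mem_univ, if_true]
    apply Complex.ext <;> simp
  conv_rhs => rw [h1]
  rw [map_sum, Complex.re_sum, Finset.mul_sum]
  refine Finset.sum_congr rfl fun j _ => ?_
  rw [map_add, map_smul, map_smul]
  simp [wirtD]
  ring

open Filter Asymptotics in
/-- The limiting argument. -/
lemma limit_arg {N N' : ℕ} {M : Set (Cn N)} {p : Cn N} {M' : Set (Cn N')}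
    {H : Cn N → Cn N'} {Hn : ℕ → Cn N → Cn N'} {r : ℝ} (hr : 0 < r)
    (hH : DifferentiableOn ℂ H (Metric.ball p r))
    (hHM : ∀ z ∈ M ∩ Metric.ball p r, H z ∈ M')
    (hHn : ∀ n, DifferentiableOn ℂ (Hn n) (Metric.ball p r))
    (hHnM : ∀ n, ∀ z ∈ M ∩ Metric.ball p r, Hn n z ∈ M')
    (hclose : ∀ n, ∀ z ∈ Metric.ball p r, ‖Hn n z - H z‖ < 1 / ((n : ℝ) + 1))
    (hne : ∀ n, ¬ ∀ᶠ z in 𝓝 p, Hn n z = H z)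
    (hspread : ∀ z ∈ Metric.ball p r, ∀ a : ℕ → ℝ, p ∈ GSet (hyperfilter ℕ : Filter ℕ) Hn H a →
      z ∈ GSet (hyperfilter ℕ : Filter ℕ) Hn H a)
    (hhol : ∀ (Y : Cn N → Cn N') (ΩY : Set (Cn N)), InHol M p M' (H p) H Y ΩY →
      ∃ V, IsOpen V ∧ p ∈ V ∧ ∀ z ∈ V, Y z = 0) : False := by
  set l : Ultrafilter ℕ := hyperfilter ℕ with hl
  have hlt : (l : Filter ℕ) ≤ atTop := Nat.hyperfilter_le_atTop
  have hr2 : 0 < r / 2 := by positivity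
  have hsub : Metric.closedBall p (r / 2) ⊆ Metric.ball p r :=
    Metric.closedBall_subset_ball (by linarith)
  have hmax : ∀ n, ∃ z ∈ Metric.closedBall p (r / 2), ∀ w ∈ Metric.closedBall p (r / 2),
      ‖Hn n w - H w‖ ≤ ‖Hn n z - H z‖ := by
    intro n
    have hc : ContinuousOn (fun z => ‖Hn n z - H z‖) (Metric.closedBall p (r / 2)) :=
      (((hHn n).continuousOn.sub hH.continuousOn).norm).mono hsub
    obtain ⟨z, hz, hm⟩ := (isCompact_closedBall p (r / 2)).exists_isMaxOn
      ⟨p, Metric.mem_closedBall_self hr2.le⟩ hc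
    exact ⟨z, hz, fun w hw => hm hw⟩
  choose zn hzn hznmax using hmax
  let a : ℕ → ℝ := fun n => ‖Hn n (zn n) - H (zn n)‖
  have ha : ∀ n, 0 < a n := by
    intro n
    by_contra hcon
    have h0 : ‖Hn n (zn n) - H (zn n)‖ ≤ 0 := not_lt.1 hcon
    apply hne n
    filter_upwards [Metric.closedBall_mem_nhds p hr2] with w hw
    have := norm_le_zero_iff.1 ((hznmax n w hw).trans h0)
    exact sub_eq_zero.1 this
  have ha1 : ∀ n, a n < 1 / ((n : ℝ) + 1) := fun n => hclose n _ (hsub (hzn n))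
  have hpG : p ∈ GSet (l : Filter ℕ) Hn H a := by
    refine IsBigO.of_bound 1 ?_
    have : Tendsto (fun x : ℕ × Cn N => x.2) ((l : Filter ℕ) ×ˢ 𝓝 p) (𝓝 p) := tendsto_snd
    filter_upwards [this.eventually (Metric.closedBall_mem_nhds p hr2)] with x hx
    rw [one_mul, Real.norm_of_nonneg (ha _).le]
    exact hznmax _ _ hx
  let f : ℕ → Cn N → Cn N' := fun n z => ((a n)⁻¹ : ℝ) • (Hn n z - H z)
  have hfd : ∀ n, DifferentiableOn ℂ (f n) (Metric.ball p r) := by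
    intro n
    have h1 : DifferentiableOn ℂ (fun z => (((a n)⁻¹ : ℝ) : ℂ) • (Hn n z - H z))
        (Metric.ball p r) :=
      ((hHn n).sub hH).const_smul (((a n)⁻¹ : ℝ) : ℂ)
    exact h1
  have hfb : ∀ z ∈ Metric.ball p r, ∃ C s : ℝ, 0 < s ∧ Metric.ball z s ⊆ Metric.ball p r ∧
      ∀ᶠ n in (l : Filter ℕ), ∀ w ∈ Metric.ball z s, ‖f n w‖ ≤ C := by
    intro z hz
    obtain ⟨C, hC⟩ := IsBigO.bound (hspread z hz a hpG)
    obtain ⟨A, hA, B, hB, hAB⟩ := eventually_prod_iff.1 hC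
    obtain ⟨s, hs, hsb⟩ := Metric.eventually_nhds_iff_ball.1
      (hB.and (Metric.isOpen_ball.mem_nhds hz))
    refine ⟨C, s, hs, fun w hw => (hsb w hw).2, ?_⟩
    filter_upwards [hA] with n hn w hw
    have h1 : ‖Hn n w - H w‖ ≤ C * ‖a n‖ := hAB hn (hsb w hw).1
    rw [Real.norm_of_nonneg (ha _).le] at h1
    rw [norm_smul, norm_inv, Real.norm_of_nonneg (ha _).le, inv_mul_le_iff₀ (ha n)]
    linarith
  have hlim : ∀ z, ∃ y, z ∈ Metric.ball p r → Tendsto (fun n => f n z) l (𝓝 y) := by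
    intro z
    by_cases hz : z ∈ Metric.ball p r
    · obtain ⟨C, s, hs, -, hb⟩ := hfb z hz
      obtain ⟨y, -, hy⟩ := (isCompact_closedBall (0 : Cn N') C).ultrafilter_le_nhds'
        (l.map fun n => f n z) (Ultrafilter.mem_map.2 (by
          filter_upwards [hb] with n hn
          simpa using hn z (Metric.mem_ball_self hs)))
      exact ⟨y, fun _ => hy⟩
    · exact ⟨0, fun h => absurd h hz⟩
  choose Y hY using hlim
  have hYd : ∀ z ∈ Metric.ball p r, DifferentiableAt ℂ Y z := by
    intro z hz
    obtain ⟨C, s, hs, hsub', hb⟩ := hfb z hz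
    exact hol_ulim l hs (Eventually.of_forall fun n => (hfd n).mono hsub') hb
      fun x hx => hY x (hsub' hx)
  have hYd' : DifferentiableOn ℂ Y (Metric.ball p r) := fun z hz =>
    (hYd z hz).differentiableWithinAt
  obtain ⟨z0, hz0, hzt⟩ := (isCompact_closedBall p (r / 2)).ultrafilter_le_nhds' (l.map zn)
    (Ultrafilter.mem_map.2 (Eventually.of_forall hzn))
  have hzt' : Tendsto zn l (𝓝 z0) := hzt
  have hY1 : ‖Y z0‖ = 1 := by
    obtain ⟨C, s, hs, hsub', hb⟩ := hfb z0 (hsub hz0)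
    have e1 : Tendsto (fun n => f n (zn n) - f n z0) l (𝓝 0) := by
      have e2 : Tendsto (fun n => 2 * C / s * ‖zn n - z0‖) l (𝓝 0) := by
        have := (tendsto_iff_norm_sub_tendsto_zero.1 hzt').const_mul (2 * C / s)
        rwa [mul_zero] at this
      refine squeeze_zero_norm' ?_ e2
      filter_upwards [hb, hzt'.eventually (Metric.ball_mem_nhds z0 hs)] with n h1 h2
      exact hol_dist_bound hs ((hfd n).mono hsub') h1 _ h2
    have e3 : Tendsto (fun n => f n (zn n)) l (𝓝 (Y z0)) := by
      have := e1.add (hY z0 (hsub hz0))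
      simpa using this
    have e4 : ∀ n, ‖f n (zn n)‖ = 1 := by
      intro n
      rw [norm_smul, norm_inv, Real.norm_of_nonneg (ha _).le]
      exact inv_mul_cancel₀ (ha n).ne'
    have e5 := e3.norm
    simp only [e4] at e5
    exact (tendsto_nhds_unique e5 tendsto_const_nhds)
  have hin : InHol M p M' (H p) H Y (Metric.ball p r) := by
    refine ⟨Metric.isOpen_ball, Metric.mem_ball_self hr, hYd', ?_⟩
    intro ρ' U' hU' hpU' hρ' hz
    refine ⟨Metric.ball p r ∩ H ⁻¹' U',
      hH.continuousOn.isOpen_inter_preimage Metric.isOpen_ball hU',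
      ⟨Metric.mem_ball_self hr, hpU'⟩, ?_⟩
    rintro z ⟨hzM, hzr, hzU⟩
    have hzU' : H z ∈ U' := hzU
    rw [re_wirtD]
    have hdiff : HasFDerivAt ρ' (fderiv ℝ ρ' (H z)) (H z) :=
      (hρ' _ hzU').differentiableAt.hasFDerivAt
    have hd0 : Tendsto (fun n => Hn n z - H z) l (𝓝 0) := by
      refine squeeze_zero_norm (fun n => (hclose n z hzr).le) ?_
      exact tendsto_one_div_add_atTop_nhds_zero_nat.mono_left hlt
    have key := (hasFDerivWithinAt_univ.2 hdiff).lim (l := (l : Filter ℕ)) hd0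
      (Eventually.of_forall fun _ => Set.mem_univ _) (hY z hzr)
    have hx : Tendsto (fun n => Hn n z) l (𝓝 (H z)) := by
      have := hd0.add_const (H z)
      simpa using this
    have key2 : Tendsto (fun n => ((a n)⁻¹ : ℝ) • (ρ' (H z + (Hn n z - H z)) - ρ' (H z))) l
        (𝓝 0) := by
      refine tendsto_const_nhds.congr' ?_
      filter_upwards [hx.eventually (hU'.mem_nhds hzU')] with n hn
      rw [add_sub_cancel, hz _ ⟨hHnM n z ⟨hzM, hzr⟩, hn⟩, hz _ ⟨hHM z ⟨hzM, hzr⟩, hzU'⟩]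
      simp
    rw [tendsto_nhds_unique key key2, mul_zero]
  obtain ⟨V, hV, hpV, hV0⟩ := hhol Y _ hin
  have := hol_ball_zero hYd' (Metric.mem_ball_self hr)
    (by filter_upwards [hV.mem_nhds hpV] with z hz; exact hV0 z hz) z0 (hsub hz0)
  rw [this] at hY1
  simp at hY1

open Filter Asymptotics in
lemma main_aux
    {N N' d d' ℓ : ℕ} (M : Set (Cn N)) (p : Cn N)
    (hM : IsGenericAt M d p) (hmin : IsMinimalAt M d p)
    (M' : Set (Cn N')) (hM' : ∀ q ∈ M', IsGenericAt M' d' q)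
    (p' : Cn N') (hp' : p' ∈ M')
    (H : Cn N → Cn N') (Ω : Set (Cn N)) (hΩ : IsOpen Ω) (hpΩ : p ∈ Ω)
    (hH : DifferentiableOn ℂ H Ω) (hHp : H p = p') (hHM : ∀ z ∈ M ∩ Ω, H z ∈ M')
    (hnd : FinNondeg M p M' ℓ H)
    (hhol : ∀ (Y : Cn N → Cn N') (ΩY : Set (Cn N)), InHol M p M' p' H Y ΩY →
      ∃ V, IsOpen V ∧ p ∈ V ∧ ∀ z ∈ V, Y z = 0) :
    ∃ K : Set (Cn N), IsCompact K ∧ K ⊆ Ω ∧ K ∈ 𝓝 p ∧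
      ∃ δ : ℝ, 0 < δ ∧
        ∀ (Hnew : Cn N → Cn N') (Ω' : Set (Cn N)), IsOpen Ω' → K ⊆ Ω' →
          DifferentiableOn ℂ Hnew Ω' → (∀ z ∈ M ∩ K, Hnew z ∈ M') → Hnew p ∈ M' →
          FinNondeg M p M' ℓ Hnew → (∀ z ∈ K, ‖Hnew z - H z‖ < δ) →
          ∃ V, IsOpen V ∧ p ∈ V ∧ ∀ z ∈ V, Hnew z = H z := by
  subst hHp
  obtain ⟨r0, hr0, hr0Ω⟩ := Metric.nhds_basis_closedBall.mem_iff.1 (hΩ.mem_nhds hpΩ)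
  refine ⟨Metric.closedBall p r0, isCompact_closedBall _ _, hr0Ω,
    Metric.closedBall_mem_nhds p hr0, ?_⟩
  by_contra hcon
  have hcon' : ∀ n : ℕ, ∃ G : Cn N → Cn N', DifferentiableOn ℂ G (Metric.ball p r0) ∧
      (∀ z ∈ M ∩ Metric.ball p r0, G z ∈ M') ∧
      (∀ z ∈ Metric.ball p r0, ‖G z - H z‖ < 1 / ((n : ℝ) + 1)) ∧
      ¬ ∀ᶠ z in 𝓝 p, G z = H z := by
    intro n
    by_contra hc
    apply hcon
    refine ⟨1 / ((n : ℝ) + 1), by positivity, ?_⟩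
    intro G Ω' _ hK hG hGM _ _ hGH
    by_contra hV
    apply hc
    refine ⟨G, hG.mono (Metric.ball_subset_closedBall.trans hK),
      fun z hz => hGM z ⟨hz.1, Metric.ball_subset_closedBall hz.2⟩,
      fun z hz => hGH z (Metric.ball_subset_closedBall hz), ?_⟩
    intro hev
    apply hV
    obtain ⟨V, h1, h2, h3⟩ := eventually_nhds_iff.1 hev
    exact ⟨V, h2, h3, h1⟩
  choose Hn hHn hHnM hclose hne using hcon'
  have hHb : DifferentiableOn ℂ H (Metric.ball p r0) :=
    hH.mono (Metric.ball_subset_closedBall.trans hr0Ω)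
  have hHMb : ∀ z ∈ M ∩ Metric.ball p r0, H z ∈ M' := fun z hz =>
    hHM z ⟨hz.1, hr0Ω (Metric.ball_subset_closedBall hz.2)⟩
  have hHol : HolNear H p := by
    filter_upwards [Metric.isOpen_ball.mem_nhds (Metric.mem_ball_self hr0)] with z hz
    exact (hHb z hz).differentiableAt (Metric.isOpen_ball.mem_nhds hz)
  obtain ⟨D⟩ := exists_cdata hM
  obtain ⟨k, R, hR, hRz, hRn⟩ := D.exists_R hHol hnd
  obtain ⟨W, hW, η, hη, hWe⟩ := D.exists_W hR hRz hr0 hHb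
  have hlt : (hyperfilter ℕ : Filter ℕ) ≤ atTop := Nat.hyperfilter_le_atTop
  have hsp := D.spread hmin (l := (hyperfilter ℕ : Filter ℕ)) (Hn := Hn) hHol (by
      filter_upwards [Metric.isOpen_ball.mem_nhds (Metric.mem_ball_self hr0)] with z hz
      have t1 : Tendsto (fun x : ℕ × Cn N => 1 / ((x.1 : ℝ) + 1))
          ((hyperfilter ℕ : Filter ℕ) ×ˢ 𝓝 z) (𝓝 0) :=
        (tendsto_one_div_add_atTop_nhds_zero_nat.mono_left hlt).comp tendsto_fst
      refine squeeze_zero_norm' ?_ t1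
      have t2 : Tendsto (fun x : ℕ × Cn N => x.2) ((hyperfilter ℕ : Filter ℕ) ×ˢ 𝓝 z) (𝓝 z) :=
        tendsto_snd
      filter_upwards [t2.eventually (Metric.isOpen_ball.mem_nhds hz)] with x hx
      exact (hclose _ _ hx).le) hR hW (by
      have t1 := tendsto_one_div_add_atTop_nhds_zero_nat (𝕜 := ℝ)
      filter_upwards [hlt (t1.eventually (gt_mem_nhds hη))] with n hn
      exact hWe (Hn n) (hHn n) (hHnM n) fun z hz => (hclose n z hz).trans hn)
    (hWe H hHb hHMb fun z _ => by simpa using hη) hRn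
  obtain ⟨r, hr, hrb⟩ := Metric.eventually_nhds_iff_ball.1
    (hsp.and (Metric.isOpen_ball.mem_nhds (Metric.mem_ball_self hr0)))
  have hrr : Metric.ball p r ⊆ Metric.ball p r0 := fun z hz => (hrb z hz).2
  exact limit_arg hr (hHb.mono hrr) (fun z hz => hHMb z ⟨hz.1, hrr hz.2⟩)
    (fun n => (hHn n).mono hrr) (fun n z hz => hHnM n z ⟨hz.1, hrr hz.2⟩)
    (fun n z hz => hclose n z (hrr hz)) hne (fun z hz => (hrb z hz).1) hhol

/-- **Corollary (to Theorem 2.10).** If `𝔥𝔬𝔩(H) = 0` then `H` is isolated among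
finitely nondegenerate holomorphic maps of `M` into `M'`. -/
theorem map_isolated_of_no_infinitesimal_deformations
    {N N' d d' ℓ : ℕ} (M : Set (Cn N)) (p : Cn N)
    (hM : IsGenericAt M d p) (hmin : IsMinimalAt M d p)
    (M' : Set (Cn N')) (hM' : ∀ q ∈ M', IsGenericAt M' d' q)
    (p' : Cn N') (hp' : p' ∈ M')
    (H : Cn N → Cn N') (Ω : Set (Cn N)) (hΩ : IsOpen Ω) (hpΩ : p ∈ Ω)
    (hH : DifferentiableOn ℂ H Ω) (hHp : H p = p') (hHM : ∀ z ∈ M ∩ Ω, H z ∈ M')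
    (hnd : FinNondeg M p M' ℓ H)
    (hhol : ∀ (Y : Cn N → Cn N') (ΩY : Set (Cn N)), InHol M p M' p' H Y ΩY →
      ∃ V, IsOpen V ∧ p ∈ V ∧ ∀ z ∈ V, Y z = 0) :
    ∃ K : Set (Cn N), IsCompact K ∧ K ⊆ Ω ∧ K ∈ 𝓝 p ∧
      ∃ δ : ℝ, 0 < δ ∧
        ∀ (Hnew : Cn N → Cn N') (Ω' : Set (Cn N)), IsOpen Ω' → K ⊆ Ω' →
          DifferentiableOn ℂ Hnew Ω' → (∀ z ∈ M ∩ K, Hnew z ∈ M') → Hnew p ∈ M' →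
          FinNondeg M p M' ℓ Hnew → (∀ z ∈ K, ‖Hnew z - H z‖ < δ) →
          ∃ V, IsOpen V ∧ p ∈ V ∧ ∀ z ∈ V, Hnew z = H z :=
  main_aux M p hM hmin M' hM' p' hp' H Ω hΩ hpΩ hH hHp hHM hnd hhol

end
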